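/- Let d = 4 and for each n let G_n = Z_n^4 be the 4-dimensional discrete torus. Let X_1, X_2 be independent lazy random walks on G_n each started from the uniform distribution, and let A_i be the painted set as defined. Then the limit α_4 = lim_{m→∞} (1/(G(0;Z^4)^2 · log m)) · Σ_{y ∈ Z^4, |y| ≤ m} G(y;Z^4)^2 exists, is positive and finite, and lim_{n→∞} Var(|A_i|)/(n^4 log n) = α_4/4, where G(x;Z^4) = Σ_{t=0}^∞ p^t(0,x;Z^4) is the Green's function of lazy simple random walk on Z^4. -/

import Mathlib

open MeasureTheory ProbabilityTheory Filter

attribute [local instance] Classical.propDecidable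

noncomputable section

namespace RWPaint

variable {V : Type*} [Fintype V]

/-- The degree of a vertex. -/
def deg (G : SimpleGraph V) (x : V) : ℕ := (Finset.univ.filter fun y => G.Adj x y).card

/-- One-step transition kernel of the lazy random walk on a finite graph:
holding probability `1/2`, otherwise a uniformly chosen neighbour. -/
def K (G : SimpleGraph V) (x y : V) : ℝ :=
  if x = y then (if deg G x = 0 then 1 else 1 / 2)
  else if G.Adj x y then 1 / (2 * (deg G x : ℝ)) else 0

/-- The `t`-step transition kernel. -/
def Kpow (G : SimpleGraph V) : ℕ → V → V → ℝ
  | 0 => fun x y => if x = y then 1 else 0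
  | t + 1 => fun x y => ∑ z, Kpow G t x z * K G z y

/-- The uniform (stationary) probability of a single vertex. -/
def unif (V : Type*) [Fintype V] : ℝ := (Fintype.card V : ℝ)⁻¹

/-- The uniform mixing time. -/
def Tmix (G : SimpleGraph V) : ℕ :=
  sInf {t : ℕ | ∀ x y : V, |Kpow G t x y / unif V - 1| ≤ 1 / 4}

/-- The Green's function `g(x,y) = ∑_{t=0}^{Tmix} p^t(x,y)`. -/
def green (G : SimpleGraph V) (x y : V) : ℝ :=
  ∑ t ∈ Finset.range (Tmix G + 1), Kpow G t x y

/-- The kernel killed on (entering) the set `S`. -/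
def Kkill (G : SimpleGraph V) (S : Finset V) (x y : V) : ℝ :=
  if y ∈ S then 0 else K G x y

/-- Powers of the killed kernel. -/
def KkillPow (G : SimpleGraph V) (S : Finset V) : ℕ → V → V → ℝ
  | 0 => fun x y => if x = y then 1 else 0
  | t + 1 => fun x y => ∑ z, KkillPow G S t x z * Kkill G S z y

/-- `P_x[τ(S) ≤ T]`, the probability that the lazy walk started at `x` visits `S`
by time `T`. -/
def hitBy (G : SimpleGraph V) (S : Finset V) (x : V) (T : ℕ) : ℝ :=
  if x ∈ S then 1 else 1 - ∑ z, KkillPow G S T x z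

/-- `f_{n,c}(x,y) = P_x[τ(y) ≤ c T_mix]`. -/
def fnc (G : SimpleGraph V) (c : ℝ) (x y : V) : ℝ :=
  hitBy G {y} x ⌊c * (Tmix G : ℝ)⌋₊

/-- `f̄_{n,c} = ∑_y f_{n,c}(x,y) π(y)` (averaged also over `x`; by vertex
transitivity this agrees with the value for any fixed `x`). -/
def fbar (G : SimpleGraph V) (c : ℝ) : ℝ :=
  (∑ x : V, ∑ y : V, fnc G c x y) / (Fintype.card V : ℝ) ^ 2

/-- `F_{n,c} = ∑_{x,y} (f_{n,c}(x,y) - f̄_{n,c})^2`. -/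
def Fquad (G : SimpleGraph V) (c : ℝ) : ℝ :=
  ∑ x : V, ∑ y : V, (fnc G c x y - fbar G c) ^ 2

/-- `Γ_n = c₀ T_mix log |V|`. -/
def gammaTime (G : SimpleGraph V) (c₀ : ℝ) : ℕ :=
  ⌊c₀ * (Tmix G : ℝ) * Real.log (Fintype.card V)⌋₊

/-- `P_x[X_t = z | τ(y) ≥ t]` as a combinatorial formula (meaningful for
`x ≠ y` and `t ≥ 1`). -/
def condAtProb (G : SimpleGraph V) (y x z : V) (t : ℕ) : ℝ :=
  (∑ w, KkillPow G {y} (t - 1) x w * K G w z) / (∑ w, KkillPow G {y} (t - 1) x w)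

/-- `∑_{t=0}^{c T_mix} p^t(x,y)`. -/
def greenC (G : SimpleGraph V) (c : ℝ) (x y : V) : ℝ :=
  ∑ t ∈ Finset.range (⌊c * (Tmix G : ℝ)⌋₊ + 1), Kpow G t x y

/-- A graph is vertex transitive if its automorphism group acts transitively. -/
def IsVertexTransitive (G : SimpleGraph V) : Prop :=
  ∀ x y : V, ∃ e : G ≃g G, e x = y

/-- The probability of a trajectory prefix for the lazy walk with initial
distribution `init`. -/
def walkP (G : SimpleGraph V) (init : V → ℝ) (n : ℕ) (v : ℕ → V) : ℝ :=
  init (v 0) * ∏ i ∈ Finset.range n, K G (v i) (v (i + 1))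

/-- Point mass initial distribution. -/
def delta (x : V) : V → ℝ := fun y => if y = x then 1 else 0

/-- Uniform initial distribution. -/
def uinit (V : Type*) [Fintype V] : V → ℝ := fun _ => (Fintype.card V : ℝ)⁻¹

/-- `X₁, X₂` are independent lazy random walks on `G` with initial
distributions `init₁, init₂`, defined on the probability space `(Ω, P)`:
all finite-dimensional distributions factorize as products of trajectory-prefix
probabilities. -/
structure IsWalkPair {Ω : Type*} [MeasurableSpace Ω] (G : SimpleGraph V) (P : Measure Ω)
    (X₁ X₂ : ℕ → Ω → V) (init₁ init₂ : V → ℝ) : Prop where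
  meas₁ : ∀ (t : ℕ) (x : V), MeasurableSet {ω | X₁ t ω = x}
  meas₂ : ∀ (t : ℕ) (x : V), MeasurableSet {ω | X₂ t ω = x}
  law : ∀ (n : ℕ) (v w : ℕ → V),
    (P {ω | (∀ i ≤ n, X₁ i ω = v i) ∧ ∀ i ≤ n, X₂ i ω = w i}).toReal
      = walkP G init₁ n v * walkP G init₂ n w

/-- `X₁, X₂` are independent stationary lazy random walks on `G`, together with
a family `ξ` of independent fair coins (one per vertex, used to break ties),
all defined on the probability space `(Ω, P)`. -/
structure IsPaintSetup {Ω : Type*} [MeasurableSpace Ω] (G : SimpleGraph V) (P : Measure Ω)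
    (X₁ X₂ : ℕ → Ω → V) (ξ : V → Ω → Bool) : Prop where
  meas₁ : ∀ (t : ℕ) (x : V), MeasurableSet {ω | X₁ t ω = x}
  meas₂ : ∀ (t : ℕ) (x : V), MeasurableSet {ω | X₂ t ω = x}
  measξ : ∀ x : V, MeasurableSet {ω | ξ x ω = true}
  law : ∀ (n : ℕ) (v w : ℕ → V) (b : V → Bool),
    (P {ω | ((∀ i ≤ n, X₁ i ω = v i) ∧ ∀ i ≤ n, X₂ i ω = w i) ∧ ∀ x, ξ x ω = b x}).toReal
      = walkP G (uinit V) n v * walkP G (uinit V) n w * (1 / 2) ^ Fintype.card V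

/-- The hitting time `τ(x)` of a vertex `x` (with value `⊤` if `x` is never visited). -/
def hitTime {Ω : Type*} (X : ℕ → Ω → V) (x : V) (ω : Ω) : ℕ∞ :=
  ⨅ (s : ℕ) (_ : X s ω = x), (s : ℕ∞)

/-- `τ(x,y) = τ(x) ⊓ τ(y)`. -/
def hitTime2 {Ω : Type*} (X : ℕ → Ω → V) (x y : V) (ω : Ω) : ℕ∞ :=
  min (hitTime X x ω) (hitTime X y ω)

/-- `|𝒜₁|`: the number of vertices first visited by `X₁` (ties broken by the coins `ξ`). -/
def paintedCount {Ω : Type*} (X₁ X₂ : ℕ → Ω → V) (ξ : V → Ω → Bool) (ω : Ω) : ℕ :=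
  Nat.card {x : V // hitTime X₁ x ω < hitTime X₂ x ω ∨
    (hitTime X₁ x ω = hitTime X₂ x ω ∧ ξ x ω = true)}

/-- The event `H(x,y) = {τ₁(x) < min(τ₁(y), τ₂(x), τ₂(y))}`. -/
def Hevent {Ω : Type*} (X₁ X₂ : ℕ → Ω → V) (x y : V) : Set Ω :=
  {ω | hitTime X₁ x ω < min (hitTime X₁ y ω) (min (hitTime X₂ x ω) (hitTime X₂ y ω))}

/-- `Y₂ = X₂(τ₁(x,y))`. -/
def Ytwo {Ω : Type*} (X₁ X₂ : ℕ → Ω → V) (x y : V) (ω : Ω) : V :=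
  X₂ (hitTime2 X₁ x y ω).toNat ω

/-- `π̃(z;x,y) = P[X₂(τ₁(x,y)) = z | H(x,y)]`. -/
def pitilde {Ω : Type*} [MeasurableSpace Ω] (P : Measure Ω) (X₁ X₂ : ℕ → Ω → V) (x y z : V) : ℝ :=
  (P (Hevent X₁ X₂ x y ∩ {ω | Ytwo X₁ X₂ x y ω = z})).toReal
    / (P (Hevent X₁ X₂ x y)).toReal

/-- The event `A(x,y) = {τ₁(x,y) ≥ τ₂(x,y) > τ₁(x,y) - Γ, τ₁(x) < τ₁(y)}`. -/
def Aevent {Ω : Type*} (X₁ X₂ : ℕ → Ω → V) (x y : V) (Γ : ℕ) : Set Ω :=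
  {ω | hitTime2 X₂ x y ω ≤ hitTime2 X₁ x y ω ∧
    hitTime2 X₁ x y ω - (Γ : ℕ∞) < hitTime2 X₂ x y ω ∧
    hitTime X₁ x ω < hitTime X₁ y ω}

/-- Conditional probability `P[A | B]`. -/
def condGiven {Ω : Type*} [MeasurableSpace Ω] (P : Measure Ω) (A B : Set Ω) : ℝ :=
  (P (A ∩ B)).toReal / (P B).toReal

/-- Assumption 1 of the paper. -/
structure Assumption1 (V : ℕ → Type*) [∀ n, Fintype (V n)]
    (G : ∀ n, SimpleGraph (V n)) : Prop where
  conn : ∀ n, (G n).Connected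
  vt : ∀ n, IsVertexTransitive (G n)
  card_top : Tendsto (fun n => Fintype.card (V n)) atTop atTop
  tmix_small : Tendsto (fun n =>
    (Tmix (G n) : ℝ) * (Real.log (Fintype.card (V n))) ^ 2 / (Fintype.card (V n) : ℝ))
    atTop (nhds 0)
  tmix_top : Tendsto (fun n => Tmix (G n)) atTop atTop
  green_sq_small : ∃ ε : ℕ → ℝ, Tendsto ε atTop (nhds 0) ∧
    ∀ n, ∀ x : V n, ∑ y ∈ Finset.univ.erase x, (green (G n) x y) ^ 2
      ≤ ε n * (Tmix (G n) : ℝ) / Real.log (Fintype.card (V n))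
  hit_miss : ∃ ρ : ℝ, ρ < 1 ∧ ∀ n, ∀ x y z : V n, x ≠ y → x ≠ z → y ≠ z →
    hitBy (G n) {y, z} x (Tmix (G n)) ≤ ρ

/-- The discrete torus `ℤ_n^d`. -/
def torus (d n : ℕ) : SimpleGraph (Fin d → ZMod n) where
  Adj x y := x ≠ y ∧ ∃ i, y - x = Pi.single i 1 ∨ x - y = Pi.single i 1
  symm := by
    constructor
    rintro x y ⟨hne, i, h | h⟩
    · exact ⟨hne.symm, i, Or.inr h⟩
    · exact ⟨hne.symm, i, Or.inl h⟩
  loopless := ⟨fun x h => h.1 rfl⟩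

/-- The hypercube `ℤ_2^n`. -/
def hypercube (n : ℕ) : SimpleGraph (Fin n → Bool) where
  Adj x y := x ≠ y ∧ ∃ i, ∀ j, j ≠ i → x j = y j
  symm := by
    constructor
    rintro x y ⟨hne, i, h⟩
    exact ⟨hne.symm, i, fun j hj => (h j hj).symm⟩
  loopless := ⟨fun x h => h.1 rfl⟩

/-- The Cayley graph of the symmetric group `S_n` generated by the transpositions. -/
def transpositionGraph (n : ℕ) : SimpleGraph (Equiv.Perm (Fin n)) where
  Adj σ τ := (σ * τ⁻¹).IsSwap
  symm := by
    constructor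
    rintro σ τ ⟨a, b, hab, h⟩
    exact ⟨a, b, hab, by rw [show τ * σ⁻¹ = (σ * τ⁻¹)⁻¹ by group, h, Equiv.swap_inv]⟩
  loopless := by
    constructor
    intro σ h
    obtain ⟨a, b, hab, h⟩ := h
    rw [mul_inv_cancel] at h
    exact hab (by simpa [Equiv.swap_apply_left] using Equiv.ext_iff.mp h a)

/-- One-step kernel of the lazy simple random walk on `ℤ^d`. -/
def KZ (d : ℕ) (x y : Fin d → ℤ) : ℝ :=
  if x = y then 1 / 2
  else if ∃ i, y - x = Pi.single i 1 ∨ x - y = Pi.single i 1 then 1 / (4 * d) else 0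

/-- `t`-step kernel of the lazy simple random walk on `ℤ^d`. -/
def KZpow (d : ℕ) : ℕ → (Fin d → ℤ) → (Fin d → ℤ) → ℝ
  | 0 => fun x y => if x = y then 1 else 0
  | t + 1 => fun x y => ∑' z, KZpow d t x z * KZ d z y

/-- The Green's function `G(x; ℤ^d) = ∑_{t=0}^∞ p^t(0,x)` of the lazy walk on `ℤ^d`. -/
def greenZ (d : ℕ) (x : Fin d → ℤ) : ℝ := ∑' t : ℕ, KZpow d t 0 x

/-- `α_d` for `d ≥ 5`. -/
def alphaHigh (d : ℕ) : ℝ := (∑' y : Fin d → ℤ, (greenZ d y) ^ 2) / (greenZ d 0) ^ 2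

/-- The normalization `h_d(n)`. -/
def hfun (d n : ℕ) : ℝ :=
  if d = 3 then (n : ℝ) ^ 4
  else if d = 4 then (n : ℝ) ^ 4 * Real.log n
  else (n : ℝ) ^ d

/-- Matrix powers of an abstract kernel. -/
def mpow (p : V → V → ℝ) : ℕ → V → V → ℝ
  | 0 => fun x y => if x = y then 1 else 0
  | t + 1 => fun x y => ∑ z, mpow p t x z * p z y

/-- Total variation distance between two (probability) vectors. -/
def tvDist (μ ν : V → ℝ) : ℝ := (1 / 2) * ∑ x, |μ x - ν x|
set_option linter.unusedSectionVars false
set_option linter.deprecated false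
set_option linter.unusedVariables false
set_option linter.unusedSimpArgs false

section Helpers

variable {V : Type*} [Fintype V]

section Prob

variable {Ω : Type*} [MeasurableSpace Ω]

lemma integral_finite_rv {α : Type*} [Fintype α] (P : Measure Ω) [IsProbabilityMeasure P]
    (Y : Ω → α) (hY : ∀ a, MeasurableSet {ω | Y ω = a}) (f : α → ℝ) :
    Integrable (fun ω => f (Y ω)) P ∧
    ∫ ω, f (Y ω) ∂P = ∑ a, P.real {ω | Y ω = a} * f a := by
  have h1 : (fun ω => f (Y ω)) = fun ω => ∑ a, ({ω | Y ω = a}.indicator (fun _ => f a) ω) := by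
    funext ω
    rw [Finset.sum_eq_single (Y ω)]
    · simp
    · intro b _ hb
      simp [Set.indicator, Ne.symm hb]
    · simp
  have hi : ∀ a, Integrable ({ω | Y ω = a}.indicator (fun _ => f a)) P := fun a =>
    (integrable_const (f a)).indicator (hY a)
  constructor
  · rw [h1]
    exact integrable_finset_sum _ fun a _ => hi a
  · rw [h1, integral_finset_sum _ fun a _ => hi a]
    refine Finset.sum_congr rfl fun a _ => ?_
    rw [integral_indicator_const _ (hY a)]
    simp

def pre (X : ℕ → Ω → V) (H : ℕ) (ω : Ω) : Fin (H + 1) → V := fun i => X i ω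

def extp {H : ℕ} (v : Fin (H + 1) → V) (a : V) : ℕ → V :=
  fun i => if h : i < H + 1 then v ⟨i, h⟩ else a

lemma pre_eq_iff (X : ℕ → Ω → V) (H : ℕ) (ω : Ω) (v : Fin (H + 1) → V) (a : V) :
    pre X H ω = v ↔ ∀ i ≤ H, X i ω = extp v a i := by
  constructor
  · rintro rfl i hi
    simp [extp, pre, Nat.lt_succ_iff.2 hi]
  · intro h
    funext i
    have := h i (Nat.lt_succ_iff.1 i.2)
    simpa only [extp, i.2, dite_true, pre] using this

variable {G : SimpleGraph V} {P : Measure Ω} {X₁ X₂ : ℕ → Ω → V} {ξ : V → Ω → Bool}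

lemma IsPaintSetup.symm (hs : IsPaintSetup G P X₁ X₂ ξ) : IsPaintSetup G P X₂ X₁ ξ where
  meas₁ := hs.meas₂
  meas₂ := hs.meas₁
  measξ := hs.measξ
  law n v w b := by
    have := hs.law n w v b
    rw [mul_comm (walkP G (uinit V) n v), ← this]
    congr 3
    ext ω
    tauto

lemma measurable_pre {X : ℕ → Ω → V} (h : ∀ t x, MeasurableSet {ω | X t ω = x}) (H : ℕ)
    (v : Fin (H + 1) → V) : MeasurableSet {ω | pre X H ω = v} := by
  have : {ω | pre X H ω = v} = ⋂ i : Fin (H + 1), {ω | X i ω = v i} := by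
    ext ω
    simp [pre, funext_iff]
  rw [this]
  exact MeasurableSet.iInter fun i => h _ _

lemma setup_law [IsProbabilityMeasure P] (hs : IsPaintSetup G P X₁ X₂ ξ) (n : ℕ) (v w : ℕ → V) :
    P.real {ω | (∀ i ≤ n, X₁ i ω = v i) ∧ ∀ i ≤ n, X₂ i ω = w i}
      = walkP G (uinit V) n v * walkP G (uinit V) n w := by
  set A := {ω | (∀ i ≤ n, X₁ i ω = v i) ∧ ∀ i ≤ n, X₂ i ω = w i} with hA
  have hAm : MeasurableSet A := by
    have : A = (⋂ i : ℕ, ⋂ _ : i ≤ n, {ω | X₁ i ω = v i}) ∩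
      (⋂ i : ℕ, ⋂ _ : i ≤ n, {ω | X₂ i ω = w i}) := by
      ext ω; simp [hA]
    rw [this]
    exact (MeasurableSet.iInter fun i => MeasurableSet.iInter fun _ => hs.meas₁ _ _).inter
      (MeasurableSet.iInter fun i => MeasurableSet.iInter fun _ => hs.meas₂ _ _)
  have hb : ∀ b : V → Bool, MeasurableSet {ω | ∀ x, ξ x ω = b x} := by
    intro b
    have : {ω | ∀ x, ξ x ω = b x} = ⋂ x, {ω | ξ x ω = b x} := by ext ω; simp
    rw [this]
    refine MeasurableSet.iInter fun x => ?_
    cases hbx : b x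
    · have : {ω | ξ x ω = false} = {ω | ξ x ω = true}ᶜ := by ext ω; simp
      rw [this]; exact (hs.measξ x).compl
    · exact hs.measξ x
  have hU : A = ⋃ b ∈ (Finset.univ : Finset (V → Bool)), (A ∩ {ω | ∀ x, ξ x ω = b x}) := by
    ext ω
    simp only [Finset.mem_univ, Set.iUnion_true, Set.mem_iUnion, Set.mem_inter_iff,
      Set.mem_setOf_eq]
    exact ⟨fun h => ⟨fun x => ξ x ω, h, fun x => rfl⟩, fun ⟨b, h, _⟩ => h⟩
  rw [hU, measureReal_biUnion_finset]
  · have : ∀ b : V → Bool, P.real (A ∩ {ω | ∀ x, ξ x ω = b x}) =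
      walkP G (uinit V) n v * walkP G (uinit V) n w * (1 / 2) ^ Fintype.card V :=
      fun b => hs.law n v w b
    simp only [this]
    simp only [Finset.sum_const, Finset.card_univ, Fintype.card_pi, Fintype.card_bool,
      Finset.prod_const]
    rw [nsmul_eq_mul]
    push_cast
    rw [mul_left_comm, ← mul_pow]
    norm_num
  · intro b _ b' _ hbb
    refine Set.disjoint_left.2 fun ω h h' => hbb ?_
    funext x
    rw [← h.2 x, h'.2 x]
  · intro b _
    exact hAm.inter (hb b)

/-- adaptedness to the first `H` steps. -/
def Adp (X₁ X₂ : ℕ → Ω → V) (H : ℕ) (W : Ω → ℝ) : Prop :=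
  ∀ ω ω', (∀ i ≤ H, X₁ i ω = X₁ i ω') → (∀ i ≤ H, X₂ i ω = X₂ i ω') → W ω = W ω'

/-- adaptedness to a single walk. -/
def Adq (X : ℕ → Ω → V) (H : ℕ) (W : Ω → ℝ) : Prop :=
  ∀ ω ω', (∀ i ≤ H, X i ω = X i ω') → W ω = W ω'

lemma Adp.exists_fun {H : ℕ} {W : Ω → ℝ} (h : Adp X₁ X₂ H W) :
    ∃ f : (Fin (H + 1) → V) × (Fin (H + 1) → V) → ℝ,
      ∀ ω, W ω = f (pre X₁ H ω, pre X₂ H ω) := by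
  have hf : Function.FactorsThrough W (fun ω => (pre X₁ H ω, pre X₂ H ω)) := by
    intro ω ω' hh
    simp only [Prod.mk.injEq] at hh
    refine h ω ω' (fun i hi => ?_) (fun i hi => ?_)
    · exact congrFun hh.1 ⟨i, Nat.lt_succ_iff.2 hi⟩
    · exact congrFun hh.2 ⟨i, Nat.lt_succ_iff.2 hi⟩
  exact ⟨Function.extend (fun ω => (pre X₁ H ω, pre X₂ H ω)) W 0, fun ω =>
    (hf.extend_apply 0 ω).symm⟩

lemma Adq.exists_fun {X : ℕ → Ω → V} {H : ℕ} {W : Ω → ℝ} (h : Adq X H W) :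
    ∃ f : (Fin (H + 1) → V) → ℝ, ∀ ω, W ω = f (pre X H ω) := by
  have hf : Function.FactorsThrough W (pre X H) := by
    intro ω ω' hh
    exact h ω ω' (fun i hi => congrFun hh ⟨i, Nat.lt_succ_iff.2 hi⟩)
  exact ⟨Function.extend (pre X H) W 0, fun ω => (hf.extend_apply 0 ω).symm⟩

lemma measurable_pre2 (hs : IsPaintSetup G P X₁ X₂ ξ) (H : ℕ)
    (a : (Fin (H + 1) → V) × (Fin (H + 1) → V)) :
    MeasurableSet {ω | (pre X₁ H ω, pre X₂ H ω) = a} := by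
  have : {ω | (pre X₁ H ω, pre X₂ H ω) = a} =
      {ω | pre X₁ H ω = a.1} ∩ {ω | pre X₂ H ω = a.2} := by
    ext ω; simp [Prod.ext_iff]
  rw [this]
  exact (measurable_pre hs.meas₁ _ _).inter (measurable_pre hs.meas₂ _ _)

lemma Adp.integrable [IsProbabilityMeasure P] (hs : IsPaintSetup G P X₁ X₂ ξ) {H : ℕ}
    {W : Ω → ℝ} (h : Adp X₁ X₂ H W) : Integrable W P := by
  obtain ⟨f, hf⟩ := h.exists_fun
  have := (integral_finite_rv P (fun ω => (pre X₁ H ω, pre X₂ H ω))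
    (measurable_pre2 hs H) f).1
  simpa [← hf] using this

lemma Adq.adp₁ {H : ℕ} {W : Ω → ℝ} (h : Adq X₁ H W) : Adp X₁ X₂ H W :=
  fun ω ω' h1 _ => h ω ω' h1

lemma Adq.adp₂ {H : ℕ} {W : Ω → ℝ} (h : Adq X₂ H W) : Adp X₁ X₂ H W :=
  fun ω ω' _ h2 => h ω ω' h2

lemma Adp.mono {H H' : ℕ} (hH : H ≤ H') {W : Ω → ℝ} (h : Adp X₁ X₂ H W) : Adp X₁ X₂ H' W :=
  fun ω ω' h1 h2 => h ω ω' (fun i hi => h1 i (hi.trans hH)) (fun i hi => h2 i (hi.trans hH))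

lemma Adp.mul {H : ℕ} {W W' : Ω → ℝ} (h : Adp X₁ X₂ H W) (h' : Adp X₁ X₂ H W') :
    Adp X₁ X₂ H (fun ω => W ω * W' ω) :=
  fun ω ω' h1 h2 => by simp only [h ω ω' h1 h2, h' ω ω' h1 h2]

lemma Adp.add {H : ℕ} {W W' : Ω → ℝ} (h : Adp X₁ X₂ H W) (h' : Adp X₁ X₂ H W') :
    Adp X₁ X₂ H (fun ω => W ω + W' ω) :=
  fun ω ω' h1 h2 => by simp only [h ω ω' h1 h2, h' ω ω' h1 h2]

lemma Adp.sub {H : ℕ} {W W' : Ω → ℝ} (h : Adp X₁ X₂ H W) (h' : Adp X₁ X₂ H W') :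
    Adp X₁ X₂ H (fun ω => W ω - W' ω) :=
  fun ω ω' h1 h2 => by simp only [h ω ω' h1 h2, h' ω ω' h1 h2]

lemma Adp.sum {ι : Type*} {s : Finset ι} {H : ℕ} {W : ι → Ω → ℝ}
    (h : ∀ i ∈ s, Adp X₁ X₂ H (W i)) : Adp X₁ X₂ H (fun ω => ∑ i ∈ s, W i ω) :=
  fun ω ω' h1 h2 => Finset.sum_congr rfl fun i hi => h i hi ω ω' h1 h2

lemma Adp.coord (X₁ X₂ : ℕ → Ω → V) {t H : ℕ} (ht : t ≤ H) (F : V → V → ℝ) :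
    Adp X₁ X₂ H (fun ω => F (X₁ t ω) (X₂ t ω)) :=
  fun ω ω' h1 h2 => by simp only [h1 t ht, h2 t ht]

lemma walkP_congr (G : SimpleGraph V) (u : V → ℝ) (n : ℕ) (v w : ℕ → V) (h : ∀ i ≤ n, v i = w i) :
    walkP G u n v = walkP G u n w := by
  unfold walkP
  rw [h 0 (Nat.zero_le _)]
  congr 1
  refine Finset.prod_congr rfl fun i hi => ?_
  have := Finset.mem_range.1 hi
  rw [h i (by omega), h (i + 1) (by omega)]

/-- weight of a finite path -/
def pw (G : SimpleGraph V) {H : ℕ} (v : Fin (H + 1) → V) : ℝ :=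
  walkP G (uinit V) H (extp v (v 0))

lemma setup_law_pre [IsProbabilityMeasure P] (hs : IsPaintSetup G P X₁ X₂ ξ) (H : ℕ)
    (a : (Fin (H + 1) → V) × (Fin (H + 1) → V)) :
    P.real {ω | (pre X₁ H ω, pre X₂ H ω) = a} = pw G a.1 * pw G a.2 := by
  rw [pw, pw, ← setup_law hs]
  congr 1
  ext ω
  simp only [Set.mem_setOf_eq, Prod.ext_iff]
  rw [← pre_eq_iff, ← pre_eq_iff]

lemma setup_law_step [IsProbabilityMeasure P] (hs : IsPaintSetup G P X₁ X₂ ξ) (H : ℕ)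
    (a : (Fin (H + 1) → V) × (Fin (H + 1) → V)) (c d : V) :
    P.real {ω | ((pre X₁ H ω, pre X₂ H ω), (X₁ (H + 1) ω, X₂ (H + 1) ω)) = (a, (c, d))}
      = pw G a.1 * pw G a.2 * (K G (a.1 (Fin.last H)) c * K G (a.2 (Fin.last H)) d) := by
  have h1 : ∀ (v : Fin (H + 1) → V) (c : V), walkP G (uinit V) (H + 1) (extp v c) =
      pw G v * K G (v (Fin.last H)) c := by
    intro v c
    have : walkP G (uinit V) (H + 1) (extp v c) = walkP G (uinit V) H (extp v c) *
      K G (extp v c H) (extp v c (H + 1)) := by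
      unfold walkP; rw [Finset.prod_range_succ, mul_assoc]
    rw [this, pw, walkP_congr G _ H (extp v c) (extp v (v 0))]
    · congr 1
      simp [extp, Fin.last]
    · intro i hi
      simp [extp, Nat.lt_succ_iff.2 hi]
  rw [show pw G a.1 * pw G a.2 * (K G (a.1 (Fin.last H)) c * K G (a.2 (Fin.last H)) d) =
    (pw G a.1 * K G (a.1 (Fin.last H)) c) * (pw G a.2 * K G (a.2 (Fin.last H)) d) by ring,
    ← h1, ← h1, ← setup_law hs]
  congr 1
  ext ω
  simp only [Set.mem_setOf_eq, Prod.ext_iff]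
  rw [pre_eq_iff _ _ _ _ c, pre_eq_iff _ _ _ _ d]
  have key : ∀ (X : ℕ → Ω → V) (v : Fin (H + 1) → V) (c : V), (∀ i ≤ H + 1, X i ω = extp v c i) ↔
      (∀ i ≤ H, X i ω = extp v c i) ∧ X (H + 1) ω = c := by
    intro X v c
    constructor
    · intro h
      refine ⟨fun i hi => h i (by omega), ?_⟩
      have := h (H + 1) le_rfl
      simpa [extp] using this
    · rintro ⟨h, h'⟩ i hi
      rcases Nat.lt_or_ge i (H + 1) with hl | hl
      · exact h i (by omega)
      · have : i = H + 1 := by omega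
        subst this
        simpa [extp] using h'
  rw [key, key]
  tauto

theorem markov [IsProbabilityMeasure P] (hs : IsPaintSetup G P X₁ X₂ ξ) {H : ℕ} {W : Ω → ℝ}
    (hW : Adp X₁ X₂ H W) (F : V → V → ℝ) :
    ∫ ω, W ω * F (X₁ (H + 1) ω) (X₂ (H + 1) ω) ∂P =
      ∫ ω, W ω * (∑ a, ∑ b, K G (X₁ H ω) a * K G (X₂ H ω) b * F a b) ∂P := by
  obtain ⟨f, hf⟩ := hW.exists_fun
  have e1 := (integral_finite_rv P
    (fun ω => ((pre X₁ H ω, pre X₂ H ω), (X₁ (H + 1) ω, X₂ (H + 1) ω)))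
    (fun a => by
      have : {ω | ((pre X₁ H ω, pre X₂ H ω), (X₁ (H + 1) ω, X₂ (H + 1) ω)) = a} =
        {ω | (pre X₁ H ω, pre X₂ H ω) = a.1} ∩ ({ω | X₁ (H + 1) ω = a.2.1} ∩
          {ω | X₂ (H + 1) ω = a.2.2}) := by
        ext ω; simp [Prod.ext_iff]
      rw [this]
      exact (measurable_pre2 hs H _).inter ((hs.meas₁ _ _).inter (hs.meas₂ _ _)))
    (fun a => f a.1 * F a.2.1 a.2.2)).2
  have e2 := (integral_finite_rv P
    (fun ω => (pre X₁ H ω, pre X₂ H ω)) (measurable_pre2 hs H)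
    (fun a => f a * (∑ c, ∑ d, K G (a.1 (Fin.last H)) c * K G (a.2 (Fin.last H)) d * F c d))).2
  simp only [← hf] at e1 e2
  have e3 : ∀ X : ℕ → Ω → V, ∀ ω, pre X H ω (Fin.last H) = X H ω := fun X ω => rfl
  simp only [e3] at e2
  rw [e1, e2, Fintype.sum_prod_type]
  refine Finset.sum_congr rfl fun a _ => ?_
  rw [Fintype.sum_prod_type, setup_law_pre hs, Finset.mul_sum, Finset.mul_sum]
  refine Finset.sum_congr rfl fun c _ => ?_
  rw [Finset.mul_sum, Finset.mul_sum]
  refine Finset.sum_congr rfl fun d _ => ?_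
  rw [setup_law_step hs]
  ring

theorem init_law [IsProbabilityMeasure P] (hs : IsPaintSetup G P X₁ X₂ ξ) (F : V → V → ℝ) :
    ∫ ω, F (X₁ 0 ω) (X₂ 0 ω) ∂P =
      ∑ a, ∑ b, (Fintype.card V : ℝ)⁻¹ * (Fintype.card V : ℝ)⁻¹ * F a b := by
  have e1 := (integral_finite_rv P
    (fun ω => (X₁ 0 ω, X₂ 0 ω))
    (fun a => by
      have : {ω | (X₁ 0 ω, X₂ 0 ω) = a} = ({ω | X₁ 0 ω = a.1} ∩ {ω | X₂ 0 ω = a.2}) := by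
        ext ω; simp [Prod.ext_iff]
      rw [this]
      exact ((hs.meas₁ _ _).inter (hs.meas₂ _ _)))
    (fun a => F a.1 a.2)).2
  simp only at e1
  rw [e1, Fintype.sum_prod_type]
  refine Finset.sum_congr rfl fun a _ => Finset.sum_congr rfl fun b _ => ?_
  congr 1
  have := setup_law hs 0 (fun _ => a) (fun _ => b)
  simp only [walkP, uinit, Finset.range_zero, Finset.prod_empty, mul_one] at this
  rw [← this]
  congr 1
  ext ω
  simp

theorem indep_walks [IsProbabilityMeasure P] (hs : IsPaintSetup G P X₁ X₂ ξ) {H : ℕ}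
    {U W : Ω → ℝ} (hU : Adq X₁ H U) (hW : Adq X₂ H W) :
    ∫ ω, U ω * W ω ∂P = (∫ ω, U ω ∂P) * ∫ ω, W ω ∂P := by
  obtain ⟨u, hu⟩ := hU.exists_fun
  obtain ⟨w, hw⟩ := hW.exists_fun
  have key : ∀ (u w : (Fin (H + 1) → V) → ℝ), ∫ ω, u (pre X₁ H ω) * w (pre X₂ H ω) ∂P =
      (∑ a, pw G a * u a) * ∑ b, pw G b * w b := by
    intro u w
    have := (integral_finite_rv P
      (fun ω => (pre X₁ H ω, pre X₂ H ω)) (measurable_pre2 hs H) (fun a => u a.1 * w a.2)).2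
    simp only at this
    rw [this, Fintype.sum_prod_type, Finset.sum_mul_sum]
    refine Finset.sum_congr rfl fun a _ => Finset.sum_congr rfl fun b _ => ?_
    rw [setup_law_pre hs]
    ring
  have k1 := key u w
  have k2 := key u (fun _ => 1)
  have k3 := key (fun _ => 1) w
  have k4 := key (fun _ => 1) (fun _ => 1)
  simp only [mul_one, one_mul, integral_const, probReal_univ, smul_eq_mul] at k2 k3 k4
  simp only [hu, hw, k1, k2, k3]
  rw [mul_mul_mul_comm, mul_comm (∑ a, pw G a * u a) (∑ a, pw G a), mul_mul_mul_comm, ← k4, one_mul]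

end Prob

section Stop

variable {Ω : Type*} [MeasurableSpace Ω]

def aliveP (X₁ X₂ : ℕ → Ω → V) (B : V → V → Prop) (H : ℕ) (ω : Ω) : Prop :=
  ∀ i ≤ H, ¬ B (X₁ i ω) (X₂ i ω)

def al (X₁ X₂ : ℕ → Ω → V) (B : V → V → Prop) (H : ℕ) (ω : Ω) : ℝ :=
  if aliveP X₁ X₂ B H ω then 1 else 0

def sg (X₁ X₂ : ℕ → Ω → V) (B : V → V → Prop) : ℕ → Ω → ℕ
  | 0, _ => 0
  | H + 1, ω => if aliveP X₁ X₂ B H ω then H + 1 else sg X₁ X₂ B H ω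

def stv (X₁ X₂ : ℕ → Ω → V) (B : V → V → Prop) (F : V → V → ℝ) (H : ℕ) (ω : Ω) : ℝ :=
  F (X₁ (sg X₁ X₂ B H ω) ω) (X₂ (sg X₁ X₂ B H ω) ω)

def op2 (G : SimpleGraph V) (F : V → V → ℝ) (a b : V) : ℝ :=
  ∑ c, ∑ d, K G a c * K G b d * F c d

variable {X₁ X₂ : ℕ → Ω → V} {B : V → V → Prop}

lemma sg_le (H : ℕ) (ω : Ω) : sg X₁ X₂ B H ω ≤ H := by
  induction H with
  | zero => simp [sg]
  | succ H ih =>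
    rw [sg]; split_ifs
    · exact le_rfl
    · omega

lemma aliveP.mono {H H' : ℕ} {ω : Ω} (h : aliveP X₁ X₂ B H' ω) (hH : H ≤ H') :
    aliveP X₁ X₂ B H ω := fun i hi => h i (hi.trans hH)

lemma sg_of_alive {H : ℕ} {ω : Ω} (h : aliveP X₁ X₂ B H ω) : sg X₁ X₂ B H ω = H := by
  cases H with
  | zero => rfl
  | succ H => rw [sg, if_pos (h.mono (Nat.le_succ H))]

lemma sg_hit {H : ℕ} {ω : Ω} (h : ¬ aliveP X₁ X₂ B H ω) :
    B (X₁ (sg X₁ X₂ B H ω) ω) (X₂ (sg X₁ X₂ B H ω) ω) ∧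
      ∀ i < sg X₁ X₂ B H ω, ¬ B (X₁ i ω) (X₂ i ω) := by
  induction H with
  | zero =>
    simp only [aliveP, Nat.le_zero, forall_eq, not_not] at h
    exact ⟨h, fun i hi => absurd hi (Nat.not_lt_zero _)⟩
  | succ H ih =>
    rw [sg]
    split_ifs with h1
    · constructor
      · by_contra h2
        exact h fun i hi => by
          rcases Nat.lt_or_ge i (H + 1) with h3 | h3
          · exact h1 i (by omega)
          · have : i = H + 1 := by omega
            subst this; exact h2
      · exact fun i hi => h1 i (by omega)
    · exact ih h1

lemma stv_succ (F : V → V → ℝ) (H : ℕ) (ω : Ω) :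
    stv X₁ X₂ B F (H + 1) ω = stv X₁ X₂ B F H ω +
      al X₁ X₂ B H ω * (F (X₁ (H + 1) ω) (X₂ (H + 1) ω) - F (X₁ H ω) (X₂ H ω)) := by
  unfold stv al
  by_cases h : aliveP X₁ X₂ B H ω
  · rw [sg, if_pos h, if_pos h, sg_of_alive h]; ring
  · rw [sg, if_neg h, if_neg h]; ring

lemma adp_al (H : ℕ) : Adp X₁ X₂ H (al X₁ X₂ B H) := by
  intro ω ω' h1 h2
  have : aliveP X₁ X₂ B H ω ↔ aliveP X₁ X₂ B H ω' := by
    unfold aliveP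
    exact forall₂_congr fun i hi => by rw [h1 i hi, h2 i hi]
  simp only [al, this]

lemma adp_stv (F : V → V → ℝ) (H : ℕ) : Adp X₁ X₂ H (stv X₁ X₂ B F H) := by
  induction H with
  | zero => exact Adp.coord X₁ X₂ le_rfl F
  | succ H ih =>
    have : stv X₁ X₂ B F (H + 1) = fun ω => stv X₁ X₂ B F H ω +
      al X₁ X₂ B H ω * (F (X₁ (H + 1) ω) (X₂ (H + 1) ω) - F (X₁ H ω) (X₂ H ω)) := by
      funext ω; exact stv_succ F H ω
    rw [this]
    exact (ih.mono (Nat.le_succ H)).add (((adp_al H).mono (Nat.le_succ H)).mul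
      ((Adp.coord X₁ X₂ le_rfl F).sub (Adp.coord X₁ X₂ (Nat.le_succ H) F)))

variable {G : SimpleGraph V} {P : Measure Ω} [IsProbabilityMeasure P]
  {ξ : V → Ω → Bool}

lemma markov_diff (hs : IsPaintSetup G P X₁ X₂ ξ) {H : ℕ} {W : Ω → ℝ}
    (hW : Adp X₁ X₂ H W) (F : V → V → ℝ) :
    ∫ ω, W ω * (F (X₁ (H + 1) ω) (X₂ (H + 1) ω) - F (X₁ H ω) (X₂ H ω)) ∂P =
      ∫ ω, W ω * (op2 G F (X₁ H ω) (X₂ H ω) - F (X₁ H ω) (X₂ H ω)) ∂P := by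
  have i1 : Integrable (fun ω => W ω * F (X₁ (H + 1) ω) (X₂ (H + 1) ω)) P :=
    ((hW.mono (Nat.le_succ H)).mul (Adp.coord X₁ X₂ le_rfl F)).integrable hs
  have i2 : Integrable (fun ω => W ω * F (X₁ H ω) (X₂ H ω)) P :=
    (hW.mul (Adp.coord X₁ X₂ le_rfl F)).integrable hs
  have i3 : Integrable (fun ω => W ω * op2 G F (X₁ H ω) (X₂ H ω)) P :=
    (hW.mul (Adp.coord X₁ X₂ le_rfl (op2 G F))).integrable hs
  simp only [mul_sub]
  rw [integral_sub i1 i2, integral_sub i3 i2, markov hs hW F]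
  rfl

/-- if `F` has drift `c` on the complement of `B` and `W` vanishes when not alive -/
lemma markov_drift (hs : IsPaintSetup G P X₁ X₂ ξ) {H : ℕ} {W : Ω → ℝ}
    (hW : Adp X₁ X₂ H W) (F : V → V → ℝ) (c : ℝ)
    (hF : ∀ a b, ¬ B a b → op2 G F a b - F a b = c)
    (h0 : ∀ ω, ¬ aliveP X₁ X₂ B H ω → W ω = 0) :
    ∫ ω, W ω * (F (X₁ (H + 1) ω) (X₂ (H + 1) ω) - F (X₁ H ω) (X₂ H ω)) ∂P =
      c * ∫ ω, W ω ∂P := by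
  rw [markov_diff hs hW F, ← integral_const_mul]
  congr 1
  funext ω
  by_cases h : aliveP X₁ X₂ B H ω
  · rw [hF _ _ (h H le_rfl), mul_comm]
  · rw [h0 ω h]; ring

lemma al_of_not {H : ℕ} (ω : Ω) (h : ¬ aliveP X₁ X₂ B H ω) : al X₁ X₂ B H ω = 0 := if_neg h

lemma dynkin (hs : IsPaintSetup G P X₁ X₂ ξ) (F : V → V → ℝ) (c : ℝ)
    (hF : ∀ a b, ¬ B a b → op2 G F a b - F a b = c) (H : ℕ) :
    ∫ ω, stv X₁ X₂ B F H ω ∂P = ∫ ω, F (X₁ 0 ω) (X₂ 0 ω) ∂P +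
      c * ∑ j ∈ Finset.range H, ∫ ω, al X₁ X₂ B j ω ∂P := by
  induction H with
  | zero => simp [stv, sg]
  | succ H ih =>
    simp only [stv_succ]
    rw [integral_add ((adp_stv F H).integrable hs)
      (((((adp_al H).mono (Nat.le_succ H)).mul
      ((Adp.coord X₁ X₂ le_rfl F).sub (Adp.coord X₁ X₂ (Nat.le_succ H) F)))).integrable hs), ih,
      markov_drift hs (adp_al H) F c hF al_of_not, Finset.sum_range_succ]
    ring

lemma al_nonneg (H : ℕ) (ω : Ω) : 0 ≤ al X₁ X₂ B H ω := by
  unfold al; split_ifs <;> norm_num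

lemma al_anti {H H' : ℕ} (h : H ≤ H') (ω : Ω) : al X₁ X₂ B H' ω ≤ al X₁ X₂ B H ω := by
  unfold al
  split_ifs with h1 h2
  · exact le_rfl
  · exact absurd (h1.mono h) h2
  · norm_num
  · exact le_rfl

lemma integral_add4 {f0 f1 f2 f3 : Ω → ℝ} (h0 : Integrable f0 P) (h1 : Integrable f1 P)
    (h2 : Integrable f2 P) (h3 : Integrable f3 P) :
    ∫ ω, (f0 ω + (f1 ω + (f2 ω + f3 ω))) ∂P =
      ∫ ω, f0 ω ∂P + (∫ ω, f1 ω ∂P + (∫ ω, f2 ω ∂P + ∫ ω, f3 ω ∂P)) := by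
  have a : Integrable (fun ω => f2 ω + f3 ω) P := h2.add h3
  have b : Integrable (fun ω => f1 ω + (f2 ω + f3 ω)) P := h1.add a
  rw [integral_add h0 b, integral_add h1 a, integral_add h2 h3]

lemma stv_mul (hs : IsPaintSetup G P X₁ X₂ ξ) {B' : V → V → Prop} (F F' : V → V → ℝ)
    (hF : ∀ a b, ¬ B a b → op2 G F a b - F a b = 0)
    (hF' : ∀ a b, ¬ B' a b → op2 G F' a b - F' a b = 0) (H : ℕ) :
    ∫ ω, stv X₁ X₂ B F H ω * stv X₁ X₂ B' F' H ω ∂P =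
      ∫ ω, stv X₁ X₂ (fun a b => B a b ∨ B' a b) (fun a b => F a b * F' a b) H ω ∂P := by
  induction H with
  | zero => simp [stv, sg]
  | succ H ih =>
    set C : V → V → Prop := fun a b => B a b ∨ B' a b with hC
    set dF : Ω → ℝ := fun ω => F (X₁ (H + 1) ω) (X₂ (H + 1) ω) - F (X₁ H ω) (X₂ H ω) with hdF
    set dF' : Ω → ℝ := fun ω => F' (X₁ (H + 1) ω) (X₂ (H + 1) ω) - F' (X₁ H ω) (X₂ H ω) with hdF'
    have hal : ∀ ω, al X₁ X₂ B H ω * al X₁ X₂ B' H ω = al X₁ X₂ C H ω := by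
      intro ω
      have : aliveP X₁ X₂ C H ω ↔ aliveP X₁ X₂ B H ω ∧ aliveP X₁ X₂ B' H ω := by
        simp only [aliveP, hC, not_or]
        exact ⟨fun h => ⟨fun i hi => (h i hi).1, fun i hi => (h i hi).2⟩,
          fun h i hi => ⟨h.1 i hi, h.2 i hi⟩⟩
      unfold al
      simp only [this]
      split_ifs <;> simp_all
    have aH : H ≤ H + 1 := Nat.le_succ H
    have adF : Adp X₁ X₂ (H + 1) dF :=
      (Adp.coord X₁ X₂ le_rfl F).sub (Adp.coord X₁ X₂ aH F)
    have adF' : Adp X₁ X₂ (H + 1) dF' :=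
      (Adp.coord X₁ X₂ le_rfl F').sub (Adp.coord X₁ X₂ aH F')
    have aC : Adp X₁ X₂ H (al X₁ X₂ C H) := adp_al H
    have z1 : ∫ ω, (al X₁ X₂ B H ω * stv X₁ X₂ B' F' H ω) * dF ω ∂P = 0 := by
      rw [markov_drift (B := B) hs ((adp_al H).mul (adp_stv F' H)) F 0 hF
        (fun ω h => by rw [al_of_not ω h, zero_mul]), zero_mul]
    have z2 : ∫ ω, (al X₁ X₂ B' H ω * stv X₁ X₂ B F H ω) * dF' ω ∂P = 0 := by
      rw [markov_drift (B := B') hs ((adp_al H).mul (adp_stv F H)) F' 0 hF'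
        (fun ω h => by rw [al_of_not ω h, zero_mul]), zero_mul]
    have z3 : ∫ ω, (al X₁ X₂ C H ω * F' (X₁ H ω) (X₂ H ω)) * dF ω ∂P = 0 := by
      rw [markov_drift (B := C) hs (aC.mul (Adp.coord X₁ X₂ le_rfl F')) F 0
        (fun a b h => hF a b fun h' => h (Or.inl h'))
        (fun ω h => by rw [al_of_not ω h, zero_mul]), zero_mul]
    have z4 : ∫ ω, (al X₁ X₂ C H ω * F (X₁ H ω) (X₂ H ω)) * dF' ω ∂P = 0 := by
      rw [markov_drift (B := C) hs (aC.mul (Adp.coord X₁ X₂ le_rfl F)) F' 0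
        (fun a b h => hF' a b fun h' => h (Or.inr h'))
        (fun ω h => by rw [al_of_not ω h, zero_mul]), zero_mul]
    have i0 : Integrable (fun ω => stv X₁ X₂ B F H ω * stv X₁ X₂ B' F' H ω) P :=
      ((adp_stv F H).mul (adp_stv F' H)).integrable hs
    have i0' : Integrable (fun ω => stv X₁ X₂ C (fun a b => F a b * F' a b) H ω) P :=
      (adp_stv _ H).integrable hs
    have i1 : Integrable (fun ω => (al X₁ X₂ B H ω * stv X₁ X₂ B' F' H ω) * dF ω) P :=
      ((((adp_al H).mul (adp_stv F' H)).mono aH).mul adF).integrable hs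
    have i2 : Integrable (fun ω => (al X₁ X₂ B' H ω * stv X₁ X₂ B F H ω) * dF' ω) P :=
      ((((adp_al H).mul (adp_stv F H)).mono aH).mul adF').integrable hs
    have i3 : Integrable (fun ω => (al X₁ X₂ C H ω * F' (X₁ H ω) (X₂ H ω)) * dF ω) P :=
      (((aC.mul (Adp.coord X₁ X₂ le_rfl F')).mono aH).mul adF).integrable hs
    have i4 : Integrable (fun ω => (al X₁ X₂ C H ω * F (X₁ H ω) (X₂ H ω)) * dF' ω) P :=
      (((aC.mul (Adp.coord X₁ X₂ le_rfl F)).mono aH).mul adF').integrable hs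
    have i5 : Integrable (fun ω => al X₁ X₂ C H ω * (dF ω * dF' ω)) P :=
      ((aC.mono aH).mul (adF.mul adF')).integrable hs
    have e1 : (fun ω => stv X₁ X₂ B F (H + 1) ω * stv X₁ X₂ B' F' (H + 1) ω) = fun ω =>
        stv X₁ X₂ B F H ω * stv X₁ X₂ B' F' H ω +
        ((al X₁ X₂ B H ω * stv X₁ X₂ B' F' H ω) * dF ω +
        ((al X₁ X₂ B' H ω * stv X₁ X₂ B F H ω) * dF' ω + al X₁ X₂ C H ω * (dF ω * dF' ω))) := by
      funext ω
      rw [stv_succ, stv_succ, ← hal]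
      ring
    have e2 : (fun ω => stv X₁ X₂ C (fun a b => F a b * F' a b) (H + 1) ω) = fun ω =>
        stv X₁ X₂ C (fun a b => F a b * F' a b) H ω +
        ((al X₁ X₂ C H ω * F' (X₁ H ω) (X₂ H ω)) * dF ω +
        ((al X₁ X₂ C H ω * F (X₁ H ω) (X₂ H ω)) * dF' ω + al X₁ X₂ C H ω * (dF ω * dF' ω))) := by
      funext ω
      rw [stv_succ]
      ring
    have r1 := integral_add4 i0 i1 i2 i5
    have r2 := integral_add4 i0' i3 i4 i5
    rw [e1, e2, r1, r2, z1, z2, z3, z4, ih]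

end Stop

section PartA

def op1 (G : SimpleGraph V) (f : V → ℝ) (a : V) : ℝ := ∑ b, K G a b * f b

structure GK (G : SimpleGraph V) (γ κ M : V → V → ℝ) (g0 k0 m kap : ℝ) : Prop where
  row : ∀ a, ∑ b, K G a b = 1
  col : ∀ b, ∑ a, K G a b = 1
  hγ : ∀ y a, op1 G (γ y) a = γ y a - (if a = y then 1 else 0) + (Fintype.card V : ℝ)⁻¹
  hκ : ∀ y a, op1 G (κ y) a = κ y a - γ y a
  γ0 : ∀ y, ∑ x, γ y x = 0
  κ0 : ∀ y, ∑ x, κ y x = 0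
  γs : ∀ x y, γ x y = γ y x
  κs : ∀ x y, κ x y = κ y x
  γd : ∀ y, γ y y = g0
  κd : ∀ y, κ y y = k0
  γle : ∀ y x, |γ y x| ≤ g0
  hM : ∀ r y x, ((op1 G)^[r] (fun z => |γ y z|)) x ≤ M y x
  Mrow : ∀ y, ∑ x, M y x ≤ m
  Mcol : ∀ x, ∑ y, M y x ≤ m
  κrow : ∀ y, ∑ x, |κ y x| ≤ kap

variable {G : SimpleGraph V} {γ κ M : V → V → ℝ} {g0 k0 m kap : ℝ}

lemma op2_fst (hr : ∀ a, ∑ b, K G a b = 1) (f : V → ℝ) (a b : V) :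
    op2 G (fun c _ => f c) a b = op1 G f a := by
  unfold op2 op1
  refine Finset.sum_congr rfl fun c _ => ?_
  rw [← Finset.sum_mul, ← Finset.mul_sum, hr, mul_one]

lemma op2_snd (hr : ∀ a, ∑ b, K G a b = 1) (f : V → ℝ) (a b : V) :
    op2 G (fun _ d => f d) a b = op1 G f b := by
  unfold op2 op1
  rw [Finset.sum_comm]
  refine Finset.sum_congr rfl fun c _ => ?_
  rw [← Finset.sum_mul, ← Finset.sum_mul, hr, one_mul]

lemma op2_mul (f h : V → ℝ) (a b : V) :
    op2 G (fun c d => f c * h d) a b = op1 G f a * op1 G h b := by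
  unfold op2 op1
  rw [Finset.sum_mul_sum]
  refine Finset.sum_congr rfl fun c _ => Finset.sum_congr rfl fun d _ => by ring

lemma op2_add (F F' : V → V → ℝ) (a b : V) :
    op2 G (fun c d => F c d + F' c d) a b = op2 G F a b + op2 G F' a b := by
  unfold op2
  simp only [mul_add, Finset.sum_add_distrib]

lemma op2_sub (F F' : V → V → ℝ) (a b : V) :
    op2 G (fun c d => F c d - F' c d) a b = op2 G F a b - op2 G F' a b := by
  unfold op2
  simp only [mul_sub, Finset.sum_sub_distrib]

lemma op1_add (f f' : V → ℝ) (a : V) :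
    op1 G (fun c => f c + f' c) a = op1 G f a + op1 G f' a := by
  unfold op1
  simp only [mul_add, Finset.sum_add_distrib]

lemma op1_smul (c : ℝ) (f : V → ℝ) (a : V) :
    op1 G (fun x => c * f x) a = c * op1 G f a := by
  unfold op1
  rw [Finset.mul_sum]
  exact Finset.sum_congr rfl fun x _ => by ring

lemma K_nonneg (G : SimpleGraph V) (a b : V) : 0 ≤ K G a b := by
  unfold K; split_ifs <;> positivity

lemma op1_nonneg {f : V → ℝ} (hf : ∀ x, 0 ≤ f x) (a : V) : 0 ≤ op1 G f a :=
  Finset.sum_nonneg fun b _ => mul_nonneg (K_nonneg G a b) (hf b)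

lemma op1_iter_nonneg {f : V → ℝ} (hf : ∀ x, 0 ≤ f x) (r : ℕ) (a : V) :
    0 ≤ ((op1 G)^[r] f) a := by
  induction r generalizing f with
  | zero => exact hf a
  | succ r ih => exact ih fun x => op1_nonneg hf x

lemma sum_op1 (hc : ∀ b, ∑ a, K G a b = 1) (f : V → ℝ) : ∑ a, op1 G f a = ∑ a, f a := by
  unfold op1
  rw [Finset.sum_comm]
  refine Finset.sum_congr rfl fun b _ => ?_
  rw [← Finset.sum_mul, hc, one_mul]

def Phi (γ : V → V → ℝ) (y a b : V) : ℝ := γ y a - γ y b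

def Jf (γ κ : V → V → ℝ) (y y' a : V) : ℝ :=
  γ y a * γ y' a + (Fintype.card V : ℝ)⁻¹ * (κ y a + κ y' a)

def Ff (γ κ : V → V → ℝ) (y y' a b : V) : ℝ :=
  γ y a * γ y' b + γ y' a * γ y b +
    ((Fintype.card V : ℝ)⁻¹ * (κ y a + κ y' a) + (Fintype.card V : ℝ)⁻¹ * (κ y b + κ y' b))

lemma Phi_drift (h : GK G γ κ M g0 k0 m kap) (y a b : V) (hB : ¬ (a = y ∨ b = y)) :
    op2 G (Phi γ y) a b - Phi γ y a b = 0 := by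
  push Not at hB
  have : op2 G (Phi γ y) a b = op1 G (γ y) a - op1 G (γ y) b := by
    unfold Phi
    rw [op2_sub, op2_fst h.row, op2_snd h.row]
  rw [this, h.hγ, h.hγ, if_neg hB.1, if_neg hB.2, Phi]
  ring

lemma Ff_drift (h : GK G γ κ M g0 k0 m kap) (y y' a b : V)
    (hB : ¬ ((a = y ∨ b = y) ∨ (a = y' ∨ b = y'))) :
    op2 G (Ff γ κ y y') a b - Ff γ κ y y' a b = 2 * ((Fintype.card V : ℝ)⁻¹) ^ 2 := by
  push Not at hB
  obtain ⟨⟨h1, h2⟩, h3, h4⟩ := hB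
  have : op2 G (Ff γ κ y y') a b = op1 G (γ y) a * op1 G (γ y') b + op1 G (γ y') a * op1 G (γ y) b
    + ((Fintype.card V : ℝ)⁻¹ * (op1 G (κ y) a + op1 G (κ y') a) +
      (Fintype.card V : ℝ)⁻¹ * (op1 G (κ y) b + op1 G (κ y') b)) := by
    unfold Ff
    rw [op2_add, op2_add, op2_mul, op2_mul, op2_add,
      op2_fst h.row (fun a => (Fintype.card V : ℝ)⁻¹ * (κ y a + κ y' a)),
      op2_snd h.row (fun a => (Fintype.card V : ℝ)⁻¹ * (κ y a + κ y' a)), op1_smul, op1_smul,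
      op1_add, op1_add]
  rw [this]
  simp only [h.hγ, h.hκ, if_neg h1, if_neg h2, if_neg h3, if_neg h4, Ff]
  ring

def Gf (γ : V → V → ℝ) (y y' a b : V) : ℝ := (γ y a + γ y' a) + (γ y b + γ y' b)

lemma Gf_drift (h : GK G γ κ M g0 k0 m kap) (y y' a b : V)
    (hB : ¬ ((a = y ∨ b = y) ∨ (a = y' ∨ b = y'))) :
    op2 G (Gf γ y y') a b - Gf γ y y' a b = 4 * ((Fintype.card V : ℝ)⁻¹) := by
  push Not at hB
  obtain ⟨⟨h1, h2⟩, h3, h4⟩ := hB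
  have : op2 G (Gf γ y y') a b = (op1 G (γ y) a + op1 G (γ y') a) +
      (op1 G (γ y) b + op1 G (γ y') b) := by
    unfold Gf
    rw [op2_add, op2_fst h.row (fun a => γ y a + γ y' a),
      op2_snd h.row (fun a => γ y a + γ y' a), op1_add, op1_add]
  rw [this]
  simp only [h.hγ, if_neg h1, if_neg h2, if_neg h3, if_neg h4, Gf]
  ring

variable {Ω : Type*} [MeasurableSpace Ω] {P : Measure Ω} [IsProbabilityMeasure P]
  {X₁ X₂ : ℕ → Ω → V} {ξ : V → Ω → Bool}

lemma two_time (h : GK G γ κ M g0 k0 m kap) (hs : IsPaintSetup G P X₁ X₂ ξ) (f : V → ℝ) (t r : ℕ)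
    (u : V → ℝ) : ∫ ω, f (X₂ t ω) * u (X₂ (t + r) ω) ∂P =
      ∫ ω, f (X₂ t ω) * ((op1 G)^[r] u) (X₂ t ω) ∂P := by
  induction r generalizing u with
  | zero => rfl
  | succ r ih =>
    have hW : Adp X₁ X₂ (t + r) (fun ω => f (X₂ t ω)) :=
      Adp.coord X₁ X₂ (Nat.le_add_right t r) (fun _ b => f b)
    have := markov hs hW (fun _ b => u b)
    rw [show t + (r + 1) = t + r + 1 by ring, this, Function.iterate_succ_apply, ← ih]
    congr 1
    funext ω
    congr 1
    exact op2_snd h.row u _ _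

lemma stationary (h : GK G γ κ M g0 k0 m kap) (hs : IsPaintSetup G P X₁ X₂ ξ) (t : ℕ) (u : V → ℝ) :
    ∫ ω, u (X₂ t ω) ∂P = (Fintype.card V : ℝ)⁻¹ * ∑ z, u z := by
  induction t generalizing u with
  | zero =>
    have := init_law hs (fun _ b => u b)
    rw [this]
    simp only [Finset.sum_const, Finset.card_univ, nsmul_eq_mul, ← Finset.mul_sum]
    rcases eq_or_ne (Fintype.card V : ℝ) 0 with h0 | h0
    · simp [h0]
    · field_simp
  | succ t ih =>
    have hW : Adp X₁ X₂ t (fun _ => (1 : ℝ)) := fun _ _ _ _ => rfl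
    have := markov hs hW (fun _ b => u b)
    simp only [one_mul] at this
    rw [this]
    have e : ∀ ω, ∑ a, ∑ b, K G (X₁ t ω) a * K G (X₂ t ω) b * u b = op1 G u (X₂ t ω) :=
      fun ω => op2_snd h.row u _ _
    simp only [e]
    rw [ih, sum_op1 h.col]

lemma Phi_init (h : GK G γ κ M g0 k0 m kap) (hs : IsPaintSetup G P X₁ X₂ ξ) (y : V) :
    ∫ ω, Phi γ y (X₁ 0 ω) (X₂ 0 ω) ∂P = 0 := by
  rw [init_law hs]
  simp only [Phi, mul_sub, Finset.sum_sub_distrib, ← Finset.mul_sum, h.γ0, Finset.sum_const]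
  simp only [smul_eq_mul, nsmul_eq_mul, ← Finset.mul_sum, h.γ0, mul_zero, sub_zero]

lemma Gf_init (h : GK G γ κ M g0 k0 m kap) (hs : IsPaintSetup G P X₁ X₂ ξ) (y y' : V) :
    ∫ ω, Gf γ y y' (X₁ 0 ω) (X₂ 0 ω) ∂P = 0 := by
  rw [init_law hs]
  simp only [Gf, mul_add, Finset.sum_add_distrib, ← Finset.mul_sum, h.γ0, Finset.sum_const]
  simp only [smul_eq_mul, nsmul_eq_mul, ← Finset.mul_sum, h.γ0, mul_zero, sub_zero, add_zero]

lemma Ff_init (h : GK G γ κ M g0 k0 m kap) (hs : IsPaintSetup G P X₁ X₂ ξ) (y y' : V) :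
    ∫ ω, Ff γ κ y y' (X₁ 0 ω) (X₂ 0 ω) ∂P = 0 := by
  rw [init_law hs]
  simp only [Ff, mul_add, Finset.sum_add_distrib, ← Finset.mul_sum, h.γ0, h.κ0, Finset.sum_const]
  simp only [smul_eq_mul, nsmul_eq_mul, ← Finset.mul_sum, h.γ0, h.κ0, mul_zero, sub_zero, add_zero,
    Finset.sum_const_zero]

/-- expected truncated time -/
def tauE (P : Measure Ω) (X₁ X₂ : ℕ → Ω → V) (B : V → V → Prop) (H : ℕ) : ℝ :=
  ∑ j ∈ Finset.range H, ∫ ω, al X₁ X₂ B j ω ∂P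

def CC (y y' : V) : V → V → Prop := fun a b => (a = y ∨ b = y) ∨ (a = y' ∨ b = y')

lemma card_pos_of (hs : IsPaintSetup G P X₁ X₂ ξ) : 0 < (Fintype.card V : ℝ) := by
  have : Nonempty Ω := by
    by_contra hne
    rw [not_nonempty_iff] at hne
    have := measure_univ (μ := P)
    rw [Set.univ_eq_empty_iff.2 hne] at this
    simp at this
  obtain ⟨ω⟩ := this
  have : Nonempty V := ⟨X₁ 0 ω⟩
  exact_mod_cast Fintype.card_pos

lemma tau_le (h : GK G γ κ M g0 k0 m kap) (hs : IsPaintSetup G P X₁ X₂ ξ) (y y' : V) (H : ℕ) :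
    tauE P X₁ X₂ (CC y y') H ≤ Fintype.card V * g0 := by
  have hN := card_pos_of hs
  have d := dynkin (B := CC y y') hs (Gf γ y y') (4 * (Fintype.card V : ℝ)⁻¹)
    (fun a b hB => Gf_drift h y y' a b hB) H
  rw [Gf_init h hs, zero_add] at d
  have b : ∫ ω, stv X₁ X₂ (CC y y') (Gf γ y y') H ω ∂P ≤ ∫ ω, 4 * g0 ∂P := by
    refine integral_mono ((adp_stv _ H).integrable hs) (integrable_const _) fun ω => ?_
    have e : ∀ z x, γ z x ≤ g0 := fun z x => (le_abs_self _).trans (h.γle z x)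
    unfold stv Gf
    have := e y (X₁ (sg X₁ X₂ (CC y y') H ω) ω)
    have := e y' (X₁ (sg X₁ X₂ (CC y y') H ω) ω)
    have := e y (X₂ (sg X₁ X₂ (CC y y') H ω) ω)
    have := e y' (X₂ (sg X₁ X₂ (CC y y') H ω) ω)
    dsimp only
    linarith
  rw [d] at b
  simp only [integral_const, probReal_univ, smul_eq_mul, one_mul] at b
  change 4 * (Fintype.card V : ℝ)⁻¹ * tauE P X₁ X₂ (CC y y') H ≤ 4 * g0 at b
  have : (Fintype.card V : ℝ)⁻¹ * tauE P X₁ X₂ (CC y y') H ≤ g0 := by linarith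
  rwa [inv_mul_le_iff₀ hN] at this

lemma alive_le (h : GK G γ κ M g0 k0 m kap) (hs : IsPaintSetup G P X₁ X₂ ξ) (y y' : V) (H : ℕ) :
    H * ∫ ω, al X₁ X₂ (CC y y') H ω ∂P ≤ Fintype.card V * g0 := by
  refine le_trans ?_ (tau_le h hs y y' H)
  unfold tauE
  have : ∀ j ∈ Finset.range H, ∫ ω, al X₁ X₂ (CC y y') H ω ∂P ≤
      ∫ ω, al X₁ X₂ (CC y y') j ω ∂P := fun j hj =>
    integral_mono ((adp_al H).integrable hs) ((adp_al j).integrable hs)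
      (fun ω => al_anti (Finset.mem_range.1 hj).le ω)
  have := Finset.sum_le_sum this
  simpa using this

lemma tau_nonneg (y y' : V) (H : ℕ) : 0 ≤ tauE P X₁ X₂ (CC y y') H :=
  Finset.sum_nonneg fun j _ => integral_nonneg fun ω => al_nonneg j ω

end PartA

section PartA2

variable {G : SimpleGraph V} {γ κ M : V → V → ℝ} {g0 k0 m kap : ℝ}
variable {Ω : Type*} [MeasurableSpace Ω] {P : Measure Ω} [IsProbabilityMeasure P]
  {X₁ X₂ : ℕ → Ω → V} {ξ : V → Ω → Bool}

/-- indicator of first hit of `D` at time `t` -/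
def fh (X : ℕ → Ω → V) (D : V → Prop) (t : ℕ) (ω : Ω) : ℝ :=
  if D (X t ω) ∧ ∀ i < t, ¬ D (X i ω) then 1 else 0

lemma fh_nonneg (X : ℕ → Ω → V) (D : V → Prop) (t : ℕ) (ω : Ω) : 0 ≤ fh X D t ω := by
  unfold fh; split_ifs <;> norm_num

lemma fh_sum_le (X : ℕ → Ω → V) (D : V → Prop) (T : ℕ) (ω : Ω) :
    ∑ t ∈ Finset.range T, fh X D t ω ≤ 1 := by
  by_cases hex : ∃ t ∈ Finset.range T, fh X D t ω ≠ 0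
  · obtain ⟨t, ht, h0⟩ := hex
    have ht' : D (X t ω) ∧ ∀ i < t, ¬ D (X i ω) := by
      by_contra hc; exact h0 (if_neg hc)
    rw [Finset.sum_eq_single t]
    · unfold fh; split_ifs <;> norm_num
    · intro b _ hb
      refine if_neg fun hc => ?_
      rcases lt_or_gt_of_ne hb with h1 | h1
      · exact ht'.2 b h1 hc.1
      · exact hc.2 t h1 ht'.1
    · exact fun h1 => absurd ht h1
  · push Not at hex
    rw [Finset.sum_eq_zero hex]; norm_num

lemma adq_fh (X : ℕ → Ω → V) (D : V → Prop) {t H : ℕ} (h : t ≤ H) : Adq X H (fh X D t) := by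
  intro ω ω' hh
  have : (D (X t ω) ∧ ∀ i < t, ¬ D (X i ω)) ↔ (D (X t ω') ∧ ∀ i < t, ¬ D (X i ω')) := by
    rw [hh t h]
    refine and_congr_right fun _ => forall₂_congr fun i hi => by rw [hh i (by omega)]
  unfold fh
  simp only [this]

lemma Adq.mono {X : ℕ → Ω → V} {H H' : ℕ} (hH : H ≤ H') {W : Ω → ℝ} (h : Adq X H W) :
    Adq X H' W := fun ω ω' h1 => h ω ω' fun i hi => h1 i (hi.trans hH)

lemma Adq.mul {X : ℕ → Ω → V} {H : ℕ} {W W' : Ω → ℝ} (h : Adq X H W) (h' : Adq X H W') :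
    Adq X H (fun ω => W ω * W' ω) :=
  fun ω ω' h1 => by simp only [h ω ω' h1, h' ω ω' h1]

lemma adq_coord (X : ℕ → Ω → V) {t H : ℕ} (h : t ≤ H) (u : V → ℝ) :
    Adq X H (fun ω => u (X t ω)) := fun ω ω' hh => by simp only [hh t h]

/-- the error sum -/
def er (X₁ X₂ : ℕ → Ω → V) (D : V → Prop) (u : V → ℝ) (T : ℕ) (ω : Ω) : ℝ :=
  ∑ t ∈ Finset.range T, fh X₁ D t ω * u (X₂ t ω)

lemma adp_er (D : V → Prop) (u : V → ℝ) (H : ℕ) : Adp X₁ X₂ H (er X₁ X₂ D u (H + 1)) :=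
  Adp.sum fun t ht => (adq_fh X₁ D (Nat.lt_succ_iff.1 (Finset.mem_range.1 ht))).adp₁.mul
    (adq_coord X₂ (Nat.lt_succ_iff.1 (Finset.mem_range.1 ht)) u).adp₂

lemma er_nonneg (D : V → Prop) {u : V → ℝ} (hu : ∀ x, 0 ≤ u x) (T : ℕ) (ω : Ω) :
    0 ≤ er X₁ X₂ D u T ω :=
  Finset.sum_nonneg fun t _ => mul_nonneg (fh_nonneg _ _ _ _) (hu _)

lemma er_ge (D : V → Prop) {u : V → ℝ} (hu : ∀ x, 0 ≤ u x) {T t : ℕ} (ht : t < T) (ω : Ω)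
    (h1 : D (X₁ t ω)) (h2 : ∀ i < t, ¬ D (X₁ i ω)) : u (X₂ t ω) ≤ er X₁ X₂ D u T ω := by
  have := Finset.single_le_sum (f := fun t => fh X₁ D t ω * u (X₂ t ω))
    (fun i _ => mul_nonneg (fh_nonneg _ _ _ _) (hu _)) (Finset.mem_range.2 ht)
  refine le_trans (le_of_eq ?_) this
  simp only [fh]
  rw [if_pos ⟨h1, h2⟩, one_mul]

lemma er_int (h : GK G γ κ M g0 k0 m kap) (hs : IsPaintSetup G P X₁ X₂ ξ) (D : V → Prop)
    {u : V → ℝ} (hu : ∀ x, 0 ≤ u x) (H : ℕ) :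
    ∫ ω, er X₁ X₂ D u (H + 1) ω ∂P ≤ (Fintype.card V : ℝ)⁻¹ * ∑ z, u z := by
  unfold er
  have hle : ∀ t ∈ Finset.range (H + 1), t ≤ H := fun t ht =>
    Nat.lt_succ_iff.1 (Finset.mem_range.1 ht)
  have hi : ∀ t ∈ Finset.range (H + 1), Integrable (fun ω => fh X₁ D t ω) P := fun t ht =>
    ((adq_fh X₁ D (hle t ht)).adp₁ (X₂ := X₂)).integrable hs
  rw [integral_finset_sum _ (fun t ht => (((adq_fh X₁ D (hle t ht)).adp₁.mul
    (adq_coord X₂ (hle t ht) u).adp₂).integrable hs))]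
  have e : ∀ t ∈ Finset.range (H + 1), ∫ ω, fh X₁ D t ω * u (X₂ t ω) ∂P =
      (∫ ω, fh X₁ D t ω ∂P) * ((Fintype.card V : ℝ)⁻¹ * ∑ z, u z) := fun t ht => by
    rw [indep_walks hs (adq_fh X₁ D (hle t ht)) (adq_coord X₂ (hle t ht) u), stationary h hs]
  rw [Finset.sum_congr rfl e, ← Finset.sum_mul, ← integral_finset_sum _ hi]
  have h1 : ∫ ω, ∑ t ∈ Finset.range (H + 1), fh X₁ D t ω ∂P ≤ ∫ ω, (1 : ℝ) ∂P :=
    integral_mono (integrable_finset_sum _ hi) (integrable_const _)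
      (fun ω => fh_sum_le X₁ D (H + 1) ω)
  simp only [integral_const, probReal_univ, smul_eq_mul, one_mul] at h1
  have h2 : 0 ≤ (Fintype.card V : ℝ)⁻¹ * ∑ z, u z :=
    mul_nonneg (by positivity) (Finset.sum_nonneg fun z _ => hu z)
  nlinarith

def Jst (γ κ : V → V → ℝ) (g0 k0 : ℝ) (y y' : V) : ℝ :=
  g0 * γ y y' + (Fintype.card V : ℝ)⁻¹ * (k0 + κ y y')

lemma J_at (h : GK G γ κ M g0 k0 m kap) (y y' z : V) (hz : z = y ∨ z = y') :
    Jf γ κ y y' z = Jst γ κ g0 k0 y y' := by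
  rcases hz with rfl | rfl
  · simp only [Jf, Jst, h.γd, h.κd, h.γs y' z, h.κs y' z]
  · simp only [Jf, Jst, h.γd, h.κd]; ring

lemma J_point (h : GK G γ κ M g0 k0 m kap) (y y' : V) (H : ℕ) (ω : Ω) :
    |stv X₁ X₂ (CC y y') (fun a b => Jf γ κ y y' a + Jf γ κ y y' b) H ω - Jst γ κ g0 k0 y y'| ≤
      (er X₁ X₂ (fun z => z = y ∨ z = y') (fun z => |Jf γ κ y y' z|) (H + 1) ω +
      er X₂ X₁ (fun z => z = y ∨ z = y') (fun z => |Jf γ κ y y' z|) (H + 1) ω) +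
      3 * (∑ z, |Jf γ κ y y' z|) * al X₁ X₂ (CC y y') H ω := by
  set J := Jf γ κ y y' with hJ
  set D : V → Prop := fun z => z = y ∨ z = y' with hD
  have e1 := er_nonneg (X₁ := X₁) (X₂ := X₂) D (u := fun z => |J z|) (fun z => abs_nonneg _)
    (H + 1) ω
  have e2 := er_nonneg (X₁ := X₂) (X₂ := X₁) D (u := fun z => |J z|) (fun z => abs_nonneg _)
    (H + 1) ω
  have hs : ∀ z, |J z| ≤ ∑ z, |J z| := fun z =>
    Finset.single_le_sum (f := fun z => |J z|) (fun i _ => abs_nonneg _) (Finset.mem_univ z)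
  by_cases ha : aliveP X₁ X₂ (CC y y') H ω
  · have : al X₁ X₂ (CC y y') H ω = 1 := if_pos ha
    rw [this, ← J_at h y y' y (Or.inl rfl)]
    unfold stv
    have a1 := hs (X₁ (sg X₁ X₂ (CC y y') H ω) ω)
    have a2 := hs (X₂ (sg X₁ X₂ (CC y y') H ω) ω)
    have a3 := hs y
    have b1 := abs_sub (J (X₁ (sg X₁ X₂ (CC y y') H ω) ω) + J (X₂ (sg X₁ X₂ (CC y y') H ω) ω)) (J y)
    have b2 := abs_add_le (J (X₁ (sg X₁ X₂ (CC y y') H ω) ω)) (J (X₂ (sg X₁ X₂ (CC y y') H ω) ω))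
    simp only [← hJ]
    linarith
  · rw [al_of_not ω ha]
    obtain ⟨h1, h2⟩ := sg_hit ha
    have hlt : sg X₁ X₂ (CC y y') H ω < H + 1 := Nat.lt_succ_iff.2 (sg_le H ω)
    unfold stv
    set s := sg X₁ X₂ (CC y y') H ω
    have hor : D (X₁ s ω) ∨ D (X₂ s ω) := by
      unfold CC at h1; simp only [hD]; tauto
    have hn1 : ∀ i < s, ¬ D (X₁ i ω) := fun i hi hc => h2 i hi (by
      unfold CC; simp only [hD] at hc; tauto)
    have hn2 : ∀ i < s, ¬ D (X₂ i ω) := fun i hi hc => h2 i hi (by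
      unfold CC; simp only [hD] at hc; tauto)
    rcases hor with hd | hd
    · have := er_ge (X₂ := X₂) D (u := fun z => |J z|) (fun z => abs_nonneg _) hlt ω hd hn1
      have e3 : J (X₁ s ω) = _ := J_at h y y' _ hd
      simp only [← hJ]
      rw [e3, add_sub_cancel_left]
      linarith
    · have := er_ge (X₁ := X₂) (X₂ := X₁) D (u := fun z => |J z|) (fun z => abs_nonneg _) hlt ω
        hd hn2
      have e3 : J (X₂ s ω) = _ := J_at h y y' _ hd
      simp only [← hJ]
      rw [e3, add_sub_cancel_right]
      linarith

lemma pair_bound (h : GK G γ κ M g0 k0 m kap) (hs : IsPaintSetup G P X₁ X₂ ξ) (y y' : V) (H : ℕ)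
    (hH : 3 * (Fintype.card V : ℝ) ^ 2 * g0 ≤ H) (hH0 : 0 < H) :
    |∫ ω, stv X₁ X₂ (CC y y') (fun a b => Phi γ y a b * Phi γ y' a b) H ω ∂P -
      Jst γ κ g0 k0 y y'| ≤ 3 * (Fintype.card V : ℝ)⁻¹ * (∑ z, |Jf γ κ y y' z|) +
        2 * (Fintype.card V : ℝ)⁻¹ * g0 := by
  have hN := card_pos_of hs
  have e1 : ∀ ω, stv X₁ X₂ (CC y y') (fun a b => Phi γ y a b * Phi γ y' a b) H ω =
      stv X₁ X₂ (CC y y') (fun a b => Jf γ κ y y' a + Jf γ κ y y' b) H ω -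
      stv X₁ X₂ (CC y y') (Ff γ κ y y') H ω := by
    intro ω
    simp only [stv, Phi, Jf, Ff]
    ring
  simp only [e1]
  have iJ : Integrable (fun ω => stv X₁ X₂ (CC y y')
    (fun a b => Jf γ κ y y' a + Jf γ κ y y' b) H ω) P := (adp_stv _ H).integrable hs
  have iF : Integrable (fun ω => stv X₁ X₂ (CC y y') (Ff γ κ y y') H ω) P :=
    (adp_stv _ H).integrable hs
  rw [integral_sub iJ iF]
  have d := dynkin (B := CC y y') hs (Ff γ κ y y') _ (fun a b hB => Ff_drift h y y' a b hB) H
  rw [Ff_init h hs, zero_add] at d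
  change _ = _ * tauE P X₁ X₂ (CC y y') H at d
  have t1 := tau_le h hs y y' H
  have t0 := tau_nonneg (P := P) (X₁ := X₁) (X₂ := X₂) y y' H
  set SJ := ∑ z, |Jf γ κ y y' z| with hSJ
  have SJ0 : 0 ≤ SJ := Finset.sum_nonneg fun z _ => abs_nonneg _
  have dF : |∫ ω, stv X₁ X₂ (CC y y') (Ff γ κ y y') H ω ∂P| ≤ 2 * (Fintype.card V : ℝ)⁻¹ * g0 := by
    rw [d, abs_of_nonneg (by positivity)]
    calc 2 * (Fintype.card V : ℝ)⁻¹ ^ 2 * tauE P X₁ X₂ (CC y y') H ≤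
        2 * (Fintype.card V : ℝ)⁻¹ ^ 2 * (Fintype.card V * g0) := by gcongr
      _ = _ := by field_simp
  have i1 := (adp_er (X₁ := X₁) (X₂ := X₂) (fun z => z = y ∨ z = y')
    (fun z => |Jf γ κ y y' z|) H).integrable hs
  have i2 := (adp_er (X₁ := X₂) (X₂ := X₁) (fun z => z = y ∨ z = y')
    (fun z => |Jf γ κ y y' z|) H).integrable hs.symm
  have i3 : Integrable (fun ω => 3 * SJ * al X₁ X₂ (CC y y') H ω) P :=
    ((adp_al H).integrable hs).const_mul _
  have dJ : |∫ ω, stv X₁ X₂ (CC y y') (fun a b => Jf γ κ y y' a + Jf γ κ y y' b) H ω ∂P -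
      Jst γ κ g0 k0 y y'| ≤ 3 * (Fintype.card V : ℝ)⁻¹ * SJ := by
    have : ∫ ω, stv X₁ X₂ (CC y y') (fun a b => Jf γ κ y y' a + Jf γ κ y y' b) H ω ∂P -
      Jst γ κ g0 k0 y y' = ∫ ω, (stv X₁ X₂ (CC y y')
        (fun a b => Jf γ κ y y' a + Jf γ κ y y' b) H ω - Jst γ κ g0 k0 y y') ∂P := by
      rw [integral_sub iJ (integrable_const _)]
      simp
    rw [this]
    refine abs_integral_le_integral_abs.trans ?_
    have i12 : Integrable (fun ω => er X₁ X₂ (fun z => z = y ∨ z = y') (fun z => |Jf γ κ y y' z|)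
      (H + 1) ω + er X₂ X₁ (fun z => z = y ∨ z = y') (fun z => |Jf γ κ y y' z|) (H + 1) ω) P :=
      i1.add i2
    have i123 : Integrable (fun ω => (er X₁ X₂ (fun z => z = y ∨ z = y')
      (fun z => |Jf γ κ y y' z|) (H + 1) ω +
      er X₂ X₁ (fun z => z = y ∨ z = y') (fun z => |Jf γ κ y y' z|) (H + 1) ω) +
      3 * SJ * al X₁ X₂ (CC y y') H ω) P := i12.add i3
    refine (integral_mono ((iJ.sub (integrable_const _)).abs) i123
      (fun ω => J_point h y y' H ω)).trans ?_
    have := integral_add i12 i3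
    have e5 := integral_add i1 i2
    have b1 := er_int h hs (fun z => z = y ∨ z = y') (u := fun z => |Jf γ κ y y' z|)
      (fun z => abs_nonneg _) H
    have b2 := er_int h hs.symm (fun z => z = y ∨ z = y') (u := fun z => |Jf γ κ y y' z|)
      (fun z => abs_nonneg _) H
    have b3 : ∫ ω, 3 * SJ * al X₁ X₂ (CC y y') H ω ∂P ≤ (Fintype.card V : ℝ)⁻¹ * SJ := by
      rw [integral_const_mul]
      have a := alive_le h hs y y' H
      have hHr : (0 : ℝ) < H := by exact_mod_cast hH0
      have a2 : 3 * ∫ ω, al X₁ X₂ (CC y y') H ω ∂P ≤ (Fintype.card V : ℝ)⁻¹ := by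
        rw [← one_div, le_div_iff₀ hN]
        have a3 : H * (3 * (∫ ω, al X₁ X₂ (CC y y') H ω ∂P) * Fintype.card V) ≤ H * 1 := by
          nlinarith
        exact le_of_mul_le_mul_left a3 hHr
      nlinarith
    rw [this, e5]
    linarith
  have := abs_sub (∫ ω, stv X₁ X₂ (CC y y') (fun a b => Jf γ κ y y' a + Jf γ κ y y' b) H ω ∂P -
      Jst γ κ g0 k0 y y') (∫ ω, stv X₁ X₂ (CC y y') (Ff γ κ y y') H ω ∂P)
  rw [sub_right_comm]
  linarith

end PartA2

section PartA3

variable {G : SimpleGraph V} {γ κ M : V → V → ℝ} {g0 k0 m kap : ℝ}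
variable {Ω : Type*} [MeasurableSpace Ω] {P : Measure Ω} [IsProbabilityMeasure P]
  {X₁ X₂ : ℕ → Ω → V} {ξ : V → Ω → Bool}

def BB (y : V) : V → V → Prop := fun a b => a = y ∨ b = y

def LL (X₁ X₂ : ℕ → Ω → V) (γ : V → V → ℝ) (H : ℕ) (ω : Ω) : ℝ :=
  ∑ y, stv X₁ X₂ (BB y) (Phi γ y) H ω

lemma adp_LL (H : ℕ) : Adp X₁ X₂ H (LL X₁ X₂ γ H) :=
  Adp.sum fun y _ => adp_stv (Phi γ y) H

lemma LL_mean (h : GK G γ κ M g0 k0 m kap) (hs : IsPaintSetup G P X₁ X₂ ξ) (H : ℕ) :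
    ∫ ω, LL X₁ X₂ γ H ω ∂P = 0 := by
  unfold LL
  rw [integral_finset_sum _ fun y _ => (adp_stv (Phi γ y) H).integrable hs]
  refine Finset.sum_eq_zero fun y _ => ?_
  rw [dynkin (B := BB y) hs (Phi γ y) 0 (fun a b hB => Phi_drift h y a b hB) H, Phi_init h hs]
  ring

lemma LL_sq (h : GK G γ κ M g0 k0 m kap) (hs : IsPaintSetup G P X₁ X₂ ξ) (H : ℕ) :
    ∫ ω, (LL X₁ X₂ γ H ω) ^ 2 ∂P =
      ∑ y, ∑ y', ∫ ω, stv X₁ X₂ (CC y y') (fun a b => Phi γ y a b * Phi γ y' a b) H ω ∂P := by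
  have e : ∀ ω, (LL X₁ X₂ γ H ω) ^ 2 = ∑ y, ∑ y',
      stv X₁ X₂ (BB y) (Phi γ y) H ω * stv X₁ X₂ (BB y') (Phi γ y') H ω := fun ω => by
    rw [LL, sq, Finset.sum_mul_sum]
  simp only [e]
  have i1 : ∀ y y', Integrable (fun ω => stv X₁ X₂ (BB y) (Phi γ y) H ω *
      stv X₁ X₂ (BB y') (Phi γ y') H ω) P := fun y y' =>
    ((adp_stv (Phi γ y) H).mul (adp_stv (Phi γ y') H)).integrable hs
  rw [integral_finset_sum _ fun y _ => integrable_finset_sum _ fun y' _ => i1 y y']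
  refine Finset.sum_congr rfl fun y _ => ?_
  rw [integral_finset_sum _ fun y' _ => i1 y y']
  refine Finset.sum_congr rfl fun y' _ => ?_
  exact stv_mul hs (Phi γ y) (Phi γ y') (fun a b hB => Phi_drift h y a b hB)
    (fun a b hB => Phi_drift h y' a b hB) H

lemma M_ge (h : GK G γ κ M g0 k0 m kap) (y z : V) : |γ y z| ≤ M y z := h.hM 0 y z

lemma M_nonneg (h : GK G γ κ M g0 k0 m kap) (y z : V) : 0 ≤ M y z :=
  (abs_nonneg _).trans (M_ge h y z)

lemma sum_sq_le (h : GK G γ κ M g0 k0 m kap) {u : V → V → ℝ} (hu : ∀ y z, 0 ≤ u y z)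
    (hu' : ∀ y z, u y z ≤ M y z) :
    ∑ y, ∑ y', ∑ z, u y z * u y' z ≤ Fintype.card V * m ^ 2 := by
  have e : ∑ y, ∑ y', ∑ z, u y z * u y' z = ∑ z, (∑ y, u y z) ^ 2 := by
    have : ∀ z, (∑ y, u y z) ^ 2 = ∑ y, ∑ y', u y z * u y' z := fun z => by
      rw [sq, Finset.sum_mul_sum]
    simp only [this]
    rw [Finset.sum_comm (s := (Finset.univ : Finset V)) (f := fun z y => ∑ y', u y z * u y' z)]
    refine Finset.sum_congr rfl fun y _ => ?_
    rw [Finset.sum_comm]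
  rw [e]
  have : ∀ z ∈ (Finset.univ : Finset V), (∑ y, u y z) ^ 2 ≤ m ^ 2 := fun z _ => by
    have h1 : ∑ y, u y z ≤ m := (Finset.sum_le_sum fun y _ => hu' y z).trans (h.Mcol z)
    have h0 : 0 ≤ ∑ y, u y z := Finset.sum_nonneg fun y _ => hu y z
    nlinarith
  have := Finset.sum_le_sum this
  simpa using this

lemma J_sum (h : GK G γ κ M g0 k0 m kap) (hN : 0 < (Fintype.card V : ℝ)) :
    ∑ y, ∑ y', ∑ z, |Jf γ κ y y' z| ≤ Fintype.card V * m ^ 2 + 2 * (Fintype.card V * kap) := by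
  have hp : ∀ y y' z, |Jf γ κ y y' z| ≤ |γ y z| * |γ y' z| +
      ((Fintype.card V : ℝ)⁻¹ * |κ y z| + (Fintype.card V : ℝ)⁻¹ * |κ y' z|) := by
    intro y y' z
    unfold Jf
    refine (abs_add_le _ _).trans ?_
    rw [abs_mul, abs_mul, abs_of_nonneg (inv_nonneg.2 hN.le), ← mul_add]
    gcongr
    exact abs_add_le _ _
  have : ∑ y, ∑ y', ∑ z, |Jf γ κ y y' z| ≤ ∑ y, ∑ y', ∑ z, (|γ y z| * |γ y' z| +
      ((Fintype.card V : ℝ)⁻¹ * |κ y z| + (Fintype.card V : ℝ)⁻¹ * |κ y' z|)) :=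
    Finset.sum_le_sum fun y _ => Finset.sum_le_sum fun y' _ => Finset.sum_le_sum fun z _ => hp y y' z
  refine this.trans ?_
  have s1 := sum_sq_le h (u := fun y z => |γ y z|) (fun _ _ => abs_nonneg _) (M_ge h)
  have k1 : ∑ y, ∑ z, |κ y z| ≤ Fintype.card V * kap := by
    have := Finset.sum_le_sum (s := (Finset.univ : Finset V)) (fun y _ => h.κrow y)
    simpa using this
  simp only [Finset.sum_add_distrib, ← Finset.mul_sum, Finset.sum_const, Finset.card_univ,
    nsmul_eq_mul] at s1 ⊢
  have e1 : (Fintype.card V : ℝ)⁻¹ * ((Fintype.card V : ℝ) * ∑ i, ∑ i_1, |κ i i_1|) =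
    ∑ i, ∑ i_1, |κ i i_1| := by field_simp
  rw [e1]
  linarith

lemma LL_sq_bound (h : GK G γ κ M g0 k0 m kap) (hs : IsPaintSetup G P X₁ X₂ ξ) (H : ℕ)
    (hH : 3 * (Fintype.card V : ℝ) ^ 2 * g0 ≤ H) (hH0 : 0 < H) :
    |∫ ω, (LL X₁ X₂ γ H ω) ^ 2 ∂P - Fintype.card V * k0| ≤
      3 * m ^ 2 + 6 * kap + 2 * (Fintype.card V * g0) := by
  have hN := card_pos_of hs
  have e : (Fintype.card V : ℝ) * k0 = ∑ y, ∑ y', Jst γ κ g0 k0 y y' := by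
    simp only [Jst, mul_add, Finset.sum_add_distrib, ← Finset.mul_sum, h.γ0, h.κ0,
      Finset.sum_const, Finset.card_univ, nsmul_eq_mul, mul_zero, Finset.sum_const_zero,
      zero_add, add_zero]
    field_simp
  rw [LL_sq h hs, e, ← Finset.sum_sub_distrib]
  simp only [← Finset.sum_sub_distrib]
  refine (Finset.abs_sum_le_sum_abs _ _).trans ?_
  refine (Finset.sum_le_sum fun y _ => Finset.abs_sum_le_sum_abs _ _).trans ?_
  refine (Finset.sum_le_sum fun y _ => Finset.sum_le_sum fun y' _ =>
    pair_bound h hs y y' H hH hH0).trans ?_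
  have := J_sum h hN
  simp only [Finset.sum_add_distrib, ← Finset.mul_sum, Finset.sum_const, Finset.card_univ,
    nsmul_eq_mul]
  have h2 : 3 * (Fintype.card V : ℝ)⁻¹ * ∑ y, ∑ y', ∑ z, |Jf γ κ y y' z| ≤
      3 * (Fintype.card V : ℝ)⁻¹ *
        (Fintype.card V * m ^ 2 + 2 * (Fintype.card V * kap)) := by gcongr
  have h3 : 3 * (Fintype.card V : ℝ)⁻¹ *
        (Fintype.card V * m ^ 2 + 2 * (Fintype.card V * kap)) = 3 * m ^ 2 + 6 * kap := by
    field_simp; ring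
  have h4 : 2 * (Fintype.card V : ℝ)⁻¹ * ((Fintype.card V : ℝ) * ((Fintype.card V : ℝ) * g0)) =
    2 * (Fintype.card V * g0) := by field_simp
  rw [h4]
  linarith

/-- `R₁` -/
def RR (X₁ X₂ : ℕ → Ω → V) (γ : V → V → ℝ) (H : ℕ) (ω : Ω) : ℝ :=
  ∑ y, er X₁ X₂ (fun z => z = y) (fun z => |γ y z|) (H + 1) ω

lemma adp_RR (H : ℕ) : Adp X₁ X₂ H (RR X₁ X₂ γ H) :=
  Adp.sum fun y _ => adp_er _ _ H

lemma two_time_le (h : GK G γ κ M g0 k0 m kap) (hs : IsPaintSetup G P X₁ X₂ ξ) (y y' : V) {t s : ℕ}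
    (hts : t ≤ s) : ∫ ω, |γ y (X₂ t ω)| * |γ y' (X₂ s ω)| ∂P ≤
      (Fintype.card V : ℝ)⁻¹ * ∑ z, M y z * M y' z := by
  obtain ⟨r, rfl⟩ := Nat.exists_eq_add_of_le hts
  rw [two_time h hs (fun z => |γ y z|) t r (fun z => |γ y' z|),
    stationary h hs t (fun z => |γ y z| * ((op1 G)^[r] (fun z => |γ y' z|)) z)]
  refine mul_le_mul_of_nonneg_left ?_ (by positivity)
  refine Finset.sum_le_sum fun z _ => ?_
  exact mul_le_mul (M_ge h y z) (h.hM r y' z) (op1_iter_nonneg (fun _ => abs_nonneg _) r z)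
    (M_nonneg h y z)

lemma RR_sq (h : GK G γ κ M g0 k0 m kap) (hs : IsPaintSetup G P X₁ X₂ ξ) (H : ℕ) :
    ∫ ω, (RR X₁ X₂ γ H ω) ^ 2 ∂P ≤ m ^ 2 := by
  have hN := card_pos_of hs
  have e : ∀ ω, (RR X₁ X₂ γ H ω) ^ 2 = ∑ y, ∑ y', ∑ t ∈ Finset.range (H + 1),
      ∑ s ∈ Finset.range (H + 1), (fh X₁ (fun z => z = y) t ω * fh X₁ (fun z => z = y') s ω) *
        (|γ y (X₂ t ω)| * |γ y' (X₂ s ω)|) := fun ω => by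
    rw [RR, sq, Finset.sum_mul_sum]
    refine Finset.sum_congr rfl fun y _ => Finset.sum_congr rfl fun y' _ => ?_
    rw [er, er, Finset.sum_mul_sum]
    refine Finset.sum_congr rfl fun t _ => Finset.sum_congr rfl fun s _ => by ring
  have hle : ∀ t ∈ Finset.range (H + 1), t ≤ H := fun t ht =>
    Nat.lt_succ_iff.1 (Finset.mem_range.1 ht)
  have aU : ∀ y y' : V, ∀ t ∈ Finset.range (H + 1), ∀ s ∈ Finset.range (H + 1),
      Adq X₁ H (fun ω => fh X₁ (fun z => z = y) t ω * fh X₁ (fun z => z = y') s ω) :=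
    fun y y' t ht s hs' => (adq_fh X₁ _ (hle t ht)).mul (adq_fh X₁ _ (hle s hs'))
  have aW : ∀ y y' : V, ∀ t ∈ Finset.range (H + 1), ∀ s ∈ Finset.range (H + 1),
      Adq X₂ H (fun ω => |γ y (X₂ t ω)| * |γ y' (X₂ s ω)|) :=
    fun y y' t ht s hs' => (adq_coord X₂ (hle t ht) (fun z => |γ y z|)).mul
      (adq_coord X₂ (hle s hs') (fun z => |γ y' z|))
  have iU : ∀ y y' : V, ∀ t ∈ Finset.range (H + 1), ∀ s ∈ Finset.range (H + 1),
      Integrable (fun ω => fh X₁ (fun z => z = y) t ω * fh X₁ (fun z => z = y') s ω) P :=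
    fun y y' t ht s hs' => ((aU y y' t ht s hs').adp₁ (X₂ := X₂)).integrable hs
  have iT : ∀ y y' : V, ∀ t ∈ Finset.range (H + 1), ∀ s ∈ Finset.range (H + 1),
      Integrable (fun ω => (fh X₁ (fun z => z = y) t ω * fh X₁ (fun z => z = y') s ω) *
        (|γ y (X₂ t ω)| * |γ y' (X₂ s ω)|)) P :=
    fun y y' t ht s hs' => ((aU y y' t ht s hs').adp₁.mul (aW y y' t ht s hs').adp₂).integrable hs
  simp only [e]
  rw [integral_finset_sum _ fun y _ => integrable_finset_sum _ fun y' _ =>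
    integrable_finset_sum _ fun t ht => integrable_finset_sum _ fun s hs' => iT y y' t ht s hs']
  have key : ∀ y y' : V, ∫ ω, ∑ t ∈ Finset.range (H + 1),
      ∑ s ∈ Finset.range (H + 1), (fh X₁ (fun z => z = y) t ω * fh X₁ (fun z => z = y') s ω) *
        (|γ y (X₂ t ω)| * |γ y' (X₂ s ω)|) ∂P ≤
      (Fintype.card V : ℝ)⁻¹ * ∑ z, M y z * M y' z := by
    intro y y'
    set c := (Fintype.card V : ℝ)⁻¹ * ∑ z, M y z * M y' z with hc
    have hc0 : 0 ≤ c := mul_nonneg (by positivity) (Finset.sum_nonneg fun z _ =>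
      mul_nonneg (M_nonneg h _ _) (M_nonneg h _ _))
    rw [integral_finset_sum _ fun t ht => integrable_finset_sum _ fun s hs' => iT y y' t ht s hs']
    have step : ∀ t ∈ Finset.range (H + 1), ∫ ω, ∑ s ∈ Finset.range (H + 1),
        (fh X₁ (fun z => z = y) t ω * fh X₁ (fun z => z = y') s ω) *
        (|γ y (X₂ t ω)| * |γ y' (X₂ s ω)|) ∂P ≤ ∑ s ∈ Finset.range (H + 1),
        (∫ ω, fh X₁ (fun z => z = y) t ω * fh X₁ (fun z => z = y') s ω ∂P) * c := by
      intro t ht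
      rw [integral_finset_sum _ fun s hs' => iT y y' t ht s hs']
      refine Finset.sum_le_sum fun s hs' => ?_
      rw [indep_walks hs (aU y y' t ht s hs') (aW y y' t ht s hs')]
      refine mul_le_mul_of_nonneg_left ?_ (integral_nonneg fun ω =>
        mul_nonneg (fh_nonneg _ _ _ _) (fh_nonneg _ _ _ _))
      rcases le_total t s with hts | hts
      · exact two_time_le h hs y y' hts
      · have := two_time_le h hs y' y hts
        rw [hc]
        simp only [mul_comm] at this ⊢
        exact this
    refine (Finset.sum_le_sum step).trans ?_
    simp only [← Finset.sum_mul]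
    have e2 : ∑ t ∈ Finset.range (H + 1), ∑ s ∈ Finset.range (H + 1),
        ∫ ω, fh X₁ (fun z => z = y) t ω * fh X₁ (fun z => z = y') s ω ∂P ≤ 1 := by
      have e3 : ∑ t ∈ Finset.range (H + 1), ∑ s ∈ Finset.range (H + 1),
        ∫ ω, fh X₁ (fun z => z = y) t ω * fh X₁ (fun z => z = y') s ω ∂P =
        ∫ ω, (∑ t ∈ Finset.range (H + 1), fh X₁ (fun z => z = y) t ω) *
          ∑ s ∈ Finset.range (H + 1), fh X₁ (fun z => z = y') s ω ∂P := by
        simp only [Finset.sum_mul_sum]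
        rw [integral_finset_sum _ fun t ht => integrable_finset_sum _ fun s hs' => iU y y' t ht s hs']
        refine Finset.sum_congr rfl fun t ht => ?_
        rw [integral_finset_sum _ fun s hs' => iU y y' t ht s hs']
      rw [e3]
      have : ∫ ω, (∑ t ∈ Finset.range (H + 1), fh X₁ (fun z => z = y) t ω) *
          ∑ s ∈ Finset.range (H + 1), fh X₁ (fun z => z = y') s ω ∂P ≤ ∫ ω, (1 : ℝ) ∂P := by
        refine integral_mono ?_ (integrable_const _) fun ω => ?_
        · simp only [Finset.sum_mul_sum]
          exact integrable_finset_sum _ fun t ht => integrable_finset_sum _ fun s hs' =>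
            iU y y' t ht s hs'
        · have a1 := fh_sum_le X₁ (fun z => z = y) (H + 1) ω
          have a2 := fh_sum_le X₁ (fun z => z = y') (H + 1) ω
          have a3 : 0 ≤ ∑ s ∈ Finset.range (H + 1), fh X₁ (fun z => z = y') s ω :=
            Finset.sum_nonneg fun s _ => fh_nonneg _ _ _ _
          dsimp only
          nlinarith
      simpa using this
    nlinarith
  have : ∑ y, ∫ ω, ∑ y', ∑ t ∈ Finset.range (H + 1),
      ∑ s ∈ Finset.range (H + 1), (fh X₁ (fun z => z = y) t ω * fh X₁ (fun z => z = y') s ω) *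
        (|γ y (X₂ t ω)| * |γ y' (X₂ s ω)|) ∂P ≤
      ∑ y, ∑ y', (Fintype.card V : ℝ)⁻¹ * ∑ z, M y z * M y' z := by
    refine Finset.sum_le_sum fun y _ => ?_
    rw [integral_finset_sum _ fun y' _ =>
      integrable_finset_sum _ fun t ht => integrable_finset_sum _ fun s hs' => iT y y' t ht s hs']
    exact Finset.sum_le_sum fun y' _ => key y y'
  refine this.trans ?_
  simp only [← Finset.mul_sum]
  have s1 := sum_sq_le h (u := M) (M_nonneg h) (fun _ _ => le_rfl)
  rwa [inv_mul_le_iff₀ hN]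

end PartA3

section PartA4

variable {G : SimpleGraph V} {γ κ M : V → V → ℝ} {g0 k0 m kap : ℝ}
variable {Ω : Type*} [MeasurableSpace Ω] {P : Measure Ω} [IsProbabilityMeasure P]
  {X₁ X₂ : ℕ → Ω → V} {ξ : V → Ω → Bool}

def paintP (X₁ X₂ : ℕ → Ω → V) (ξ : V → Ω → Bool) (x : V) (ω : Ω) : Prop :=
  hitTime X₁ x ω < hitTime X₂ x ω ∨ (hitTime X₁ x ω = hitTime X₂ x ω ∧ ξ x ω = true)

lemma hit_lt_iff (X Y : ℕ → Ω → V) (x : V) (ω : Ω) :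
    hitTime X x ω < hitTime Y x ω ↔ ∃ t, X t ω = x ∧ ∀ s ≤ t, Y s ω ≠ x := by
  unfold hitTime
  constructor
  · intro h
    simp only [iInf_lt_iff] at h
    obtain ⟨t, ht, h⟩ := h
    refine ⟨t, ht, fun s hs hc => ?_⟩
    have h1 : (⨅ (s : ℕ) (_ : Y s ω = x), (s : ℕ∞)) ≤ s := iInf₂_le s hc
    have h2 := h.trans_le h1
    have : t < s := by exact_mod_cast h2
    omega
  · rintro ⟨t, ht, h⟩
    have h1 : (⨅ (s : ℕ) (_ : X s ω = x), (s : ℕ∞)) ≤ t := iInf₂_le t ht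
    have h2 : ((t + 1 : ℕ) : ℕ∞) ≤ (⨅ (s : ℕ) (_ : Y s ω = x), (s : ℕ∞)) := by
      refine le_iInf₂ fun s hs => ?_
      have : t < s := by
        by_contra hc
        exact h s (by omega) hs
      exact_mod_cast this
    refine h1.trans_lt (lt_of_lt_of_le ?_ h2)
    exact_mod_cast Nat.lt_succ_self t

lemma meas_hit_lt {X Y : ℕ → Ω → V} (h1 : ∀ t x, MeasurableSet {ω | X t ω = x})
    (h2 : ∀ t x, MeasurableSet {ω | Y t ω = x}) (x : V) :
    MeasurableSet {ω | hitTime X x ω < hitTime Y x ω} := by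
  have : {ω | hitTime X x ω < hitTime Y x ω} =
      ⋃ t, ({ω | X t ω = x} ∩ ⋂ s, ⋂ (_ : s ≤ t), {ω | Y s ω = x}ᶜ) := by
    ext ω
    simp [hit_lt_iff]
  rw [this]
  exact MeasurableSet.iUnion fun t => (h1 t x).inter
    (MeasurableSet.iInter fun s => MeasurableSet.iInter fun _ => (h2 s x).compl)

lemma meas_paintP (hs : IsPaintSetup G P X₁ X₂ ξ) (x : V) :
    MeasurableSet {ω | paintP X₁ X₂ ξ x ω} := by
  have a := meas_hit_lt hs.meas₁ hs.meas₂ x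
  have b := meas_hit_lt hs.meas₂ hs.meas₁ x
  have : {ω | paintP X₁ X₂ ξ x ω} = {ω | hitTime X₁ x ω < hitTime X₂ x ω} ∪
      (({ω | hitTime X₁ x ω < hitTime X₂ x ω}ᶜ ∩ {ω | hitTime X₂ x ω < hitTime X₁ x ω}ᶜ) ∩
        {ω | ξ x ω = true}) := by
    ext ω
    simp only [paintP, Set.mem_setOf_eq, Set.mem_union, Set.mem_inter_iff, Set.mem_compl_iff,
      not_lt, le_antisymm_iff]
    tauto
  rw [this]
  exact a.union ((a.compl.inter b.compl).inter (hs.measξ x))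

/-- sign of a vertex -/
def sn (X₁ X₂ : ℕ → Ω → V) (ξ : V → Ω → Bool) (x : V) (ω : Ω) : ℝ :=
  if paintP X₁ X₂ ξ x ω then 1 else -1

lemma paintedCount_eq (ω : Ω) :
    2 * (paintedCount X₁ X₂ ξ ω : ℝ) = Fintype.card V + ∑ x, sn X₁ X₂ ξ x ω := by
  have : (paintedCount X₁ X₂ ξ ω : ℝ) = ∑ x, if paintP X₁ X₂ ξ x ω then (1 : ℝ) else 0 := by
    unfold paintedCount
    rw [Nat.card_eq_fintype_card, Fintype.card_subtype]
    rw [Finset.card_filter, Nat.cast_sum]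
    refine Finset.sum_congr rfl fun x _ => ?_
    unfold paintP
    split_ifs <;> simp
  rw [this, Finset.mul_sum]
  have e : (Fintype.card V : ℝ) = ∑ x : V, (1 : ℝ) := by simp
  rw [e, ← Finset.sum_add_distrib]
  refine Finset.sum_congr rfl fun x _ => ?_
  unfold sn
  split_ifs <;> norm_num

lemma sn_int (hs : IsPaintSetup G P X₁ X₂ ξ) (x : V) : Measurable (sn X₁ X₂ ξ x) :=
  Measurable.ite (meas_paintP hs x) measurable_const measurable_const

lemma sn_abs (x : V) (ω : Ω) : |sn X₁ X₂ ξ x ω| = 1 := by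
  unfold sn; split_ifs <;> simp

lemma sn_point (h : GK G γ κ M g0 k0 m kap) (y : V) (H : ℕ) (ω : Ω) :
    |g0 * sn X₁ X₂ ξ y ω - stv X₁ X₂ (BB y) (Phi γ y) H ω| ≤
      (er X₁ X₂ (fun z => z = y) (fun z => |γ y z|) (H + 1) ω +
      er X₂ X₁ (fun z => z = y) (fun z => |γ y z|) (H + 1) ω) +
      3 * g0 * al X₁ X₂ (BB y) H ω := by
  have g00 : 0 ≤ g0 := (abs_nonneg _).trans (h.γle y y)
  have e1 := er_nonneg (X₁ := X₁) (X₂ := X₂) (fun z => z = y) (u := fun z => |γ y z|)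
    (fun z => abs_nonneg _) (H + 1) ω
  have e2 := er_nonneg (X₁ := X₂) (X₂ := X₁) (fun z => z = y) (u := fun z => |γ y z|)
    (fun z => abs_nonneg _) (H + 1) ω
  have hg : |g0 * sn X₁ X₂ ξ y ω| = g0 := by
    rw [abs_mul, sn_abs, mul_one, abs_of_nonneg g00]
  by_cases ha : aliveP X₁ X₂ (BB y) H ω
  · have : al X₁ X₂ (BB y) H ω = 1 := if_pos ha
    rw [this]
    have b1 := abs_sub (g0 * sn X₁ X₂ ξ y ω) (stv X₁ X₂ (BB y) (Phi γ y) H ω)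
    have b2 : |stv X₁ X₂ (BB y) (Phi γ y) H ω| ≤ 2 * g0 := by
      unfold stv Phi
      have a1 := h.γle y (X₁ (sg X₁ X₂ (BB y) H ω) ω)
      have a2 := h.γle y (X₂ (sg X₁ X₂ (BB y) H ω) ω)
      have := abs_sub (γ y (X₁ (sg X₁ X₂ (BB y) H ω) ω)) (γ y (X₂ (sg X₁ X₂ (BB y) H ω) ω))
      linarith
    linarith
  · rw [al_of_not ω ha]
    obtain ⟨h1, h2⟩ := sg_hit ha
    have hlt : sg X₁ X₂ (BB y) H ω < H + 1 := Nat.lt_succ_iff.2 (sg_le H ω)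
    unfold stv
    set s := sg X₁ X₂ (BB y) H ω
    have hn1 : ∀ i < s, ¬ X₁ i ω = y := fun i hi hc => h2 i hi (Or.inl hc)
    have hn2 : ∀ i < s, ¬ X₂ i ω = y := fun i hi hc => h2 i hi (Or.inr hc)
    by_cases c1 : X₁ s ω = y
    · have g1 := er_ge (X₂ := X₂) (fun z => z = y) (u := fun z => |γ y z|)
        (fun z => abs_nonneg _) hlt ω c1 hn1
      by_cases c2 : X₂ s ω = y
      · have : Phi γ y (X₁ s ω) (X₂ s ω) = 0 := by rw [c1, c2, Phi, sub_self]
        rw [this, sub_zero, hg]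
        rw [c2, h.γd, abs_of_nonneg g00] at g1
        linarith
      · have hp : paintP X₁ X₂ ξ y ω := by
          left
          rw [hit_lt_iff]
          refine ⟨s, c1, fun i hi hc => ?_⟩
          rcases Nat.lt_or_ge i s with h3 | h3
          · exact hn2 i h3 hc
          · have : i = s := by omega
            subst this; exact c2 hc
        rw [show sn X₁ X₂ ξ y ω = 1 from if_pos hp, c1, Phi, h.γd]
        rw [show g0 * 1 - (g0 - γ y (X₂ s ω)) = γ y (X₂ s ω) by ring]
        linarith
    · have c2 : X₂ s ω = y := by
        rcases h1 with h1 | h1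
        · exact absurd h1 c1
        · exact h1
      have g1 := er_ge (X₁ := X₂) (X₂ := X₁) (fun z => z = y) (u := fun z => |γ y z|)
        (fun z => abs_nonneg _) hlt ω c2 hn2
      have hp : ¬ paintP X₁ X₂ ξ y ω := by
        have : hitTime X₂ y ω < hitTime X₁ y ω := by
          rw [hit_lt_iff]
          refine ⟨s, c2, fun i hi hc => ?_⟩
          rcases Nat.lt_or_ge i s with h3 | h3
          · exact hn1 i h3 hc
          · have : i = s := by omega
            subst this; exact c1 hc
        rintro (h5 | h5)
        · exact absurd h5 this.le.not_gt
        · exact absurd h5.1 this.ne'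
      rw [show sn X₁ X₂ ξ y ω = -1 from if_neg hp, c2, Phi, h.γd]
      rw [show g0 * -1 - (γ y (X₁ s ω) - g0) = -γ y (X₁ s ω) by ring, abs_neg]
      linarith

def SS (X₁ X₂ : ℕ → Ω → V) (ξ : V → Ω → Bool) (ω : Ω) : ℝ := ∑ x, sn X₁ X₂ ξ x ω

def A3 (X₁ X₂ : ℕ → Ω → V) (H : ℕ) (ω : Ω) : ℝ := ∑ y, al X₁ X₂ (BB y) H ω

lemma SS_point (h : GK G γ κ M g0 k0 m kap) (H : ℕ) (ω : Ω) :
    |g0 * SS X₁ X₂ ξ ω - LL X₁ X₂ γ H ω| ≤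
      (RR X₁ X₂ γ H ω + RR X₂ X₁ γ H ω) + 3 * g0 * A3 X₁ X₂ H ω := by
  unfold SS LL RR A3
  rw [Finset.mul_sum, ← Finset.sum_sub_distrib, ← Finset.sum_add_distrib, Finset.mul_sum,
    ← Finset.sum_add_distrib]
  exact (Finset.abs_sum_le_sum_abs _ _).trans (Finset.sum_le_sum fun y _ => sn_point h y H ω)

lemma A3_sq (h : GK G γ κ M g0 k0 m kap) (hs : IsPaintSetup G P X₁ X₂ ξ) (H : ℕ) :
    H * ∫ ω, (A3 X₁ X₂ H ω) ^ 2 ∂P ≤ (Fintype.card V : ℝ) ^ 3 * g0 := by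
  have hN := card_pos_of hs
  have hle : ∀ ω, (A3 X₁ X₂ H ω) ^ 2 ≤ Fintype.card V * A3 X₁ X₂ H ω := by
    intro ω
    have h1 : A3 X₁ X₂ H ω ≤ Fintype.card V := by
      unfold A3
      have : ∀ y ∈ (Finset.univ : Finset V), al X₁ X₂ (BB y) H ω ≤ 1 := fun y _ => by
        unfold al; split_ifs <;> norm_num
      simpa using Finset.sum_le_sum this
    have h0 : 0 ≤ A3 X₁ X₂ H ω := Finset.sum_nonneg fun y _ => al_nonneg H ω
    nlinarith
  have aA : Adp X₁ X₂ H (A3 X₁ X₂ H) := Adp.sum fun y _ => adp_al H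
  have i2 : Integrable (fun ω => (A3 X₁ X₂ H ω) ^ 2) P := by
    simp only [sq]; exact (aA.mul aA).integrable hs
  have := integral_mono i2 ((aA.integrable hs).const_mul (Fintype.card V : ℝ)) hle
  rw [integral_const_mul] at this
  have e : ∫ ω, A3 X₁ X₂ H ω ∂P = ∑ y, ∫ ω, al X₁ X₂ (BB y) H ω ∂P := by
    unfold A3
    exact integral_finset_sum _ fun y _ => (adp_al H).integrable hs
  have b : H * ∫ ω, A3 X₁ X₂ H ω ∂P ≤ Fintype.card V * (Fintype.card V * g0) := by
    rw [e, Finset.mul_sum]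
    have : ∀ y ∈ (Finset.univ : Finset V), H * ∫ ω, al X₁ X₂ (BB y) H ω ∂P ≤
        Fintype.card V * g0 := fun y _ => by
      have := alive_le h hs y y H
      have e : CC y y = BB y := by
        funext a b; simp [CC, BB]
      rwa [e] at this
    simpa using Finset.sum_le_sum this
  have hH : (0 : ℝ) ≤ H := by positivity
  nlinarith

lemma var_core {Y L : Ω → ℝ} {E : ℝ} (hY : MemLp Y 2 P) (hL : MemLp L 2 P)
    (hL0 : ∫ ω, L ω ∂P = 0) (hD : ∫ ω, (Y ω - L ω) ^ 2 ∂P ≤ E) {ε : ℝ} (hε : 0 < ε) :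
    |variance Y P - ∫ ω, (L ω) ^ 2 ∂P| ≤ ε * ∫ ω, (L ω) ^ 2 ∂P + (1 + ε⁻¹) * E := by
  have hDm : MemLp (fun ω => Y ω - L ω) 2 P := hY.sub hL
  have iY : Integrable Y P := hY.integrable (by norm_num)
  have iL : Integrable L P := hL.integrable (by norm_num)
  have iD : Integrable (fun ω => Y ω - L ω) P := iY.sub iL
  have iY2 : Integrable (fun ω => Y ω ^ 2) P := hY.integrable_sq
  have iL2 : Integrable (fun ω => L ω ^ 2) P := hL.integrable_sq
  have iD2 : Integrable (fun ω => (Y ω - L ω) ^ 2) P := hDm.integrable_sq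
  set d := ∫ ω, (Y ω - L ω) ∂P with hd
  have d1 : ∫ ω, Y ω ∂P = d := by
    rw [hd, integral_sub iY iL, hL0, sub_zero]
  have d2 : d ^ 2 ≤ ∫ ω, (Y ω - L ω) ^ 2 ∂P := by
    have := variance_nonneg (fun ω => Y ω - L ω) P
    rw [variance_eq_sub hDm] at this
    simp only [Pi.pow_apply] at this
    linarith
  have v : variance Y P = ∫ ω, Y ω ^ 2 ∂P - d ^ 2 := by
    rw [variance_eq_sub hY, d1]; rfl
  have up : ∫ ω, Y ω ^ 2 ∂P ≤ ∫ ω, ((1 + ε) * L ω ^ 2 + (1 + ε⁻¹) * (Y ω - L ω) ^ 2) ∂P := by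
    refine integral_mono iY2 ((iL2.const_mul _).add (iD2.const_mul _)) fun ω => ?_
    have : 0 ≤ (ε * L ω - (Y ω - L ω)) ^ 2 * ε⁻¹ := by positivity
    have e : (ε * L ω - (Y ω - L ω)) ^ 2 * ε⁻¹ = (1 + ε) * L ω ^ 2 + (1 + ε⁻¹) * (Y ω - L ω) ^ 2
        - Y ω ^ 2 := by field_simp; ring
    dsimp only
    linarith
  have dn : ∫ ω, ((1 - ε) * L ω ^ 2 + (1 - ε⁻¹) * (Y ω - L ω) ^ 2) ∂P ≤ ∫ ω, Y ω ^ 2 ∂P := by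
    refine integral_mono ((iL2.const_mul _).add (iD2.const_mul _)) iY2 fun ω => ?_
    have : 0 ≤ (ε * L ω + (Y ω - L ω)) ^ 2 * ε⁻¹ := by positivity
    have e : (ε * L ω + (Y ω - L ω)) ^ 2 * ε⁻¹ = Y ω ^ 2 -
      ((1 - ε) * L ω ^ 2 + (1 - ε⁻¹) * (Y ω - L ω) ^ 2) := by field_simp; ring
    dsimp only
    linarith
  rw [integral_add (iL2.const_mul _) (iD2.const_mul _), integral_const_mul, integral_const_mul]
    at up dn
  have hp : 0 < ε⁻¹ := inv_pos.2 hε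
  have D0 : 0 ≤ ∫ ω, (Y ω - L ω) ^ 2 ∂P := integral_nonneg fun ω => sq_nonneg _
  rw [v, abs_le]
  constructor <;> nlinarith [sq_nonneg d]

theorem partA (h : GK G γ κ M g0 k0 m kap) (hs : IsPaintSetup G P X₁ X₂ ξ) {ε : ℝ} (hε : 0 < ε) :
    |4 * g0 ^ 2 * variance (fun ω => (paintedCount X₁ X₂ ξ ω : ℝ)) P - Fintype.card V * k0| ≤
      (1 + ε) * (3 * m ^ 2 + 6 * kap + 2 * (Fintype.card V * g0)) +
      ε * |Fintype.card V * k0| + (1 + ε⁻¹) * (6 * m ^ 2 + 1) := by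
  have hN := card_pos_of hs
  obtain ⟨H, hH⟩ := exists_nat_ge (max (max 1 (3 * (Fintype.card V : ℝ) ^ 2 * g0))
    (27 * g0 ^ 3 * (Fintype.card V : ℝ) ^ 3))
  have hH1 : (1 : ℝ) ≤ H := ((le_max_left _ _).trans (le_max_left _ _)).trans hH
  have hH2 : 3 * (Fintype.card V : ℝ) ^ 2 * g0 ≤ H :=
    ((le_max_right _ _).trans (le_max_left _ _)).trans hH
  have hH3 : 27 * g0 ^ 3 * (Fintype.card V : ℝ) ^ 3 ≤ H := (le_max_right _ _).trans hH
  have hH0 : 0 < H := by exact_mod_cast (lt_of_lt_of_le zero_lt_one hH1)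
  set L := LL X₁ X₂ γ H with hL
  set Y : Ω → ℝ := fun ω => g0 * SS X₁ X₂ ξ ω with hY
  have mS : Measurable (SS X₁ X₂ ξ) := Finset.measurable_sum _ fun x _ => sn_int hs x
  have bS : ∀ ω, |SS X₁ X₂ ξ ω| ≤ Fintype.card V := fun ω => by
    refine (Finset.abs_sum_le_sum_abs _ _).trans ?_
    simp [sn_abs]
  have mY : MemLp Y 2 P := by
    refine MemLp.of_bound (mS.const_mul g0).aestronglyMeasurable (|g0| * Fintype.card V)
      (ae_of_all _ fun ω => ?_)
    rw [Real.norm_eq_abs, abs_mul]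
    exact mul_le_mul_of_nonneg_left (bS ω) (abs_nonneg _)
  have aL : Adp X₁ X₂ H L := adp_LL H
  have mL : MemLp L 2 P := by
    rw [memLp_two_iff_integrable_sq (aL.integrable hs).aestronglyMeasurable]
    simp only [sq]
    exact (aL.mul aL).integrable hs
  have aR1 : Adp X₁ X₂ H (RR X₁ X₂ γ H) := adp_RR H
  have aR2 : Adp X₂ X₁ H (RR X₂ X₁ γ H) := adp_RR H
  have aA : Adp X₁ X₂ H (A3 X₁ X₂ H) := Adp.sum fun y _ => adp_al H
  have iR1 : Integrable (fun ω => (RR X₁ X₂ γ H ω) ^ 2) P := by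
    simp only [sq]; exact (aR1.mul aR1).integrable hs
  have iR2 : Integrable (fun ω => (RR X₂ X₁ γ H ω) ^ 2) P := by
    simp only [sq]; exact (aR2.mul aR2).integrable hs.symm
  have iA : Integrable (fun ω => (A3 X₁ X₂ H ω) ^ 2) P := by
    simp only [sq]; exact (aA.mul aA).integrable hs
  have hD : ∫ ω, (Y ω - L ω) ^ 2 ∂P ≤ 6 * m ^ 2 + 1 := by
    have i1 : Integrable (fun ω => 3 * (RR X₁ X₂ γ H ω) ^ 2 + 3 * (RR X₂ X₁ γ H ω) ^ 2) P :=
      (iR1.const_mul 3).add (iR2.const_mul 3)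
    have i2 : Integrable (fun ω => (3 * (RR X₁ X₂ γ H ω) ^ 2 + 3 * (RR X₂ X₁ γ H ω) ^ 2) +
      27 * g0 ^ 2 * (A3 X₁ X₂ H ω) ^ 2) P := i1.add (iA.const_mul _)
    have : ∫ ω, (Y ω - L ω) ^ 2 ∂P ≤ ∫ ω, ((3 * (RR X₁ X₂ γ H ω) ^ 2 +
        3 * (RR X₂ X₁ γ H ω) ^ 2) + 27 * g0 ^ 2 * (A3 X₁ X₂ H ω) ^ 2) ∂P := by
      refine integral_mono (mY.sub mL).integrable_sq i2 fun ω => ?_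
      have p := SS_point (X₁ := X₁) (X₂ := X₂) (ξ := ξ) h H ω
      have p2 : (Y ω - L ω) ^ 2 ≤ ((RR X₁ X₂ γ H ω + RR X₂ X₁ γ H ω) +
        3 * g0 * A3 X₁ X₂ H ω) ^ 2 := by
        rw [← sq_abs]
        exact pow_le_pow_left₀ (abs_nonneg _) p 2
      refine p2.trans ?_
      nlinarith [sq_nonneg (RR X₁ X₂ γ H ω - RR X₂ X₁ γ H ω),
        sq_nonneg (RR X₁ X₂ γ H ω - 3 * g0 * A3 X₁ X₂ H ω),
        sq_nonneg (RR X₂ X₁ γ H ω - 3 * g0 * A3 X₁ X₂ H ω)]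
    refine this.trans ?_
    rw [integral_add i1 (iA.const_mul _), integral_add (iR1.const_mul 3) (iR2.const_mul 3),
      integral_const_mul, integral_const_mul, integral_const_mul]
    have r1 := RR_sq h hs H
    have r2 := RR_sq h hs.symm H
    have r3 := A3_sq h hs H
    have r4 : 27 * g0 ^ 2 * ∫ ω, (A3 X₁ X₂ H ω) ^ 2 ∂P ≤ 1 := by
      have hHr : (0 : ℝ) < H := by linarith
      have : H * (27 * g0 ^ 2 * ∫ ω, (A3 X₁ X₂ H ω) ^ 2 ∂P) ≤ H * 1 := by
        nlinarith [sq_nonneg g0]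
      exact le_of_mul_le_mul_left this hHr
    linarith
  have vc := var_core mY mL (LL_mean h hs H) hD hε
  have lb := LL_sq_bound h hs H hH2 hH0
  have vY : variance Y P = 4 * g0 ^ 2 * variance (fun ω => (paintedCount X₁ X₂ ξ ω : ℝ)) P := by
    have e : Y = fun ω => (2 * g0) * ((paintedCount X₁ X₂ ξ ω : ℝ) - Fintype.card V / 2) := by
      funext ω
      have := paintedCount_eq (X₁ := X₁) (X₂ := X₂) (ξ := ξ) ω
      simp only [hY, SS]
      linear_combination (-g0) * this
    have mp : AEStronglyMeasurable (fun ω => (paintedCount X₁ X₂ ξ ω : ℝ)) P := by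
      have : (fun ω => (paintedCount X₁ X₂ ξ ω : ℝ)) = fun ω =>
          (Fintype.card V + SS X₁ X₂ ξ ω) / 2 := by
        funext ω
        have := paintedCount_eq (X₁ := X₁) (X₂ := X₂) (ξ := ξ) ω
        simp only [SS]; linarith
      rw [this]
      exact ((measurable_const.add mS).div_const 2).aestronglyMeasurable
    rw [e, variance_const_mul, variance_sub_const mp]
    ring
  rw [← vY]
  have a1 := abs_sub_le (variance Y P) (∫ ω, L ω ^ 2 ∂P) (Fintype.card V * k0)
  have a2 : ∫ ω, L ω ^ 2 ∂P ≤ |Fintype.card V * k0| +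
      (3 * m ^ 2 + 6 * kap + 2 * (Fintype.card V * g0)) := by
    have := (abs_le.1 lb).2
    have := le_abs_self ((Fintype.card V : ℝ) * k0)
    linarith
  nlinarith

end PartA4

section Walk

variable {R : Type*} [CommRing R]

def ev (R : Type*) [CommRing R] (i : Fin 4) : Fin 4 → R := Pi.single i 1

def Pop (f : (Fin 4 → R) → ℝ) (x : Fin 4 → R) : ℝ :=
  f x / 2 + (∑ i, (f (x + ev R i) + f (x - ev R i))) / 16

def dl (R : Type*) [CommRing R] (x : Fin 4 → R) : ℝ := if x = 0 then 1 else 0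

def pk (R : Type*) [CommRing R] (t : ℕ) : (Fin 4 → R) → ℝ := Pop^[t] (dl R)

lemma Pop_add (f g : (Fin 4 → R) → ℝ) : Pop (fun x => f x + g x) = fun x => Pop f x + Pop g x := by
  funext x
  simp only [Pop, Finset.sum_add_distrib]
  ring

lemma Pop_sub (f g : (Fin 4 → R) → ℝ) : Pop (fun x => f x - g x) = fun x => Pop f x - Pop g x := by
  funext x
  simp only [Pop, Finset.sum_add_distrib, Finset.sum_sub_distrib]
  ring

lemma Pop_smul (c : ℝ) (f : (Fin 4 → R) → ℝ) : Pop (fun x => c * f x) = fun x => c * Pop f x := by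
  funext x
  simp only [Pop, ← mul_add, ← Finset.mul_sum]
  ring

lemma Pop_const (c : ℝ) : Pop (fun _ : Fin 4 → R => c) = fun _ => c := by
  funext x
  simp [Pop]
  ring

lemma Pop_sum {ι : Type*} (s : Finset ι) (f : ι → (Fin 4 → R) → ℝ) :
    Pop (fun x => ∑ i ∈ s, f i x) = fun x => ∑ i ∈ s, Pop (f i) x := by
  induction s using Finset.induction_on with
  | empty => simpa using Pop_const (R := R) 0
  | insert a s ha ih =>
    simp only [Finset.sum_insert ha]
    rw [Pop_add, ih]

lemma Pop_mono {f g : (Fin 4 → R) → ℝ} (h : ∀ x, f x ≤ g x) (x : Fin 4 → R) : Pop f x ≤ Pop g x := by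
  unfold Pop
  have : ∑ i, (f (x + ev R i) + f (x - ev R i)) ≤ ∑ i, (g (x + ev R i) + g (x - ev R i)) :=
    Finset.sum_le_sum fun i _ => add_le_add (h _) (h _)
  have := h x
  linarith

lemma Pop_iter_mono {f g : (Fin 4 → R) → ℝ} (h : ∀ x, f x ≤ g x) (t : ℕ) (x : Fin 4 → R) :
    (Pop^[t] f) x ≤ (Pop^[t] g) x := by
  induction t generalizing f g with
  | zero => exact h x
  | succ t ih => exact ih (fun x => Pop_mono h x)

lemma Pop_iter_add (f g : (Fin 4 → R) → ℝ) (t : ℕ) :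
    Pop^[t] (fun x => f x + g x) = fun x => (Pop^[t] f) x + (Pop^[t] g) x := by
  induction t generalizing f g with
  | zero => rfl
  | succ t ih => rw [Function.iterate_succ_apply, Pop_add, ih]; rfl

lemma Pop_iter_const (c : ℝ) (t : ℕ) : Pop^[t] (fun _ : Fin 4 → R => c) = fun _ => c := by
  induction t with
  | zero => rfl
  | succ t ih => rw [Function.iterate_succ_apply, Pop_const, ih]

lemma Pop_iter_smul (c : ℝ) (f : (Fin 4 → R) → ℝ) (t : ℕ) :
    Pop^[t] (fun x => c * f x) = fun x => c * (Pop^[t] f) x := by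
  induction t generalizing f with
  | zero => rfl
  | succ t ih => rw [Function.iterate_succ_apply, Pop_smul, ih]; rfl

lemma Pop_iter_sum {ι : Type*} (s : Finset ι) (f : ι → (Fin 4 → R) → ℝ) (t : ℕ) :
    Pop^[t] (fun x => ∑ i ∈ s, f i x) = fun x => ∑ i ∈ s, (Pop^[t] (f i)) x := by
  induction t generalizing f with
  | zero => rfl
  | succ t ih => rw [Function.iterate_succ_apply, Pop_sum, ih]; rfl

lemma Pop_neg (f : (Fin 4 → R) → ℝ) : Pop (fun x => f (-x)) = fun x => Pop f (-x) := by
  funext x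
  unfold Pop
  congr 2
  refine Finset.sum_congr rfl fun i _ => ?_
  dsimp only
  rw [add_comm, show -(x - ev R i) = -x + ev R i by abel, show -(x + ev R i) = -x - ev R i by abel]

lemma Pop_shift (f : (Fin 4 → R) → ℝ) (a : Fin 4 → R) :
    Pop (fun x => f (x - a)) = fun x => Pop f (x - a) := by
  funext x
  unfold Pop
  congr 2
  refine Finset.sum_congr rfl fun i _ => ?_
  dsimp only
  rw [show x + ev R i - a = x - a + ev R i by abel, show x - ev R i - a = x - a - ev R i by abel]

lemma Pop_iter_shift (f : (Fin 4 → R) → ℝ) (a : Fin 4 → R) (t : ℕ) :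
    Pop^[t] (fun x => f (x - a)) = fun x => (Pop^[t] f) (x - a) := by
  induction t generalizing f with
  | zero => rfl
  | succ t ih => rw [Function.iterate_succ_apply, Pop_shift, ih]; rfl

lemma pk_zero : pk R 0 = dl R := rfl

lemma pk_succ (t : ℕ) : pk R (t + 1) = Pop (pk R t) := Function.iterate_succ_apply' _ _ _

lemma pk_iter (s t : ℕ) : Pop^[s] (pk R t) = pk R (s + t) := by
  unfold pk; rw [Function.iterate_add_apply]

lemma pk_neg (t : ℕ) (x : Fin 4 → R) : pk R t (-x) = pk R t x := by
  induction t generalizing x with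
  | zero => simp [pk, dl]
  | succ t ih =>
    have : (fun x => pk R t (-x)) = pk R t := funext ih
    rw [pk_succ, ← congrFun (Pop_neg (pk R t)) x, this]

lemma pk_nonneg (t : ℕ) (x : Fin 4 → R) : 0 ≤ pk R t x := by
  have h := Pop_iter_mono (f := fun _ : Fin 4 → R => (0 : ℝ)) (g := dl R)
    (fun x => by unfold dl; split_ifs <;> norm_num) t x
  rw [Pop_iter_const] at h
  exact h

lemma pk_fin (t : ℕ) : (Function.support (pk R t)).Finite := by
  induction t with
  | zero =>
    refine (Set.finite_singleton (0 : Fin 4 → R)).subset fun x hx => ?_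
    by_contra h
    exact hx (if_neg h)
  | succ t ih =>
    have hsub : Function.support (pk R (t + 1)) ⊆ Function.support (pk R t) ∪
        ⋃ i, ((fun x => x - ev R i) '' Function.support (pk R t) ∪
          (fun x => x + ev R i) '' Function.support (pk R t)) := by
      intro x hx
      by_contra hc
      simp only [Set.mem_union, Set.mem_iUnion, not_or, not_exists] at hc
      obtain ⟨h1, h2⟩ := hc
      refine hx ?_
      rw [pk_succ, Pop, Function.notMem_support.1 h1]
      have : ∀ i ∈ (Finset.univ : Finset (Fin 4)),
          pk R t (x + ev R i) + pk R t (x - ev R i) = 0 := by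
        intro i _
        have a : pk R t (x + ev R i) = 0 := by
          by_contra hh
          exact (h2 i).1 ⟨x + ev R i, hh, by simp⟩
        have b : pk R t (x - ev R i) = 0 := by
          by_contra hh
          exact (h2 i).2 ⟨x - ev R i, hh, by simp⟩
        rw [a, b, add_zero]
      rw [Finset.sum_eq_zero this]
      norm_num
    exact (ih.union (Set.finite_iUnion fun i => (ih.image _).union (ih.image _))).subset hsub

lemma summ_of_fin {p : (Fin 4 → R) → ℝ} (hp : (Function.support p).Finite)
    (f : (Fin 4 → R) → ℝ) : Summable (fun x => p x * f x) :=
  summable_of_finite_support (hp.subset fun x hx => left_ne_zero_of_mul hx)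

lemma Pop_adj {p : (Fin 4 → R) → ℝ} (hp : (Function.support p).Finite) (f : (Fin 4 → R) → ℝ) :
    ∑' y, Pop p y * f y = ∑' y, p y * Pop f y := by
  have e1 : ∀ y, Pop p y * f y = p y * (f y / 2) + ∑ i, (p (y + ev R i) * (f y / 16) +
      p (y - ev R i) * (f y / 16)) := by
    intro y
    unfold Pop
    simp only [← add_mul, ← Finset.sum_mul]
    ring
  have e2 : ∀ y, p y * Pop f y = p y * (f y / 2) + ∑ i, (p y * (f (y - ev R i) / 16) +
      p y * (f (y + ev R i) / 16)) := by
    intro y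
    unfold Pop
    have hc : ∑ i, (f (y + ev R i) + f (y - ev R i)) = ∑ i, (f (y - ev R i) + f (y + ev R i)) :=
      Finset.sum_congr rfl fun i _ => add_comm _ _
    rw [hc]
    simp only [← mul_add, ← Finset.mul_sum, ← add_div, ← Finset.sum_div]
  have shp : ∀ i, Summable fun y => p (y + ev R i) * (f y / 16) := by
    intro i
    have := (Equiv.addRight (ev R i)).summable_iff.2 (summ_of_fin hp (fun y => f (y - ev R i) / 16))
    refine this.congr fun y => ?_
    simp
  have shm : ∀ i, Summable fun y => p (y - ev R i) * (f y / 16) := by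
    intro i
    have := (Equiv.subRight (ev R i)).summable_iff.2 (summ_of_fin hp (fun y => f (y + ev R i) / 16))
    refine this.congr fun y => ?_
    simp
  have tp : ∀ i, ∑' y, p (y + ev R i) * (f y / 16) = ∑' y, p y * (f (y - ev R i) / 16) := by
    intro i
    rw [← (Equiv.addRight (ev R i)).tsum_eq (fun y => p y * (f (y - ev R i) / 16))]
    simp
  have tm : ∀ i, ∑' y, p (y - ev R i) * (f y / 16) = ∑' y, p y * (f (y + ev R i) / 16) := by
    intro i
    rw [← (Equiv.subRight (ev R i)).tsum_eq (fun y => p y * (f (y + ev R i) / 16))]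
    simp
  simp only [e1, e2]
  rw [(summ_of_fin hp _).tsum_add (summable_sum fun i _ => (shp i).add (shm i)),
    (summ_of_fin hp _).tsum_add (summable_sum fun i _ => (summ_of_fin hp _).add (summ_of_fin hp _)),
    Summable.tsum_finsetSum (fun i _ => (shp i).add (shm i)),
    Summable.tsum_finsetSum (fun i _ => (summ_of_fin hp _).add (summ_of_fin hp _))]
  congr 1
  refine Finset.sum_congr rfl fun i _ => ?_
  rw [(shp i).tsum_add (shm i), (summ_of_fin hp _).tsum_add (summ_of_fin hp _), tp, tm]

lemma pairing (t : ℕ) (f : (Fin 4 → R) → ℝ) : ∑' y, pk R t y * f y = (Pop^[t] f) 0 := by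
  induction t generalizing f with
  | zero =>
    rw [tsum_eq_single (0 : Fin 4 → R)]
    · simp [pk, dl]
    · intro y hy; simp [pk, dl, hy]
  | succ t ih => rw [pk_succ, Pop_adj (pk_fin t), ih, Function.iterate_succ_apply]

lemma pk_sum (t : ℕ) : ∑' y, pk R t y = 1 := by
  have := pairing (R := R) t (fun _ => 1)
  rw [Pop_iter_const] at this
  simpa using this

lemma pk_summable (t : ℕ) : Summable (pk R t) := summable_of_finite_support (pk_fin t)

lemma pk_conv (s t : ℕ) : ∑' y, pk R s y * pk R t y = pk R (s + t) 0 := by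
  rw [pairing, pk_iter]

/-- neighbour indicator -/
lemma nbr_ind (h1 : (1 : R) ≠ 0) (h2 : (2 : R) ≠ 0) (x y : Fin 4 → R) :
    (if ∃ i : Fin 4, y - x = Pi.single i 1 ∨ x - y = Pi.single i 1 then (1 : ℝ) else 0) =
      ∑ i, ((if y = x + ev R i then 1 else 0) + (if y = x - ev R i then 1 else 0)) := by
  have hne : ∀ i j : Fin 4, i ≠ j → ev R i ≠ ev R j := by
    intro i j hij h
    have := congrFun h i
    simp [ev, hij] at this
    exact h1 this
  have hne2 : ∀ i j : Fin 4, ev R i ≠ - ev R j := by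
    intro i j h
    have := congrFun h i
    by_cases hij : i = j
    · subst hij
      simp [ev] at this
      apply h2
      have h3 : (1 : R) + 1 = 0 := by
        nth_rewrite 1 [this]; ring
      rw [← h3]; norm_num
    · simp [ev, hij] at this
      exact h1 this
  have ep : ∀ i, (y = x + ev R i ↔ y - x = ev R i) := fun i => by
    rw [sub_eq_iff_eq_add']
  have em : ∀ i, (y = x - ev R i ↔ y - x = - ev R i) := fun i => by
    rw [sub_eq_iff_eq_add', sub_eq_add_neg]
  have em' : ∀ i : Fin 4, (x - y = Pi.single i 1 ↔ y - x = - ev R i) := fun i => by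
    rw [← neg_sub x y, neg_inj]; rfl
  have ep' : ∀ i : Fin 4, (y - x = Pi.single i 1 ↔ y - x = ev R i) := fun i => Iff.rfl
  simp only [ep, em, em', ep']
  generalize y - x = z
  split_ifs with h
  · obtain ⟨i, hi⟩ := h
    rw [Finset.sum_eq_single i]
    · rcases hi with rfl | rfl
      · rw [if_pos rfl, if_neg (hne2 i i)]; norm_num
      · rw [if_pos rfl, if_neg (fun h => hne2 i i h.symm)]; norm_num
    · intro j _ hj
      rcases hi with rfl | rfl
      · rw [if_neg (hne i j hj.symm), if_neg (hne2 i j)]; norm_num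
      · rw [if_neg (fun h => hne2 j i h.symm), if_neg (fun h => hne i j hj.symm (neg_inj.1 h))]
        norm_num
    · simp
  · push Not at h
    symm
    refine Finset.sum_eq_zero fun i _ => ?_
    rw [if_neg (h i).1, if_neg (h i).2]; norm_num

end Walk

section Torus

lemma no_self {R : Type*} [CommRing R] (h1 : (1 : R) ≠ 0) (x : Fin 4 → R) :
    ¬ ∃ i : Fin 4, x - x = Pi.single i (1 : R) ∨ x - x = Pi.single i 1 := by
  rintro ⟨i, h | h⟩ <;>
  · have := congrFun h i
    simp at this
    exact h1 this.symm

lemma pk_one_form {R : Type*} [CommRing R] (h1 : (1 : R) ≠ 0) (h2 : (2 : R) ≠ 0) (x y : Fin 4 → R) :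
    pk R 1 (x - y) = dl R (x - y) / 2 +
      (if ∃ i : Fin 4, y - x = Pi.single i 1 ∨ x - y = Pi.single i 1 then (1 : ℝ) else 0) / 16 := by
  rw [nbr_ind h1 h2, pk_succ, pk_zero]
  unfold Pop dl
  congr 2
  refine Finset.sum_congr rfl fun i _ => ?_
  have e1 : x - y + ev R i = 0 ↔ y = x + ev R i := by
    constructor
    · intro h
      have : y = x + ev R i - (x - y + ev R i) := by abel
      rw [h] at this; simpa using this
    · rintro rfl; abel
  have e2 : x - y - ev R i = 0 ↔ y = x - ev R i := by
    constructor
    · intro h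
      have : y = x - ev R i - (x - y - ev R i) := by abel
      rw [h] at this; simpa using this
    · rintro rfl; abel
  simp only [e1, e2]

lemma dl_of_ne {R : Type*} [CommRing R] {x y : Fin 4 → R} (h : x ≠ y) : dl R (x - y) = 0 :=
  if_neg (sub_ne_zero.2 h)

lemma dl_zero {R : Type*} [CommRing R] : dl R 0 = 1 := if_pos rfl

variable {n : ℕ} [NeZero n]

lemma zmod_one_ne (hn : 3 ≤ n) : (1 : ZMod n) ≠ 0 := by
  intro h
  have : ((1 : ℕ) : ZMod n) = 0 := by exact_mod_cast h
  rw [ZMod.natCast_eq_zero_iff] at this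
  have := Nat.le_of_dvd (by norm_num) this
  omega

lemma zmod_two_ne (hn : 3 ≤ n) : (2 : ZMod n) ≠ 0 := by
  intro h
  have : ((2 : ℕ) : ZMod n) = 0 := by exact_mod_cast h
  rw [ZMod.natCast_eq_zero_iff] at this
  have := Nat.le_of_dvd (by norm_num) this
  omega

lemma torus_adj (hn : 3 ≤ n) (x y : Fin 4 → ZMod n) :
    (torus 4 n).Adj x y ↔ ∃ i : Fin 4, y - x = Pi.single i 1 ∨ x - y = Pi.single i 1 := by
  refine ⟨fun h => h.2, fun h => ⟨?_, h⟩⟩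
  rintro rfl
  obtain ⟨i, h | h⟩ := h <;>
  · have := congrFun h i
    simp at this
    exact zmod_one_ne hn this.symm

lemma dl_sum_mul (f : (Fin 4 → ZMod n) → ℝ) (x : Fin 4 → ZMod n) :
    ∑ y, dl (ZMod n) (x - y) * f y = f x := by
  rw [Finset.sum_eq_single x]
  · rw [sub_self, dl_zero, one_mul]
  · intro y _ hy
    rw [dl_of_ne hy.symm, zero_mul]
  · simp

lemma pk_one_sum_mul (f : (Fin 4 → ZMod n) → ℝ) (x : Fin 4 → ZMod n) :
    ∑ y, pk (ZMod n) 1 (x - y) * f y = Pop f x := by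
  have e : ∀ y, pk (ZMod n) 1 (x - y) * f y = Pop (fun u => f y * dl (ZMod n) (u - y)) x := by
    intro y
    rw [Pop_smul, Pop_shift, mul_comm]; rfl
  rw [Finset.sum_congr rfl fun y _ => e y, ← congrFun (Pop_sum _ _) x]
  congr 1
  funext u
  rw [← dl_sum_mul f u]
  exact Finset.sum_congr rfl fun y _ => mul_comm _ _

lemma torus_deg (hn : 3 ≤ n) (x : Fin 4 → ZMod n) : deg (torus 4 n) x = 8 := by
  have : ((deg (torus 4 n) x : ℕ) : ℝ) = 8 := by
    unfold deg
    rw [Finset.card_filter, Nat.cast_sum]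
    have e : ∀ y : Fin 4 → ZMod n, (((if (torus 4 n).Adj x y then 1 else 0 : ℕ)) : ℝ)
        = pk (ZMod n) 1 (x - y) * 16 - dl (ZMod n) (x - y) * 8 := by
      intro y
      rw [pk_one_form (zmod_one_ne hn) (zmod_two_ne hn)]
      by_cases h : ∃ i : Fin 4, y - x = Pi.single i 1 ∨ x - y = Pi.single i 1
      · rw [if_pos h, if_pos ((torus_adj hn x y).2 h)]; push_cast; ring
      · rw [if_neg h, if_neg (fun h' => h ((torus_adj hn x y).1 h'))]; push_cast; ring
    rw [Finset.sum_congr rfl fun y _ => e y, Finset.sum_sub_distrib,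
      pk_one_sum_mul (fun _ => 16), dl_sum_mul (fun _ => 8), Pop_const]
    norm_num
  exact_mod_cast this

lemma torus_K (hn : 3 ≤ n) (x y : Fin 4 → ZMod n) : K (torus 4 n) x y = pk (ZMod n) 1 (x - y) := by
  rw [pk_one_form (zmod_one_ne hn) (zmod_two_ne hn)]
  unfold K
  rw [torus_deg hn]
  by_cases hxy : x = y
  · subst hxy
    rw [if_neg (no_self (zmod_one_ne hn) x), if_pos rfl, sub_self, dl_zero]; norm_num
  · rw [if_neg hxy, dl_of_ne hxy]
    by_cases h : ∃ i : Fin 4, y - x = Pi.single i 1 ∨ x - y = Pi.single i 1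
    · rw [if_pos h, if_pos ((torus_adj hn x y).2 h)]; norm_num
    · rw [if_neg h, if_neg (fun h' => h ((torus_adj hn x y).1 h'))]; norm_num

lemma torus_op1 (hn : 3 ≤ n) (f : (Fin 4 → ZMod n) → ℝ) : op1 (torus 4 n) f = Pop f := by
  funext x
  unfold op1
  simp only [torus_K hn]
  exact pk_one_sum_mul f x

lemma torus_row (hn : 3 ≤ n) (x : Fin 4 → ZMod n) : ∑ y, K (torus 4 n) x y = 1 := by
  have h := congrFun (torus_op1 hn (fun _ => 1)) x
  rw [Pop_const] at h
  simpa [op1] using h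

lemma torus_Ksymm (hn : 3 ≤ n) (x y : Fin 4 → ZMod n) :
    K (torus 4 n) x y = K (torus 4 n) y x := by
  rw [torus_K hn, torus_K hn, ← pk_neg, neg_sub]

lemma torus_col (hn : 3 ≤ n) (x : Fin 4 → ZMod n) : ∑ y, K (torus 4 n) y x = 1 := by
  simp only [fun y => torus_Ksymm hn y x]
  exact torus_row hn x

end Torus

section Lattice

lemma KZ_eq (x y : Fin 4 → ℤ) : KZ 4 x y = pk ℤ 1 (x - y) := by
  rw [pk_one_form one_ne_zero two_ne_zero]
  unfold KZ
  by_cases hxy : x = y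
  · subst hxy
    rw [if_pos rfl, if_neg (no_self one_ne_zero x), sub_self, dl_zero]; norm_num
  · rw [if_neg hxy, dl_of_ne hxy]
    by_cases h : ∃ i : Fin 4, y - x = Pi.single i 1 ∨ x - y = Pi.single i 1
    · rw [if_pos h, if_pos h]; norm_num
    · rw [if_neg h, if_neg h]; norm_num

lemma KZpow_eq (t : ℕ) (x : Fin 4 → ℤ) : KZpow 4 t 0 x = pk ℤ t x := by
  induction t generalizing x with
  | zero =>
    unfold KZpow pk dl
    simp only [Function.iterate_zero, id_eq]
    by_cases h : x = 0
    · rw [if_pos h, if_pos h.symm]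
    · rw [if_neg h, if_neg (Ne.symm h)]
  | succ t ih =>
    have e : ∀ z, KZpow 4 t 0 z * KZ 4 z x = pk ℤ t z * Pop (fun u => dl ℤ (u - x)) z := by
      intro z
      rw [ih, KZ_eq, Pop_shift]; rfl
    have e' : KZpow 4 (t + 1) 0 x = ∑' z, KZpow 4 t 0 z * KZ 4 z x := rfl
    rw [e', tsum_congr e, pairing, ← Function.iterate_succ_apply, Pop_iter_shift]
    show pk ℤ (t + 1) (0 - x) = _
    rw [zero_sub, pk_neg]

lemma greenZ_eq (x : Fin 4 → ℤ) : greenZ 4 x = ∑' t, pk ℤ t x := by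
  unfold greenZ
  exact tsum_congr fun t => KZpow_eq t x

end Lattice

section TorusFourier

variable {n : ℕ} [NeZero n]

def chi (ξ x : Fin 4 → ZMod n) : ℂ := ∏ i, (ZMod.stdAddChar (ξ i * x i) : ℂ)

def phi (ξ : Fin 4 → ZMod n) : ℝ := 1 / 2 + (∑ i, ((ZMod.stdAddChar (ξ i) : ℂ)).re) / 8

lemma chi_add (ξ x : Fin 4 → ZMod n) (i : Fin 4) :
    chi ξ (x + ev (ZMod n) i) = chi ξ x * ZMod.stdAddChar (ξ i) := by
  unfold chi
  have : (ZMod.stdAddChar (ξ i) : ℂ) = ∏ j, (ZMod.stdAddChar (ξ j * ev (ZMod n) i j) : ℂ) := by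
    rw [Finset.prod_eq_single i]
    · simp [ev]
    · intro j _ hj; simp [ev, hj]
    · simp
  rw [this, ← Finset.prod_mul_distrib]
  refine Finset.prod_congr rfl fun j _ => ?_
  rw [Pi.add_apply, mul_add, AddChar.map_add_eq_mul]

lemma chi_sub (ξ x : Fin 4 → ZMod n) (i : Fin 4) :
    chi ξ (x - ev (ZMod n) i) = chi ξ x * (starRingEnd ℂ) (ZMod.stdAddChar (ξ i)) := by
  have h := chi_add ξ (x - ev (ZMod n) i) i
  rw [sub_add_cancel] at h
  rw [h, mul_assoc, Complex.mul_conj, Complex.normSq_eq_norm_sq, AddChar.norm_apply]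
  simp

lemma chi_norm (ξ x : Fin 4 → ZMod n) : ‖chi ξ x‖ = 1 := by
  unfold chi
  rw [norm_prod]
  simp [AddChar.norm_apply]

lemma Pop_chi (ξ x : Fin 4 → ZMod n) :
    Pop (fun x => (chi ξ x).re) x = phi ξ * (chi ξ x).re := by
  unfold Pop phi
  have : ∀ i, (chi ξ (x + ev (ZMod n) i)).re + (chi ξ (x - ev (ZMod n) i)).re =
      (ZMod.stdAddChar (ξ i) : ℂ).re * (2 * (chi ξ x).re) := by
    intro i
    rw [chi_add, chi_sub]
    simp only [Complex.mul_re, Complex.conj_re, Complex.conj_im]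
    ring
  simp only [this]
  rw [← Finset.sum_mul]
  ring

lemma chi_orth (x : Fin 4 → ZMod n) : ∑ ξ, chi ξ x = ((n : ℝ) ^ 4 * dl (ZMod n) x : ℝ) := by
  have h1 : ∑ ξ, chi ξ x = ∏ i, ∑ a : ZMod n, (ZMod.stdAddChar (a * x i) : ℂ) := by
    unfold chi
    rw [Finset.prod_univ_sum]
    simp
  rw [h1]
  simp only [AddChar.sum_mulShift _ (ZMod.isPrimitive_stdAddChar n)]
  unfold dl
  split_ifs with h
  · subst h
    simp
  · obtain ⟨i, hi⟩ := Function.ne_iff.1 h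
    rw [Finset.prod_eq_zero (Finset.mem_univ i)]
    · simp
    · rw [if_neg (show ¬ x i = 0 from hi)]; simp

lemma pk_fourier (t : ℕ) (x : Fin 4 → ZMod n) :
    pk (ZMod n) t x = (∑ ξ, phi ξ ^ t * (chi ξ x).re) / (n : ℝ) ^ 4 := by
  have hn : (n : ℝ) ^ 4 ≠ 0 := pow_ne_zero _ (Nat.cast_ne_zero.2 (NeZero.ne n))
  induction t generalizing x with
  | zero =>
    rw [pk_zero, eq_div_iff hn]
    have := congrArg Complex.re (chi_orth x)
    rw [Complex.re_sum, Complex.ofReal_re] at this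
    simp only [pow_zero, one_mul]
    rw [this, mul_comm]
  | succ t ih =>
    rw [pk_succ, show pk (ZMod n) t = fun x => ((n : ℝ) ^ 4)⁻¹ * ∑ ξ, phi ξ ^ t * (chi ξ x).re from
      funext fun x => by rw [ih, div_eq_inv_mul], Pop_smul, Pop_sum, div_eq_inv_mul]
    dsimp only
    congr 1
    refine Finset.sum_congr rfl fun ξ _ => ?_
    rw [Pop_smul]
    dsimp only
    rw [Pop_chi]; ring

lemma psi_re_abs (a : ZMod n) : |(ZMod.stdAddChar a : ℂ).re| ≤ 1 := by
  have h := Complex.abs_re_le_norm (ZMod.stdAddChar a : ℂ)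
  rwa [AddChar.norm_apply] at h

lemma phi_nonneg (ξ : Fin 4 → ZMod n) : 0 ≤ phi ξ := by
  unfold phi
  have : ∑ i : Fin 4, (-1 : ℝ) ≤ ∑ i, (ZMod.stdAddChar (ξ i) : ℂ).re :=
    Finset.sum_le_sum fun i _ => (abs_le.1 (psi_re_abs (ξ i))).1
  simp at this
  linarith

lemma phi_zero : phi (0 : Fin 4 → ZMod n) = 1 := by
  simp [phi]; norm_num

lemma chi_zero_left (x : Fin 4 → ZMod n) : chi 0 x = 1 := by simp [chi]
lemma chi_zero_right (x : Fin 4 → ZMod n) : chi x 0 = 1 := by simp [chi]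

def qk (n : ℕ) (t : ℕ) (x : Fin 4 → ZMod n) : ℝ := pk (ZMod n) t x - ((n : ℝ) ^ 4)⁻¹

lemma qk_fourier (t : ℕ) (x : Fin 4 → ZMod n) :
    qk n t x = (∑ ξ ∈ Finset.univ.erase 0, phi ξ ^ t * (chi ξ x).re) / (n : ℝ) ^ 4 := by
  rw [qk, pk_fourier, ← Finset.add_sum_erase _ _ (Finset.mem_univ (0 : Fin 4 → ZMod n)), phi_zero,
    chi_zero_left]
  simp only [one_pow, Complex.one_re, mul_one]
  ring

lemma qk_zero (t : ℕ) :
    qk n t 0 = (∑ ξ ∈ Finset.univ.erase (0 : Fin 4 → ZMod n), phi ξ ^ t) / (n : ℝ) ^ 4 := by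
  rw [qk_fourier]
  simp [chi_zero_right]

lemma qk_abs (t : ℕ) (x : Fin 4 → ZMod n) : |qk n t x| ≤ qk n t 0 := by
  rw [qk_fourier, qk_zero, abs_div, abs_of_nonneg (by positivity : (0 : ℝ) ≤ (n : ℝ) ^ 4)]
  gcongr
  refine (Finset.abs_sum_le_sum_abs _ _).trans (Finset.sum_le_sum fun ξ _ => ?_)
  rw [abs_mul, abs_of_nonneg (pow_nonneg (phi_nonneg ξ) t)]
  have h := Complex.abs_re_le_norm (chi ξ x)
  rw [chi_norm] at h
  exact mul_le_of_le_one_right (pow_nonneg (phi_nonneg ξ) t) h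

lemma qk_zero_nonneg (t : ℕ) : 0 ≤ qk n t 0 := (abs_nonneg _).trans (qk_abs t 0)

lemma pk_le_zero (t : ℕ) (x : Fin 4 → ZMod n) : pk (ZMod n) t x ≤ pk (ZMod n) t 0 := by
  have := (le_abs_self _).trans (qk_abs t x)
  unfold qk at this
  linarith

lemma pk_le_one {R : Type*} [CommRing R] (t : ℕ) (x : Fin 4 → R) : pk R t x ≤ 1 := by
  have h := Pop_iter_mono (f := dl R) (g := fun _ : Fin 4 → R => (1 : ℝ))
    (fun x => by unfold dl; split_ifs <;> norm_num) t x
  rw [Pop_iter_const] at h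
  exact h

lemma psi_re (a : ZMod n) : (ZMod.stdAddChar a : ℂ).re = Real.cos (2 * Real.pi * a.val / n) := by
  have h := ZMod.stdAddChar_coe (N := n) (a.val : ℤ)
  rw [show (((a.val : ℤ)) : ZMod n) = a by simp] at h
  rw [h, show (2 * (Real.pi : ℂ) * Complex.I * ((a.val : ℤ) : ℂ) / (n : ℂ)) =
    ((2 * Real.pi * a.val / n : ℝ) : ℂ) * Complex.I by push_cast; ring, Complex.exp_ofReal_mul_I_re]

/-- one dimensional bound -/
lemma psi_exp_le (t : ℕ) (a : ZMod n) :
    Real.exp (-((t : ℝ) / 8 * (1 - (ZMod.stdAddChar a : ℂ).re))) ≤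
      Real.exp (-(t / (n : ℝ) ^ 2 * (a.val : ℝ) ^ 2)) +
      Real.exp (-(t / (n : ℝ) ^ 2 * ((n : ℝ) - a.val) ^ 2)) := by
  have hn : (0 : ℝ) < n := Nat.cast_pos.2 (NeZero.pos n)
  have key : ∀ v : ℝ, 0 ≤ v → v ≤ n / 2 → Real.cos (2 * Real.pi * v / n) ≤ 1 - 8 * v ^ 2 / n ^ 2 := by
    intro v h0 h1
    have hpi := Real.pi_pos
    have hb : |2 * Real.pi * v / n| ≤ Real.pi := by
      rw [abs_of_nonneg (by positivity), div_le_iff₀ hn]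
      nlinarith
    refine (Real.cos_le_one_sub_mul_cos_sq hb).trans (le_of_eq ?_)
    field_simp
    ring
  have hv : (a.val : ℝ) < n := by exact_mod_cast ZMod.val_lt a
  rcases le_total (a.val : ℝ) (n / 2) with h | h
  · have k := key a.val (by positivity) h
    rw [← psi_re] at k
    refine le_add_of_le_of_nonneg (Real.exp_le_exp.2 ?_) (Real.exp_pos _).le
    have : (t : ℝ) / 8 * (8 * (a.val : ℝ) ^ 2 / n ^ 2) ≤ t / 8 * (1 - (ZMod.stdAddChar a : ℂ).re) := by
      gcongr; linarith
    have e : (t : ℝ) / 8 * (8 * (a.val : ℝ) ^ 2 / n ^ 2) = t / (n : ℝ) ^ 2 * (a.val : ℝ) ^ 2 := by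
      field_simp
    linarith
  · have k := key (n - a.val) (by linarith) (by linarith)
    rw [show 2 * Real.pi * ((n : ℝ) - a.val) / n = 2 * Real.pi - 2 * Real.pi * a.val / n by
      field_simp, Real.cos_two_pi_sub, ← psi_re] at k
    refine le_add_of_nonneg_of_le (Real.exp_pos _).le (Real.exp_le_exp.2 ?_)
    have : (t : ℝ) / 8 * (8 * ((n : ℝ) - a.val) ^ 2 / n ^ 2) ≤ t / 8 * (1 - (ZMod.stdAddChar a : ℂ).re) := by
      gcongr; linarith
    have e : (t : ℝ) / 8 * (8 * ((n : ℝ) - a.val) ^ 2 / n ^ 2) = t / (n : ℝ) ^ 2 * ((n : ℝ) - a.val) ^ 2 := by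
      field_simp
    linarith

lemma zmod_sum (f : ℕ → ℝ) : ∑ a : ZMod n, f a.val = ∑ v ∈ Finset.range n, f v := by
  obtain ⟨k, rfl⟩ : ∃ k, n = k + 1 := ⟨n - 1, (Nat.succ_pred_eq_of_pos (NeZero.pos n)).symm⟩
  exact Fin.sum_univ_eq_sum_range (fun v => f v) (k + 1)

lemma sq_geo {s : ℝ} (hs : 0 < s) (v : ℕ) :
    Real.exp (-(s * (v : ℝ) ^ 2)) ≤ 2 * Real.exp (-Real.sqrt s) ^ v := by
  have h2 : Real.exp (1 / 4) ≤ 2 := by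
    have : Real.exp (1 / 4) ≤ Real.exp (Real.log 2) := by
      apply Real.exp_le_exp.2
      have := Real.log_two_gt_d9
      linarith
    rwa [Real.exp_log (by norm_num)] at this
  have hq := Real.sq_sqrt hs.le
  calc Real.exp (-(s * (v : ℝ) ^ 2)) ≤ Real.exp (1 / 4 + v * (-Real.sqrt s)) := by
        apply Real.exp_le_exp.2
        rw [← hq]
        rw [Real.sqrt_sq (Real.sqrt_nonneg s)]
        nlinarith [sq_nonneg (Real.sqrt s * v - 1 / 2)]
    _ = Real.exp (1 / 4) * Real.exp (-Real.sqrt s) ^ v := by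
        rw [Real.exp_add, Real.exp_nat_mul]
    _ ≤ _ := by gcongr

lemma geo_sum {s : ℝ} (hs : 0 < s) (m : ℕ) :
    ∑ v ∈ Finset.range m, Real.exp (-Real.sqrt s) ^ (v + 1) ≤ 1 / (Real.exp (Real.sqrt s) - 1) := by
  have h1 : 1 < Real.exp (Real.sqrt s) := Real.one_lt_exp_iff.2 (Real.sqrt_pos.2 hs)
  rw [Real.exp_neg]
  set r := Real.exp (Real.sqrt s)
  have hr : r⁻¹ < 1 := inv_lt_one_of_one_lt₀ h1
  have hr0 : 0 < r⁻¹ := by positivity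
  have := (summable_geometric_of_lt_one hr0.le hr).sum_le_tsum (Finset.range m)
    (fun i _ => by positivity)
  rw [tsum_geometric_of_lt_one hr0.le hr] at this
  simp only [pow_succ, ← Finset.sum_mul]
  calc _ ≤ (1 - r⁻¹)⁻¹ * r⁻¹ := by gcongr
    _ = _ := by
      have : r ≠ 0 := by positivity
      have : r - 1 ≠ 0 := by linarith
      field_simp

lemma psi_sum_le {t : ℕ} (ht : 0 < t) :
    ∑ a : ZMod n, Real.exp (-((t : ℝ) / 8 * (1 - (ZMod.stdAddChar a : ℂ).re))) ≤
      1 + 4 / (Real.exp (Real.sqrt (t / (n : ℝ) ^ 2)) - 1) := by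
  have hn : (0 : ℝ) < n := Nat.cast_pos.2 (NeZero.pos n)
  set s : ℝ := t / (n : ℝ) ^ 2 with hsdef
  have hs : 0 < s := by positivity
  have b := fun m => geo_sum hs m
  set r := Real.exp (-Real.sqrt s)
  have h1 : ∀ a : ZMod n, Real.exp (-((t : ℝ) / 8 * (1 - (ZMod.stdAddChar a : ℂ).re))) ≤
      (fun v : ℕ => if v = 0 then (1 : ℝ) else 2 * r ^ v + 2 * r ^ (n - v)) a.val := by
    intro a
    dsimp only
    split_ifs with h
    · rw [ZMod.val_eq_zero] at h
      simp [h]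
    · refine (psi_exp_le t a).trans ?_
      have e : (n : ℝ) - a.val = ((n - a.val : ℕ) : ℝ) := by
        rw [Nat.cast_sub (ZMod.val_lt a).le]
      rw [e]
      exact add_le_add (sq_geo hs _) (sq_geo hs _)
  refine (Finset.sum_le_sum fun a _ => h1 a).trans ?_
  rw [zmod_sum (fun v : ℕ => if v = 0 then (1 : ℝ) else 2 * r ^ v + 2 * r ^ (n - v))]
  obtain ⟨k, hk⟩ : ∃ k, n = k + 1 := ⟨n - 1, (Nat.succ_pred_eq_of_pos (NeZero.pos n)).symm⟩
  rw [hk, Finset.sum_range_succ']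
  simp only [if_true, Nat.succ_ne_zero, if_false, Nat.add_eq_zero_iff, one_ne_zero, and_false]
  have e2 : ∑ v ∈ Finset.range k, r ^ (k + 1 - (v + 1)) = ∑ v ∈ Finset.range k, r ^ (v + 1) := by
    rw [← Finset.sum_range_reflect]
    refine Finset.sum_congr rfl fun v hv => ?_
    have := Finset.mem_range.1 hv
    congr 1
    omega
  rw [Finset.sum_add_distrib, ← Finset.mul_sum, ← Finset.mul_sum, e2]
  have := b k
  rw [show 4 / (Real.exp (Real.sqrt s) - 1) = 4 * (1 / (Real.exp (Real.sqrt s) - 1)) by ring]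
  linarith

lemma phi_pow_le (t : ℕ) (ξ : Fin 4 → ZMod n) :
    phi ξ ^ t ≤ ∏ i, Real.exp (-((t : ℝ) / 8 * (1 - (ZMod.stdAddChar (ξ i) : ℂ).re))) := by
  rw [← Real.exp_sum]
  have h : phi ξ ≤ Real.exp (phi ξ - 1) := by
    have := Real.add_one_le_exp (phi ξ - 1); linarith
  refine (pow_le_pow_left₀ (phi_nonneg ξ) h t).trans (le_of_eq ?_)
  rw [← Real.exp_nat_mul]
  congr 1
  rw [Finset.sum_neg_distrib, ← Finset.mul_sum, Finset.sum_sub_distrib]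
  unfold phi
  simp
  ring

lemma qk_zero_le {t : ℕ} (ht : 0 < t) : qk n t 0 * (n : ℝ) ^ 4 ≤
    (1 + 4 / (Real.exp (Real.sqrt (t / (n : ℝ) ^ 2)) - 1)) ^ 4 - 1 := by
  have hn : (n : ℝ) ^ 4 ≠ 0 := pow_ne_zero _ (Nat.cast_ne_zero.2 (NeZero.ne n))
  rw [qk_zero, div_mul_cancel₀ _ hn]
  have h1 : ∑ ξ : Fin 4 → ZMod n, phi ξ ^ t = phi 0 ^ t + ∑ ξ ∈ Finset.univ.erase (0 : Fin 4 → ZMod n), phi ξ ^ t :=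
    (Finset.add_sum_erase _ _ (Finset.mem_univ _)).symm
  rw [phi_zero, one_pow] at h1
  have h2 : ∑ ξ : Fin 4 → ZMod n, phi ξ ^ t ≤ (∑ a : ZMod n, Real.exp (-((t : ℝ) / 8 * (1 - (ZMod.stdAddChar a : ℂ).re)))) ^ 4 := by
    have : ∑ ξ : Fin 4 → ZMod n, ∏ i, Real.exp (-((t : ℝ) / 8 * (1 - (ZMod.stdAddChar (ξ i) : ℂ).re))) =
      ∏ _i : Fin 4, ∑ a : ZMod n, Real.exp (-((t : ℝ) / 8 * (1 - (ZMod.stdAddChar a : ℂ).re))) := by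
      rw [Finset.prod_univ_sum]
      simp
    rw [Finset.prod_const] at this
    simp only [Finset.card_univ, Fintype.card_fin] at this
    rw [← this]
    exact Finset.sum_le_sum fun ξ _ => phi_pow_le t ξ
  have h3 := pow_le_pow_left₀ (Finset.sum_nonneg fun a _ => (Real.exp_pos _).le) (psi_sum_le (n := n) ht) 4
  linarith

end TorusFourier

section TorusBounds

def CE : ℝ := 8 * (4 * 2881 ^ 3 * 2880)

lemma CE_pos : 0 < CE := by unfold CE; norm_num
lemma CE_one : 1 ≤ CE := by unfold CE; norm_num

variable {n : ℕ} [NeZero n]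

lemma qk_zero_le_one (t : ℕ) : qk n t 0 ≤ 1 := by
  have h := pk_le_one (R := ZMod n) t 0
  have : (0 : ℝ) ≤ ((n : ℝ) ^ 4)⁻¹ := by positivity
  unfold qk; linarith

lemma qk_aux {t : ℕ} (ht : 0 < t) : (t : ℝ) ^ 2 * qk n t 0 ≤ 4 * 2881 ^ 3 * 2880 ∧
    (t : ℝ) ^ 3 * qk n t 0 ≤ 4 * 2881 ^ 3 * 2880 * (n : ℝ) ^ 2 := by
  have hn : (0 : ℝ) < n := Nat.cast_pos.2 (NeZero.pos n)
  have ht' : (0 : ℝ) < t := Nat.cast_pos.2 ht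
  have h := qk_zero_le (n := n) ht
  have hq0 := qk_zero_nonneg (n := n) t
  obtain ⟨s, hsdef⟩ : ∃ s : ℝ, s = t / (n : ℝ) ^ 2 := ⟨_, rfl⟩
  rw [← hsdef] at h
  have hs : 0 < s := by rw [hsdef]; positivity
  have hts : (t : ℝ) = s * (n : ℝ) ^ 2 := by rw [hsdef]; field_simp
  have hy : 0 < Real.sqrt s := Real.sqrt_pos.2 hs
  have hq := Real.sq_sqrt hs.le
  set y := Real.sqrt s
  have hE1 : y ≤ Real.exp y - 1 := by have := Real.add_one_le_exp y; linarith
  have hE2 : s ^ 3 / 720 ≤ Real.exp y - 1 := by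
    have := Real.sum_le_exp_of_nonneg hy.le 7
    simp [Finset.sum_range_succ, Nat.factorial] at this
    rw [← hq]
    have h6 : (y ^ 2) ^ 3 = y ^ 6 := by ring
    rw [h6]
    have : 0 ≤ y ^ 2 := by positivity
    have : 0 ≤ y ^ 3 := by positivity
    have : 0 ≤ y ^ 4 := by positivity
    have : 0 ≤ y ^ 5 := by positivity
    linarith
  have hE : 0 < Real.exp y - 1 := by linarith
  set Q := qk n t 0
  rcases le_total s 1 with h1 | h1
  · have hy1 : y ≤ 1 := by
      rw [← Real.sqrt_one]; exact Real.sqrt_le_sqrt h1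
    have b1 : 4 / (Real.exp y - 1) ≤ 4 / y := by gcongr
    have b2 : 1 + 4 / (Real.exp y - 1) ≤ 5 / y := by
      have : 1 ≤ 1 / y := by rw [le_div_iff₀ hy]; linarith
      have : 5 / y = 1 / y + 4 / y := by ring
      linarith
    have b3 : (1 + 4 / (Real.exp y - 1)) ^ 4 ≤ (5 / y) ^ 4 := by gcongr
    have e : (5 / y) ^ 4 = 625 / s ^ 2 := by rw [← hq]; field_simp; norm_num
    rw [e] at b3
    have b4 : Q * (n : ℝ) ^ 4 * s ^ 2 ≤ 625 := by
      have : Q * (n : ℝ) ^ 4 ≤ 625 / s ^ 2 := by linarith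
      rwa [le_div_iff₀ (by positivity)] at this
    have b5 : (t : ℝ) ^ 2 * Q ≤ 625 := by
      rw [hts]; calc _ = Q * (n : ℝ) ^ 4 * s ^ 2 := by ring
        _ ≤ _ := b4
    refine ⟨b5.trans (by norm_num), ?_⟩
    have : (t : ℝ) ≤ (n : ℝ) ^ 2 := by rw [hts]; nlinarith [sq_nonneg (n : ℝ)]
    calc (t : ℝ) ^ 3 * Q = ((t : ℝ) ^ 2 * Q) * t := by ring
      _ ≤ 625 * (n : ℝ) ^ 2 := by gcongr
      _ ≤ _ := by gcongr; norm_num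
  · have b1 : 4 / (Real.exp y - 1) ≤ 4 / (s ^ 3 / 720) := by gcongr
    have e : 4 / (s ^ 3 / 720) = 2880 / s ^ 3 := by field_simp; norm_num
    rw [e] at b1
    set B := 4 / (Real.exp y - 1)
    have hB0 : 0 < B := by positivity
    have hs3 : 1 ≤ s ^ 3 := one_le_pow₀ h1
    have hB : B ≤ 2880 := b1.trans (by rw [div_le_iff₀ (by positivity)]; linarith)
    have b2 : (1 + B) ^ 4 - 1 ≤ 4 * B * (1 + B) ^ 3 := by
      have : 0 ≤ 3 * B ^ 4 + 8 * B ^ 3 + 6 * B ^ 2 := by positivity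
      nlinarith
    have b3 : 4 * B * (1 + B) ^ 3 ≤ 4 * (2880 / s ^ 3) * 2881 ^ 3 := by
      gcongr
      linarith
    have b4 : Q * (n : ℝ) ^ 4 * s ^ 3 ≤ 4 * 2881 ^ 3 * 2880 := by
      have : Q * (n : ℝ) ^ 4 ≤ (4 * 2881 ^ 3 * 2880) / s ^ 3 := by
        refine (h.trans (b2.trans b3)).trans (le_of_eq (by ring))
      rwa [le_div_iff₀ (by positivity)] at this
    have b5 : (t : ℝ) ^ 3 * Q ≤ 4 * 2881 ^ 3 * 2880 * (n : ℝ) ^ 2 := by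
      rw [hts]; calc _ = Q * (n : ℝ) ^ 4 * s ^ 3 * (n : ℝ) ^ 2 := by ring
        _ ≤ _ := by gcongr
    refine ⟨?_, b5⟩
    have : (n : ℝ) ^ 2 ≤ t := by rw [hts]; nlinarith [sq_nonneg (n : ℝ)]
    have : (t : ℝ) ^ 2 * Q * t ≤ 4 * 2881 ^ 3 * 2880 * t :=
      calc _ = (t : ℝ) ^ 3 * Q := by ring
        _ ≤ _ := b5.trans (by gcongr)
    exact le_of_mul_le_mul_right this ht'

lemma qk_E2 (t : ℕ) : qk n t 0 ≤ CE / ((t : ℝ) + 1) ^ 2 := by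
  rcases Nat.eq_zero_or_pos t with rfl | ht
  · have := qk_zero_le_one (n := n) 0
    have := CE_one
    norm_num; linarith
  · have h := (qk_aux (n := n) ht).1
    have h1 : (1 : ℝ) ≤ t := by exact_mod_cast ht
    have h0 := qk_zero_nonneg (n := n) t
    rw [le_div_iff₀ (by positivity)]
    have : ((t : ℝ) + 1) ^ 2 ≤ 8 * (t : ℝ) ^ 2 := by nlinarith
    calc qk n t 0 * ((t : ℝ) + 1) ^ 2 ≤ qk n t 0 * (8 * (t : ℝ) ^ 2) := by gcongr
      _ = 8 * ((t : ℝ) ^ 2 * qk n t 0) := by ring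
      _ ≤ CE := by unfold CE; gcongr

lemma qk_E3 (t : ℕ) : qk n t 0 ≤ CE * (n : ℝ) ^ 2 / ((t : ℝ) + 1) ^ 3 := by
  have hn : (1 : ℝ) ≤ n := by exact_mod_cast NeZero.pos n
  rcases Nat.eq_zero_or_pos t with rfl | ht
  · have := qk_zero_le_one (n := n) 0
    have := CE_one
    norm_num; nlinarith
  · have h := (qk_aux (n := n) ht).2
    have h1 : (1 : ℝ) ≤ t := by exact_mod_cast ht
    have h0 := qk_zero_nonneg (n := n) t
    rw [le_div_iff₀ (by positivity)]
    have : ((t : ℝ) + 1) ^ 3 ≤ (2 * (t : ℝ)) ^ 3 := by gcongr; linarith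
    calc qk n t 0 * ((t : ℝ) + 1) ^ 3 ≤ qk n t 0 * (2 * (t : ℝ)) ^ 3 := by gcongr
      _ = 8 * ((t : ℝ) ^ 3 * qk n t 0) := by ring
      _ ≤ 8 * (4 * 2881 ^ 3 * 2880 * (n : ℝ) ^ 2) := by gcongr
      _ = _ := by unfold CE; ring

end TorusBounds

section Tails

lemma inv_sq_summable : Summable fun t : ℕ => 1 / ((t : ℝ) + 1) ^ 2 := by
  have := (summable_nat_add_iff 1).2 (Real.summable_one_div_nat_pow.2 (le_refl 2))
  simpa using this

lemma inv_sq_tail {T : ℕ} (hT : 0 < T) : ∑' t : ℕ, 1 / (((t + T : ℕ) : ℝ) + 1) ^ 2 ≤ 1 / (T : ℝ) := by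
  refine Real.tsum_le_of_sum_range_le (fun t => by positivity) fun m => ?_
  have : ∑ t ∈ Finset.range m, 1 / (((t + T : ℕ) : ℝ) + 1) ^ 2 ≤ 1 / (T : ℝ) - 1 / ((m + T : ℕ) : ℝ) := by
    induction m with
    | zero => simp
    | succ m ih =>
      rw [Finset.sum_range_succ]
      have hp : (0 : ℝ) < ((m + T : ℕ) : ℝ) := by exact_mod_cast (by omega : 0 < m + T)
      have : 1 / (((m + T : ℕ) : ℝ) + 1) ^ 2 ≤ 1 / ((m + T : ℕ) : ℝ) - 1 / ((m + 1 + T : ℕ) : ℝ) := by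
        rw [show ((m + 1 + T : ℕ) : ℝ) = ((m + T : ℕ) : ℝ) + 1 by push_cast; ring]
        rw [div_sub_div _ _ (by positivity) (by positivity), div_le_div_iff₀ (by positivity) (by positivity)]
        nlinarith
      linarith
  have h2 : (0 : ℝ) ≤ 1 / ((m + T : ℕ) : ℝ) := by positivity
  linarith

lemma summ_of_tail {f : ℕ → ℝ} {c : ℝ} {T : ℕ} (h0 : ∀ t, 0 ≤ f t)
    (hf : ∀ t, T ≤ t → f t ≤ c / ((t : ℝ) + 1) ^ 2) : Summable f := by
  rw [← summable_nat_add_iff T]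
  refine Summable.of_nonneg_of_le (fun t => h0 _) (fun t => hf (t + T) (by omega)) ?_
  have := ((summable_nat_add_iff T).2 inv_sq_summable).mul_left c
  refine this.congr fun t => ?_
  ring

lemma tail_le {f : ℕ → ℝ} {c : ℝ} {T : ℕ} (hT : 0 < T) (h0 : ∀ t, 0 ≤ f t)
    (hf : ∀ t, T ≤ t → f t ≤ c / ((t : ℝ) + 1) ^ 2) : ∑' t, f (t + T) ≤ c / T := by
  have hs := summ_of_tail h0 hf
  have h1 : ∑' t, f (t + T) ≤ ∑' t : ℕ, c * (1 / (((t + T : ℕ) : ℝ) + 1) ^ 2) := by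
    refine Summable.tsum_le_tsum (fun t => (hf (t + T) (by omega)).trans (le_of_eq (by ring)))
      ((summable_nat_add_iff T).2 hs) (((summable_nat_add_iff T).2 inv_sq_summable).mul_left c)
  rw [tsum_mul_left] at h1
  have hc : 0 ≤ c := by
    have := (h0 T).trans (hf T le_rfl)
    by_contra hc
    push Not at hc
    exact absurd this (not_le.2 (div_neg_of_neg_of_pos hc (by positivity)))
  calc _ ≤ _ := h1
    _ ≤ c * (1 / T) := by gcongr; exact inv_sq_tail hT
    _ = _ := by ring

lemma tsum_le_tail {f : ℕ → ℝ} {c : ℝ} {T : ℕ} (hT : 0 < T) (h0 : ∀ t, 0 ≤ f t)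
    (hf : ∀ t, T ≤ t → f t ≤ c / ((t : ℝ) + 1) ^ 2) :
    ∑' t, f t ≤ ∑ t ∈ Finset.range T, f t + c / T := by
  rw [← (summ_of_tail h0 hf).sum_add_tsum_nat_add T]
  gcongr
  exact tail_le hT h0 hf

lemma sum_succ_le (T : ℕ) : ∑ t ∈ Finset.range T, ((t : ℝ) + 1) ≤ (T : ℝ) ^ 2 := by
  induction T with
  | zero => simp
  | succ T ih =>
    rw [Finset.sum_range_succ]
    push_cast
    nlinarith [(Nat.cast_nonneg T : (0 : ℝ) ≤ T)]

end Tails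

section TorusGreen

lemma Pop_tsum {R : Type*} [CommRing R] {f : ℕ → (Fin 4 → R) → ℝ}
    (hs : ∀ x, Summable fun t => f t x) (x : Fin 4 → R) :
    Pop (fun x => ∑' t, f t x) x = ∑' t, Pop (f t) x := by
  have h : HasSum (fun t => Pop (f t) x) (Pop (fun x => ∑' t, f t x) x) :=
    ((hs x).hasSum.div_const 2).add
      ((hasSum_sum fun i _ => ((hs _).hasSum.add (hs _).hasSum)).div_const 16)
  exact h.tsum_eq.symm

lemma abs_tsum_le' {f g : ℕ → ℝ} (hg : Summable g) (h : ∀ t, |f t| ≤ g t) :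
    |∑' t, f t| ≤ ∑' t, g t := by
  have := tsum_of_norm_bounded (f := f) hg.hasSum (fun t => by rw [Real.norm_eq_abs]; exact h t)
  rwa [Real.norm_eq_abs] at this

variable {n : ℕ} [NeZero n]

def gg (n : ℕ) (x : Fin 4 → ZMod n) : ℝ := ∑' t, qk n t x
def kk (n : ℕ) (x : Fin 4 → ZMod n) : ℝ := ∑' t : ℕ, ((t : ℝ) + 1) * qk n t x

lemma card_torus : (Fintype.card (Fin 4 → ZMod n) : ℝ) = (n : ℝ) ^ 4 := by
  simp [ZMod.card]

lemma e_summable : Summable fun t => qk n t 0 :=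
  summ_of_tail (T := 0) (fun t => qk_zero_nonneg t) (fun t _ => qk_E2 t)

lemma ke_le (t : ℕ) : ((t : ℝ) + 1) * qk n t 0 ≤ CE * (n : ℝ) ^ 2 / ((t : ℝ) + 1) ^ 2 := by
  have h := qk_E3 (n := n) t
  have hp : (0 : ℝ) < (t : ℝ) + 1 := by positivity
  calc ((t : ℝ) + 1) * qk n t 0 ≤ ((t : ℝ) + 1) * (CE * (n : ℝ) ^ 2 / ((t : ℝ) + 1) ^ 3) := by gcongr
    _ = _ := by field_simp

lemma ke_nonneg (t : ℕ) : 0 ≤ ((t : ℝ) + 1) * qk n t 0 :=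
  mul_nonneg (by positivity) (qk_zero_nonneg t)

lemma ke_summable : Summable fun t : ℕ => ((t : ℝ) + 1) * qk n t 0 :=
  summ_of_tail (T := 0) (fun t => ke_nonneg t) (fun t _ => ke_le t)

lemma q_summable (x : Fin 4 → ZMod n) : Summable fun t => qk n t x :=
  Summable.of_norm_bounded (e_summable (n := n)) (fun t => qk_abs t x)

lemma kq_summable (x : Fin 4 → ZMod n) : Summable fun t : ℕ => ((t : ℝ) + 1) * qk n t x := by
  refine Summable.of_norm_bounded (ke_summable (n := n)) (fun t => ?_)
  rw [Real.norm_eq_abs, abs_mul, abs_of_nonneg (by positivity : (0 : ℝ) ≤ (t : ℝ) + 1)]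
  gcongr
  exact qk_abs t x

lemma Pop_qk (t : ℕ) : Pop (qk n t) = qk n (t + 1) := by
  funext x
  have := congrFun (Pop_sub (pk (ZMod n) t) (fun _ => ((n : ℝ) ^ 4)⁻¹)) x
  rw [Pop_const, ← pk_succ] at this
  exact this

lemma Pop_gg (x : Fin 4 → ZMod n) : Pop (gg n) x = gg n x - qk n 0 x := by
  have h := Pop_tsum (f := fun t => qk n t) (fun x => q_summable x) x
  have h2 := (q_summable x).tsum_eq_zero_add
  simp only [Pop_qk] at h
  unfold gg
  rw [h, h2]; ring

lemma Pop_kk (x : Fin 4 → ZMod n) : Pop (kk n) x = kk n x - gg n x := by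
  have h := Pop_tsum (f := fun t x => ((t : ℝ) + 1) * qk n t x) (fun x => kq_summable x) x
  simp only [Pop_smul, Pop_qk] at h
  have h2 := (q_summable x).tsum_eq_zero_add
  have h3 := (kq_summable x).tsum_eq_zero_add
  have hs := (summable_nat_add_iff 1).2 (kq_summable x)
  have hs2 := (summable_nat_add_iff 1).2 (q_summable x)
  have h4 : ∑' t : ℕ, ((t : ℝ) + 1) * qk n (t + 1) x =
      ∑' t : ℕ, (((t + 1 : ℕ) : ℝ) + 1) * qk n (t + 1) x - ∑' t : ℕ, qk n (t + 1) x := by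
    rw [← hs.tsum_sub hs2]
    refine tsum_congr fun t => ?_
    push_cast; ring
  unfold gg
  rw [show Pop (kk n) x = _ from h, h4, h2, show kk n x = _ from h3]
  push_cast
  ring

lemma pk_fsum (t : ℕ) : ∑ x, pk (ZMod n) t x = 1 := by
  have := pk_sum (R := ZMod n) t
  rwa [tsum_fintype] at this

lemma npos : (0 : ℝ) < n := Nat.cast_pos.2 (NeZero.pos n)

lemma qk_fsum (t : ℕ) : ∑ x, qk n t x = 0 := by
  unfold qk
  have := npos (n := n)
  rw [Finset.sum_sub_distrib, pk_fsum, Finset.sum_const, nsmul_eq_mul, Finset.card_univ, card_torus,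
    mul_inv_cancel₀ (by positivity), sub_self]

lemma gg_fsum : ∑ x, gg n x = 0 := by
  unfold gg
  rw [← Summable.tsum_finsetSum fun x _ => q_summable x]
  simp only [qk_fsum, tsum_zero]

lemma kk_fsum : ∑ x, kk n x = 0 := by
  unfold kk
  rw [← Summable.tsum_finsetSum fun x _ => kq_summable x]
  simp only [← Finset.mul_sum, qk_fsum, mul_zero, tsum_zero]

lemma qk_neg (t : ℕ) (x : Fin 4 → ZMod n) : qk n t (-x) = qk n t x := by
  unfold qk; rw [pk_neg]

lemma gg_neg (x : Fin 4 → ZMod n) : gg n (-x) = gg n x := by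
  unfold gg; simp only [qk_neg]

lemma kk_neg (x : Fin 4 → ZMod n) : kk n (-x) = kk n x := by
  unfold kk; simp only [qk_neg]

lemma gg_abs (x : Fin 4 → ZMod n) : |gg n x| ≤ gg n 0 := by
  unfold gg
  exact abs_tsum_le' e_summable (fun t => qk_abs t x)

lemma shift_sum (f : (Fin 4 → ZMod n) → ℝ) (y : Fin 4 → ZMod n) : ∑ x, f (x - y) = ∑ x, f x :=
  (Equiv.subRight y).sum_comp f

lemma shift_sum' (f : (Fin 4 → ZMod n) → ℝ) (y : Fin 4 → ZMod n) : ∑ x, f (y - x) = ∑ x, f x :=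
  (Equiv.subLeft y).sum_comp f

lemma qk_abs_sum_le (t : ℕ) : ∑ x, |qk n t x| ≤ 2 := by
  have hn := npos (n := n)
  calc ∑ x, |qk n t x| ≤ ∑ x : Fin 4 → ZMod n, (pk (ZMod n) t x + ((n : ℝ) ^ 4)⁻¹) := by
        refine Finset.sum_le_sum fun x _ => ?_
        unfold qk
        refine (abs_sub _ _).trans ?_
        rw [abs_of_nonneg (pk_nonneg t x), abs_of_nonneg (by positivity)]
    _ = 2 := by
      rw [Finset.sum_add_distrib, pk_fsum, Finset.sum_const, nsmul_eq_mul, Finset.card_univ, card_torus,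
        mul_inv_cancel₀ (by positivity)]
      norm_num

lemma kk_abs_sum : ∑ x, |kk n x| ≤ (2 + CE) * (n : ℝ) ^ 4 := by
  have hn := npos (n := n)
  set F : ℕ → ℝ := fun t => ((t : ℝ) + 1) * ∑ x, |qk n t x|
  have hF0 : ∀ t, 0 ≤ F t := fun t => mul_nonneg (by positivity) (Finset.sum_nonneg fun _ _ => abs_nonneg _)
  have hF : ∀ t, n ^ 2 ≤ t → F t ≤ CE * (n : ℝ) ^ 2 * (n : ℝ) ^ 4 / ((t : ℝ) + 1) ^ 2 := by
    intro t _
    have h1 : ∑ x, |qk n t x| ≤ (n : ℝ) ^ 4 * qk n t 0 := by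
      refine (Finset.sum_le_sum fun x _ => qk_abs t x).trans (le_of_eq ?_)
      rw [Finset.sum_const, nsmul_eq_mul, Finset.card_univ, card_torus]
    calc F t ≤ ((t : ℝ) + 1) * ((n : ℝ) ^ 4 * qk n t 0) := mul_le_mul_of_nonneg_left h1 (by positivity)
      _ = (n : ℝ) ^ 4 * (((t : ℝ) + 1) * qk n t 0) := by ring
      _ ≤ (n : ℝ) ^ 4 * (CE * (n : ℝ) ^ 2 / ((t : ℝ) + 1) ^ 2) := by gcongr; exact ke_le t
      _ = _ := by ring
  have hFs := summ_of_tail hF0 hF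
  have hsa : ∀ x : Fin 4 → ZMod n, Summable fun t : ℕ => ((t : ℝ) + 1) * |qk n t x| := by
    intro x
    refine ((kq_summable x).abs).congr fun t => ?_
    rw [abs_mul, abs_of_nonneg (by positivity : (0 : ℝ) ≤ (t : ℝ) + 1)]
  have h1 : ∑ x, |kk n x| ≤ ∑' t, F t := by
    have : ∀ x ∈ (Finset.univ : Finset (Fin 4 → ZMod n)), |kk n x| ≤ ∑' t : ℕ, ((t : ℝ) + 1) * |qk n t x| := by
      intro x _
      refine abs_tsum_le' (hsa x) fun t => ?_
      rw [abs_mul, abs_of_nonneg (by positivity : (0 : ℝ) ≤ (t : ℝ) + 1)]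
    refine (Finset.sum_le_sum this).trans (le_of_eq ?_)
    rw [← Summable.tsum_finsetSum fun x _ => hsa x]
    refine tsum_congr fun t => ?_
    rw [← Finset.mul_sum]
  have hT : 0 < n ^ 2 := pow_pos (NeZero.pos n) 2
  refine h1.trans ((tsum_le_tail hT hF0 hF).trans ?_)
  have h2 : ∑ t ∈ Finset.range (n ^ 2), F t ≤ 2 * (n : ℝ) ^ 4 := by
    calc ∑ t ∈ Finset.range (n ^ 2), F t ≤ ∑ t ∈ Finset.range (n ^ 2), ((t : ℝ) + 1) * 2 := by
          refine Finset.sum_le_sum fun t _ => ?_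
          exact mul_le_mul_of_nonneg_left (qk_abs_sum_le t) (by positivity)
      _ = 2 * ∑ t ∈ Finset.range (n ^ 2), ((t : ℝ) + 1) := by rw [← Finset.sum_mul, mul_comm]
      _ ≤ 2 * ((n ^ 2 : ℕ) : ℝ) ^ 2 := by gcongr; exact sum_succ_le _
      _ = _ := by push_cast; ring
  have h3 : CE * (n : ℝ) ^ 2 * (n : ℝ) ^ 4 / ((n ^ 2 : ℕ) : ℝ) = CE * (n : ℝ) ^ 4 := by
    push_cast; field_simp
  rw [h3]
  linarith

lemma e_tail : ∑' t, qk n (t + n ^ 2) 0 ≤ CE / (n : ℝ) ^ 2 := by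
  have hT : 0 < n ^ 2 := pow_pos (NeZero.pos n) 2
  have := tail_le (f := fun t => qk n t 0) (c := CE) hT (fun t => qk_zero_nonneg t) (fun t _ => qk_E2 t)
  push_cast at this
  exact this

lemma inv_split : ((n : ℝ) ^ 2) * ((n : ℝ) ^ 4)⁻¹ = 1 / (n : ℝ) ^ 2 := by
  have hn := npos (n := n)
  field_simp

lemma gg_abs_le (x : Fin 4 → ZMod n) :
    |gg n x| ≤ ∑ t ∈ Finset.range (n ^ 2), pk (ZMod n) t x + (CE + 1) / (n : ℝ) ^ 2 := by
  have hn := npos (n := n)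
  unfold gg
  rw [← (q_summable x).sum_add_tsum_nat_add (n ^ 2)]
  refine (abs_add_le _ _).trans ?_
  have h1 : |∑' t, qk n (t + n ^ 2) x| ≤ CE / (n : ℝ) ^ 2 :=
    (abs_tsum_le' ((summable_nat_add_iff (n ^ 2)).2 (e_summable (n := n)))
      (fun t => qk_abs _ x)).trans e_tail
  have h2 : |∑ t ∈ Finset.range (n ^ 2), qk n t x| ≤
      ∑ t ∈ Finset.range (n ^ 2), (pk (ZMod n) t x + ((n : ℝ) ^ 4)⁻¹) := by
    refine (Finset.abs_sum_le_sum_abs _ _).trans (Finset.sum_le_sum fun t _ => ?_)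
    unfold qk
    refine (abs_sub _ _).trans ?_
    rw [abs_of_nonneg (pk_nonneg t x), abs_of_nonneg (by positivity)]
  rw [Finset.sum_add_distrib, Finset.sum_const, Finset.card_range, nsmul_eq_mul] at h2
  push_cast at h2
  rw [inv_split] at h2
  rw [add_div]
  linarith

lemma window (r : ℕ) (x : Fin 4 → ZMod n) :
    ∑ t ∈ Finset.range (n ^ 2), pk (ZMod n) (r + t) x ≤
      ∑ t ∈ Finset.range (n ^ 2), pk (ZMod n) t x + (CE + 1) / (n : ℝ) ^ 2 := by
  have hn := npos (n := n)
  set T := n ^ 2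
  have h0 : ∀ u, pk (ZMod n) u x ≤ (if u < T then pk (ZMod n) u x else 0) + ((n : ℝ) ^ 4)⁻¹ +
      (if T ≤ u then qk n u 0 else 0) := by
    intro u
    have : (0 : ℝ) ≤ ((n : ℝ) ^ 4)⁻¹ := by positivity
    by_cases h : u < T
    · rw [if_pos h, if_neg (by omega)]; linarith
    · rw [if_neg h, if_pos (by omega)]
      have := (le_abs_self _).trans (qk_abs u x)
      unfold qk at this ⊢
      linarith
  refine (Finset.sum_le_sum fun t _ => h0 (r + t)).trans ?_
  rw [Finset.sum_add_distrib, Finset.sum_add_distrib, Finset.sum_const, Finset.card_range, nsmul_eq_mul]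
  have h1 : ∑ t ∈ Finset.range T, (if r + t < T then pk (ZMod n) (r + t) x else 0) ≤
      ∑ t ∈ Finset.range T, pk (ZMod n) t x := by
    rw [← Finset.sum_filter, ← Finset.sum_image (s := (Finset.range T).filter fun t => r + t < T)
      (g := fun t => r + t) (f := fun u => pk (ZMod n) u x) (by intro a _ b _ h; simpa using h)]
    refine Finset.sum_le_sum_of_subset_of_nonneg ?_ (fun t _ _ => pk_nonneg t x)
    intro u hu
    simp only [Finset.mem_image, Finset.mem_filter, Finset.mem_range] at hu ⊢
    obtain ⟨a, ha, rfl⟩ := hu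
    exact ha.2
  have h2 : ∑ t ∈ Finset.range T, (if T ≤ r + t then qk n (r + t) 0 else 0) ≤ CE / (n : ℝ) ^ 2 := by
    rw [← Finset.sum_filter]
    have e : ∑ t ∈ (Finset.range T).filter (fun t => T ≤ r + t), qk n (r + t) 0 =
        ∑ u ∈ ((Finset.range T).filter (fun t => T ≤ r + t)).image (fun t => r + t - T), qk n (u + T) 0 := by
      rw [Finset.sum_image]
      · refine Finset.sum_congr rfl fun a ha => ?_
        simp only [Finset.mem_filter] at ha
        rw [Nat.sub_add_cancel ha.2]
      · intro a ha b hb h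
        simp only [Finset.coe_filter, Set.mem_setOf_eq] at ha hb
        have : r + a - T = r + b - T := h
        omega
    rw [e]
    refine le_trans ?_ e_tail
    exact ((summable_nat_add_iff (n ^ 2)).2 (e_summable (n := n))).sum_le_tsum _
      (fun t _ => qk_zero_nonneg _)
  have h3 : ((T : ℕ) : ℝ) * ((n : ℝ) ^ 4)⁻¹ = 1 / (n : ℝ) ^ 2 := by
    rw [← inv_split]; simp [T]
  rw [h3, add_div]
  linarith

def MM (n : ℕ) (x : Fin 4 → ZMod n) : ℝ :=
  ∑ t ∈ Finset.range (n ^ 2), pk (ZMod n) t x + (2 * CE + 2) / (n : ℝ) ^ 2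

lemma MM_sum : ∑ x, MM n x = (2 * CE + 3) * (n : ℝ) ^ 2 := by
  have hn := npos (n := n)
  unfold MM
  rw [Finset.sum_add_distrib, Finset.sum_comm]
  simp only [pk_fsum, Finset.sum_const, Finset.card_range, nsmul_eq_mul, Finset.card_univ, card_torus]
  push_cast
  field_simp
  ring

lemma Pop_iter_gg (r : ℕ) (x : Fin 4 → ZMod n) : (Pop^[r] fun z => |gg n z|) x ≤ MM n x := by
  refine (Pop_iter_mono (fun z => gg_abs_le z) r x).trans ?_
  rw [Pop_iter_add, Pop_iter_const, Pop_iter_sum]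
  simp only [pk_iter]
  have := window r x
  unfold MM
  have e : (2 * CE + 2) / (n : ℝ) ^ 2 = (CE + 1) / (n : ℝ) ^ 2 + (CE + 1) / (n : ℝ) ^ 2 := by ring
  rw [e]
  linarith

theorem torus_GK (hn : 3 ≤ n) : GK (torus 4 n) (fun y x => gg n (x - y)) (fun y x => kk n (x - y))
    (fun y x => MM n (x - y)) (gg n 0) (kk n 0) ((2 * CE + 3) * (n : ℝ) ^ 2) ((2 + CE) * (n : ℝ) ^ 4) where
  row := torus_row hn
  col := torus_col hn
  hγ := by
    intro y a
    rw [torus_op1 hn, Pop_shift]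
    dsimp only
    rw [Pop_gg, card_torus, qk, pk_zero, dl]
    simp only [sub_eq_zero]
    by_cases h : a = y
    · rw [if_pos h, if_pos h]; ring
    · rw [if_neg h, if_neg h]; ring
  hκ := by
    intro y a
    rw [torus_op1 hn, Pop_shift]
    dsimp only
    rw [Pop_kk]
  γ0 := fun y => by rw [shift_sum, gg_fsum]
  κ0 := fun y => by rw [shift_sum, kk_fsum]
  γs := fun x y => by rw [← gg_neg, neg_sub]
  κs := fun x y => by rw [← kk_neg, neg_sub]
  γd := fun y => by rw [sub_self]
  κd := fun y => by rw [sub_self]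
  γle := fun y x => gg_abs _
  hM := by
    intro r y x
    rw [show op1 (torus 4 n) = Pop from funext fun f => torus_op1 hn f]
    rw [Pop_iter_shift (fun z => |gg n z|)]
    exact Pop_iter_gg r _
  Mrow := fun y => by rw [shift_sum, MM_sum]
  Mcol := fun x => by rw [shift_sum', MM_sum]
  κrow := fun y => by rw [shift_sum (fun x => |kk n x|)]; exact kk_abs_sum

end TorusGreen

section SecondMoment

lemma Pop_comm_shift {R : Type*} [CommRing R] (f : (Fin 4 → R) → ℝ) (a : Fin 4 → R) (t : ℕ) :
    Pop^[t] (fun x => f (x + a)) = fun x => (Pop^[t] f) (x + a) := by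
  have := Pop_iter_shift f (-a) t
  simpa only [sub_neg_eq_add] using this

def Df (i : Fin 4) (F : (Fin 4 → ℤ) → ℝ) (y : Fin 4 → ℤ) : ℝ :=
  (1 / 16) * F (y + ev ℤ i) + (-(1 / 16)) * F (y - ev ℤ i)

def sqn (y : Fin 4 → ℤ) : ℝ := ∑ i, (y i : ℝ) ^ 2

lemma Pop_iter_Df (i : Fin 4) (F : (Fin 4 → ℤ) → ℝ) (t : ℕ) :
    Pop^[t] (Df i F) = Df i (Pop^[t] F) := by
  unfold Df
  rw [Pop_iter_add (fun y => (1 / 16) * F (y + ev ℤ i)) (fun y => (-(1 / 16)) * F (y - ev ℤ i)),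
    Pop_iter_smul _ (fun y => F (y + ev ℤ i)), Pop_iter_smul _ (fun y => F (y - ev ℤ i)),
    Pop_comm_shift, Pop_iter_shift]

lemma Pop_coord (i : Fin 4) (H : (Fin 4 → ℤ) → ℝ) :
    Pop (fun y : Fin 4 → ℤ => (y i : ℝ) * H y) = fun y : Fin 4 → ℤ => (y i : ℝ) * Pop H y + Df i H y := by
  funext y
  unfold Pop Df
  have : ∀ j, ((((y + ev ℤ j) i : ℤ) : ℝ) * H (y + ev ℤ j) + (((y - ev ℤ j) i : ℤ) : ℝ) * H (y - ev ℤ j)) =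
      (y i : ℝ) * (H (y + ev ℤ j) + H (y - ev ℤ j)) +
      (if j = i then H (y + ev ℤ i) - H (y - ev ℤ i) else 0) := by
    intro j
    by_cases h : j = i
    · subst h; simp [ev]; ring
    · have h' : i ≠ j := fun hh => h hh.symm
      simp [ev, h, h']; ring
  simp only [this]
  rw [Finset.sum_add_distrib, ← Finset.mul_sum, Finset.sum_ite_eq' Finset.univ i]
  simp
  ring

lemma Pop_sqn (F : (Fin 4 → ℤ) → ℝ) :
    Pop (fun y => sqn y * F y) = fun y => (sqn y * Pop F y + ∑ i, 2 * ((y i : ℝ) * Df i F y)) +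
      (∑ i, (F (y + ev ℤ i) + F (y - ev ℤ i))) / 16 := by
  funext y
  unfold Pop
  have hp : ∀ j, sqn (y + ev ℤ j) = sqn y + 2 * y j + 1 := by
    intro j
    unfold sqn
    have : ∀ i, (((y + ev ℤ j) i : ℤ) : ℝ) ^ 2 = (y i : ℝ) ^ 2 + (if i = j then 2 * (y j : ℝ) + 1 else 0) := by
      intro i
      by_cases h : i = j
      · subst h; simp [ev]; ring
      · simp [ev, h]
    simp only [this]
    rw [Finset.sum_add_distrib, Finset.sum_ite_eq' Finset.univ j]
    simp; ring
  have hm : ∀ j, sqn (y - ev ℤ j) = sqn y - 2 * y j + 1 := by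
    intro j
    unfold sqn
    have : ∀ i, (((y - ev ℤ j) i : ℤ) : ℝ) ^ 2 = (y i : ℝ) ^ 2 + (if i = j then -2 * (y j : ℝ) + 1 else 0) := by
      intro i
      by_cases h : i = j
      · subst h; simp [ev]; ring
      · simp [ev, h]
    simp only [this]
    rw [Finset.sum_add_distrib, Finset.sum_ite_eq' Finset.univ j]
    simp; ring
  have : ∀ j, sqn (y + ev ℤ j) * F (y + ev ℤ j) + sqn (y - ev ℤ j) * F (y - ev ℤ j) =
      sqn y * (F (y + ev ℤ j) + F (y - ev ℤ j)) + 16 * (2 * ((y j : ℝ) * Df j F y)) +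
      (F (y + ev ℤ j) + F (y - ev ℤ j)) := by
    intro j
    rw [hp, hm]; unfold Df; ring
  simp only [this]
  rw [Finset.sum_add_distrib, Finset.sum_add_distrib, ← Finset.mul_sum, ← Finset.mul_sum]
  ring

lemma coord_moment (i : Fin 4) (H : (Fin 4 → ℤ) → ℝ) (t : ℕ) :
    (Pop^[t + 1] (fun y : Fin 4 → ℤ => (y i : ℝ) * H y)) 0 = ((t : ℝ) + 1) * (Pop^[t] (Df i H)) 0 := by
  induction t generalizing H with
  | zero =>
    simp only [Function.iterate_succ, Function.iterate_zero, Function.comp, id]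
    rw [Pop_coord]; simp
  | succ t ih =>
    rw [Function.iterate_succ_apply, Pop_coord, Pop_iter_add (fun y : Fin 4 → ℤ => (y i : ℝ) * Pop H y)]
    dsimp only
    rw [ih]
    have : Df i (Pop H) = Pop (Df i H) := (Pop_iter_Df i H 1).symm
    rw [this, ← Function.iterate_succ_apply]
    push_cast; ring

lemma second_moment (F : (Fin 4 → ℤ) → ℝ) (h0 : ∀ x, 0 ≤ F x)
    (hmax : ∀ t x, (Pop^[t] F) x ≤ (Pop^[t] F) 0) (t : ℕ) :
    (Pop^[t] (fun y => sqn y * F y)) 0 ≤ t * (Pop^[t] F) 0 := by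
  induction t generalizing F with
  | zero => simp [sqn]
  | succ t ih =>
    have hP0 : ∀ x, 0 ≤ Pop F x := fun x => by
      have := Pop_mono h0 x
      rwa [Pop_const] at this
    have h1 := ih (Pop F) hP0 (fun s x => hmax (s + 1) x)
    rw [Function.iterate_succ_apply, Pop_sqn,
      Pop_iter_add (fun y => sqn y * Pop F y + ∑ i, 2 * ((y i : ℝ) * Df i F y)),
      Pop_iter_add (fun y => sqn y * Pop F y), Pop_iter_sum]
    have h2 : ∑ i, (Pop^[t] (fun y : Fin 4 → ℤ => 2 * ((y i : ℝ) * Df i F y))) 0 ≤ 0 := by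
      refine Finset.sum_nonpos fun i _ => ?_
      rw [Pop_iter_smul _ (fun y : Fin 4 → ℤ => (y i : ℝ) * Df i F y)]
      cases t with
      | zero => simp
      | succ s =>
        dsimp only
        rw [coord_moment, Pop_iter_Df, Pop_iter_Df]
        have hx := hmax s (0 + ev ℤ i + ev ℤ i)
        have hy := hmax s (0 - ev ℤ i - ev ℤ i)
        have : Df i (Df i (Pop^[s] F)) 0 ≤ 0 := by
          unfold Df
          rw [show (0 : Fin 4 → ℤ) + ev ℤ i - ev ℤ i = 0 by simp, show (0 : Fin 4 → ℤ) - ev ℤ i + ev ℤ i = 0 by simp]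
          linarith
        have hs : (0 : ℝ) ≤ (s : ℝ) + 1 := by positivity
        nlinarith
    have h3 : (Pop^[t] (fun y => (∑ i, (F (y + ev ℤ i) + F (y - ev ℤ i))) / 16)) 0 ≤ (Pop^[t] (Pop F)) 0 := by
      refine Pop_iter_mono (fun y => ?_) t 0
      have := h0 y
      show _ ≤ F y / 2 + _
      linarith
    rw [Function.iterate_succ_apply]
    push_cast
    linarith

end SecondMoment

section Wrap

variable {n : ℕ} [NeZero n]

def prj (n : ℕ) (y : Fin 4 → ℤ) : Fin 4 → ZMod n := fun i => (y i : ZMod n)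

lemma prj_ev_add (y : Fin 4 → ℤ) (i : Fin 4) : prj n (y + ev ℤ i) = prj n y + ev (ZMod n) i := by
  funext j
  by_cases h : j = i
  · subst h; simp [prj, ev]
  · simp [prj, ev, h]

lemma prj_ev_sub (y : Fin 4 → ℤ) (i : Fin 4) : prj n (y - ev ℤ i) = prj n y - ev (ZMod n) i := by
  have := prj_ev_add (n := n) (y - ev ℤ i) i
  rw [sub_add_cancel] at this
  rw [this, add_sub_cancel_right]

lemma prj_zero : prj n 0 = 0 := by funext i; simp [prj]

lemma Pop_prj (f : (Fin 4 → ZMod n) → ℝ) (t : ℕ) :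
    Pop^[t] (fun y => f (prj n y)) = fun y => (Pop^[t] f) (prj n y) := by
  induction t generalizing f with
  | zero => rfl
  | succ t ih =>
    have : Pop (fun y => f (prj n y)) = fun y => Pop f (prj n y) := by
      funext y
      unfold Pop
      simp only [prj_ev_add, prj_ev_sub]
    rw [Function.iterate_succ_apply, this, ih]; rfl

lemma pk_prj (t : ℕ) : Pop^[t] (fun y => dl (ZMod n) (prj n y)) = fun y => pk (ZMod n) t (prj n y) :=
  Pop_prj _ t

lemma pk_le_prj (t : ℕ) (y : Fin 4 → ℤ) : pk ℤ t y ≤ pk (ZMod n) t (prj n y) := by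
  have h := Pop_iter_mono (f := dl ℤ) (g := fun y => dl (ZMod n) (prj n y)) (fun y => by
    unfold dl
    by_cases h : y = 0
    · rw [if_pos h, if_pos (by rw [h, prj_zero])]
    · rw [if_neg h]; split_ifs <;> norm_num) t y
  rw [pk_prj] at h
  exact h

lemma pk_wrap (t : ℕ) : pk (ZMod n) t 0 ≤ pk ℤ t 0 + (t / (n : ℝ) ^ 2) * pk (ZMod n) t 0 := by
  have hn := npos (n := n)
  have h := second_moment (fun y => dl (ZMod n) (prj n y)) (fun y => by unfold dl; split_ifs <;> norm_num)
    (fun s x => by rw [pk_prj]; dsimp only; rw [prj_zero]; exact pk_le_zero s _) t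
  rw [pk_prj] at h
  have h2 := Pop_iter_mono (f := fun y => dl (ZMod n) (prj n y))
    (g := fun y => dl ℤ y + ((n : ℝ) ^ 2)⁻¹ * (sqn y * dl (ZMod n) (prj n y))) (fun y => by
      have hs : 0 ≤ sqn y := Finset.sum_nonneg fun i _ => sq_nonneg _
      unfold dl
      by_cases h : y = 0
      · rw [if_pos h]
        have : 0 ≤ ((n : ℝ) ^ 2)⁻¹ * (sqn y * (if prj n y = 0 then 1 else 0)) := by
          split_ifs <;> positivity
        split_ifs at this ⊢ <;> linarith
      · rw [if_neg h]
        by_cases hp : prj n y = 0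
        · rw [if_pos hp, zero_add, mul_one, ← div_eq_inv_mul, le_div_iff₀ (by positivity), one_mul]
          obtain ⟨i, hi⟩ := Function.ne_iff.1 h
          have hd : (n : ℤ) ∣ y i := (ZMod.intCast_zmod_eq_zero_iff_dvd (y i) n).1 (congrFun hp i)
          have h3 : (n : ℤ) ≤ |y i| := Int.le_of_dvd (abs_pos.2 hi) ((dvd_abs _ _).2 hd)
          have h4 : (n : ℝ) ≤ |(y i : ℝ)| := by exact_mod_cast h3
          calc (n : ℝ) ^ 2 ≤ |(y i : ℝ)| ^ 2 := by gcongr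
            _ = (y i : ℝ) ^ 2 := sq_abs _
            _ ≤ sqn y := Finset.single_le_sum (f := fun i => (y i : ℝ) ^ 2) (fun i _ => sq_nonneg _) (Finset.mem_univ i)
        · rw [if_neg hp]; simp) t 0
  rw [pk_prj, Pop_iter_add, Pop_iter_smul _ (fun y => sqn y * dl (ZMod n) (prj n y))] at h2
  dsimp only at h h2
  rw [prj_zero] at h h2
  refine h2.trans ?_
  have h5 := mul_le_mul_of_nonneg_left h (show (0 : ℝ) ≤ ((n : ℝ) ^ 2)⁻¹ by positivity)
  have h6 : ((n : ℝ) ^ 2)⁻¹ * (t * pk (ZMod n) t 0) = (t / (n : ℝ) ^ 2) * pk (ZMod n) t 0 := by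
    rw [div_eq_mul_inv]; ring
  have h7 : (Pop^[t] (dl ℤ)) 0 = pk ℤ t 0 := rfl
  linarith

end Wrap

section LatticeMax

lemma pkZ_zero_le_torus (n : ℕ) [NeZero n] (t : ℕ) : pk ℤ t 0 ≤ pk (ZMod n) t 0 := by
  have := pk_le_prj (n := n) t 0
  rwa [prj_zero] at this

lemma pk_torus_le (n : ℕ) [NeZero n] (t : ℕ) : pk (ZMod n) t 0 ≤ pk ℤ t 0 + t / (n : ℝ) ^ 2 := by
  have h := pk_wrap (n := n) t
  have h1 := pk_le_one (R := ZMod n) t 0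
  have : (t / (n : ℝ) ^ 2) * pk (ZMod n) t 0 ≤ t / (n : ℝ) ^ 2 := mul_le_of_le_one_right (by positivity) h1
  linarith

lemma tend_inv_sq (c : ℝ) : Tendsto (fun n : ℕ => c / ((n : ℝ) + 1) ^ 2) atTop (nhds 0) := by
  have h1 := (tendsto_one_div_add_atTop_nhds_zero_nat (𝕜 := ℝ)).pow 2
  have h2 := h1.const_mul c
  simp only [ne_eq, OfNat.ofNat_ne_zero, not_false_eq_true, zero_pow, mul_zero] at h2
  refine h2.congr fun n => ?_
  rw [div_pow, one_pow]; ring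

lemma pkZ_le_zero (t : ℕ) (x : Fin 4 → ℤ) : pk ℤ t x ≤ pk ℤ t 0 := by
  have h : ∀ n : ℕ, pk ℤ t x ≤ pk ℤ t 0 + t / ((n : ℝ) + 1) ^ 2 := by
    intro n
    have h1 := pk_le_prj (n := n + 1) t x
    have h2 := pk_le_zero (n := n + 1) t (prj (n + 1) x)
    have h3 := pk_torus_le (n + 1) t
    push_cast at h3
    linarith
  have h2 := (tend_inv_sq t).const_add (pk ℤ t 0)
  rw [add_zero] at h2
  exact ge_of_tendsto' h2 h

lemma pkZ_E2 (t : ℕ) : pk ℤ t 0 ≤ CE / ((t : ℝ) + 1) ^ 2 := by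
  have h : ∀ n : ℕ, pk ℤ t 0 ≤ CE / ((t : ℝ) + 1) ^ 2 + 1 / ((n : ℝ) + 1) ^ 2 := by
    intro n
    have h1 := pkZ_zero_le_torus (n + 1) t
    have h2 := qk_E2 (n := n + 1) t
    unfold qk at h2
    push_cast at h2
    have h3 : (((n : ℝ) + 1) ^ 4)⁻¹ ≤ 1 / ((n : ℝ) + 1) ^ 2 := by
      rw [← one_div]
      have hn : (1 : ℝ) ≤ (n : ℝ) + 1 := by linarith [(Nat.cast_nonneg n : (0 : ℝ) ≤ n)]
      exact one_div_le_one_div_of_le (by positivity) (pow_le_pow_right₀ hn (by norm_num))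
    linarith
  have h2 := (tend_inv_sq 1).const_add (CE / ((t : ℝ) + 1) ^ 2)
  rw [add_zero] at h2
  exact ge_of_tendsto' h2 h

end LatticeMax

section TorusAsym

def AA (T : ℕ) : ℝ := ∑ u ∈ Finset.range T, ((u : ℝ) + 1) * pk ℤ u 0

lemma kk_lower (n : ℕ) [NeZero n] : AA (n ^ 2) - 1 ≤ kk n 0 := by
  have hn := npos (n := n)
  have h1 : ∑ t ∈ Finset.range (n ^ 2), ((t : ℝ) + 1) * qk n t 0 ≤ kk n 0 :=
    (ke_summable (n := n)).sum_le_tsum _ (fun t _ => ke_nonneg t)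
  have h2 : AA (n ^ 2) - (∑ t ∈ Finset.range (n ^ 2), ((t : ℝ) + 1)) * ((n : ℝ) ^ 4)⁻¹ ≤
      ∑ t ∈ Finset.range (n ^ 2), ((t : ℝ) + 1) * qk n t 0 := by
    unfold AA
    rw [Finset.sum_mul, ← Finset.sum_sub_distrib]
    refine Finset.sum_le_sum fun t _ => ?_
    unfold qk
    rw [← mul_sub]
    have := pkZ_zero_le_torus n t
    gcongr
  have h3 : (∑ t ∈ Finset.range (n ^ 2), ((t : ℝ) + 1)) * ((n : ℝ) ^ 4)⁻¹ ≤ 1 := by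
    rw [← div_eq_mul_inv, div_le_one (by positivity)]
    refine (sum_succ_le _).trans (le_of_eq ?_)
    push_cast; ring
  linarith

lemma kk_upper (n : ℕ) [NeZero n] : kk n 0 ≤ AA (n ^ 2) + (2 * CE + 1) := by
  have hn := npos (n := n)
  have hT : 0 < n ^ 2 := pow_pos (NeZero.pos n) 2
  have h1 := tsum_le_tail (f := fun t : ℕ => ((t : ℝ) + 1) * qk n t 0) hT (fun t => ke_nonneg t) (fun t _ => ke_le t)
  have h0 : CE * (n : ℝ) ^ 2 / ((n ^ 2 : ℕ) : ℝ) = CE := by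
    push_cast; field_simp
  rw [h0] at h1
  have hC := CE_pos
  have h2 : ∑ t ∈ Finset.range (n ^ 2), ((t : ℝ) + 1) * qk n t 0 ≤
      AA (n ^ 2) + ∑ t ∈ Finset.range (n ^ 2), (CE / (n : ℝ) ^ 2 + ((t : ℝ) + 1) * ((n : ℝ) ^ 4)⁻¹) := by
    unfold AA
    rw [← Finset.sum_add_distrib]
    refine Finset.sum_le_sum fun t ht => ?_
    have ht' : (t : ℝ) ≤ (n : ℝ) ^ 2 := by exact_mod_cast (Finset.mem_range.1 ht).le
    have hw := pk_wrap (n := n) t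
    have hE := qk_E2 (n := n) t
    have hp : pk (ZMod n) t 0 = qk n t 0 + ((n : ℝ) ^ 4)⁻¹ := by unfold qk; ring
    have hq : qk n t 0 ≤ pk (ZMod n) t 0 := by rw [hp]; linarith [show (0 : ℝ) ≤ ((n : ℝ) ^ 4)⁻¹ by positivity]
    have ht0 : (0 : ℝ) ≤ t := Nat.cast_nonneg t
    have h5 : (t / (n : ℝ) ^ 2) * pk (ZMod n) t 0 ≤
        (t / (n : ℝ) ^ 2) * (CE / ((t : ℝ) + 1) ^ 2) + 1 * ((n : ℝ) ^ 4)⁻¹ := by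
      rw [hp, mul_add]
      have : t / (n : ℝ) ^ 2 ≤ 1 := (div_le_one (by positivity)).2 ht'
      gcongr
    have h6 : ((t : ℝ) + 1) * ((t / (n : ℝ) ^ 2) * (CE / ((t : ℝ) + 1) ^ 2)) ≤ CE / (n : ℝ) ^ 2 := by
      have : ((t : ℝ) + 1) * ((t / (n : ℝ) ^ 2) * (CE / ((t : ℝ) + 1) ^ 2)) =
          (t / ((t : ℝ) + 1)) * (CE / (n : ℝ) ^ 2) := by field_simp
      rw [this]
      refine mul_le_of_le_one_left (by positivity) ((div_le_one (by positivity)).2 (by linarith))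
    calc ((t : ℝ) + 1) * qk n t 0 ≤ ((t : ℝ) + 1) * (pk ℤ t 0 + ((t / (n : ℝ) ^ 2) * (CE / ((t : ℝ) + 1) ^ 2) + 1 * ((n : ℝ) ^ 4)⁻¹)) := by
          gcongr; linarith
      _ = ((t : ℝ) + 1) * pk ℤ t 0 + (((t : ℝ) + 1) * ((t / (n : ℝ) ^ 2) * (CE / ((t : ℝ) + 1) ^ 2)) + ((t : ℝ) + 1) * ((n : ℝ) ^ 4)⁻¹) := by ring
      _ ≤ _ := by gcongr
  have h3 : ∑ t ∈ Finset.range (n ^ 2), (CE / (n : ℝ) ^ 2 + ((t : ℝ) + 1) * ((n : ℝ) ^ 4)⁻¹) ≤ CE + 1 := by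
    rw [Finset.sum_add_distrib, Finset.sum_const, Finset.card_range, ← Finset.sum_mul]
    refine add_le_add (le_of_eq ?_) ?_
    · rw [nsmul_eq_mul]; push_cast; field_simp
    · rw [← div_eq_mul_inv, div_le_one (by positivity)]
      refine (sum_succ_le _).trans (le_of_eq ?_)
      push_cast; ring
  unfold kk
  linarith

lemma pkZ_summable (x : Fin 4 → ℤ) : Summable fun t => pk ℤ t x :=
  summ_of_tail (T := 0) (fun t => pk_nonneg t x) (fun t _ => (pkZ_le_zero t x).trans (pkZ_E2 t))

lemma gg_tendsto : Tendsto (fun n : ℕ => gg (n + 1) 0) atTop (nhds (greenZ 4 0)) := by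
  rw [greenZ_eq]
  unfold gg
  refine tendsto_tsum_of_dominated_convergence (bound := fun t : ℕ => CE * (1 / ((t : ℝ) + 1) ^ 2))
    (inv_sq_summable.mul_left CE) ?_ ?_
  · intro t
    have hA : Tendsto (fun n : ℕ => pk ℤ t 0 - 1 / ((n : ℝ) + 1) ^ 2) atTop (nhds (pk ℤ t 0)) := by
      simpa using (tend_inv_sq 1).const_sub (pk ℤ t 0)
    have hB : Tendsto (fun n : ℕ => pk ℤ t 0 + t / ((n : ℝ) + 1) ^ 2) atTop (nhds (pk ℤ t 0)) := by
      simpa using (tend_inv_sq t).const_add (pk ℤ t 0)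
    refine tendsto_of_tendsto_of_tendsto_of_le_of_le hA hB (fun n => ?_) (fun n => ?_)
    · have h1 := pkZ_zero_le_torus (n + 1) t
      have h3 : (((n : ℝ) + 1) ^ 4)⁻¹ ≤ 1 / ((n : ℝ) + 1) ^ 2 := by
        rw [← one_div]
        have hn : (1 : ℝ) ≤ (n : ℝ) + 1 := by linarith [(Nat.cast_nonneg n : (0 : ℝ) ≤ n)]
        exact one_div_le_one_div_of_le (by positivity) (pow_le_pow_right₀ hn (by norm_num))
      unfold qk
      push_cast
      linarith
    · have h1 := pk_torus_le (n + 1) t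
      have h3 : 0 ≤ (((n : ℝ) + 1) ^ 4)⁻¹ := by positivity
      unfold qk
      push_cast at h1 ⊢
      linarith
  · refine Eventually.of_forall fun n t => ?_
    rw [Real.norm_eq_abs, abs_of_nonneg (qk_zero_nonneg t), mul_one_div]
    exact qk_E2 t

lemma greenZ_pos : 0 < greenZ 4 0 := by
  rw [greenZ_eq]
  have h := (pkZ_summable 0).sum_le_tsum (Finset.range 1) (fun t _ => pk_nonneg t 0)
  rw [Finset.sum_range_one, pk_zero, dl_zero] at h
  linarith

end TorusAsym

section LatticeSum

lemma diag_aux (h : ℕ → ℝ) (T : ℕ) : ∑ s ∈ Finset.range T, ∑ t ∈ Finset.range T, h (s + t) =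
    ∑ u ∈ Finset.range (2 * T), (((Finset.range T ×ˢ Finset.range T).filter (fun p => p.1 + p.2 = u)).card : ℝ) * h u := by
  rw [← Finset.sum_product' (f := fun s t => h (s + t)),
    ← Finset.sum_fiberwise_of_maps_to (g := fun p : ℕ × ℕ => p.1 + p.2) (t := Finset.range (2 * T))]
  · refine Finset.sum_congr rfl fun u _ => ?_
    rw [← nsmul_eq_mul, ← Finset.sum_const]
    refine Finset.sum_congr rfl fun p hp => ?_
    rw [(Finset.mem_filter.1 hp).2]
  · intro p hp
    rw [Finset.mem_product, Finset.mem_range, Finset.mem_range] at hp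
    rw [Finset.mem_range]; omega

lemma diag_upper (h : ℕ → ℝ) (h0 : ∀ u, 0 ≤ h u) (T : ℕ) :
    ∑ s ∈ Finset.range T, ∑ t ∈ Finset.range T, h (s + t) ≤ ∑ u ∈ Finset.range (2 * T), ((u : ℝ) + 1) * h u := by
  rw [diag_aux]
  refine Finset.sum_le_sum fun u _ => mul_le_mul_of_nonneg_right ?_ (h0 u)
  have : ((Finset.range T ×ˢ Finset.range T).filter (fun p => p.1 + p.2 = u)).card ≤ u + 1 := by
    rw [← Finset.Nat.card_antidiagonal u]
    refine Finset.card_le_card fun p hp => ?_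
    rw [Finset.HasAntidiagonal.mem_antidiagonal]; exact (Finset.mem_filter.1 hp).2
  exact_mod_cast this

lemma diag_lower (h : ℕ → ℝ) (h0 : ∀ u, 0 ≤ h u) (T : ℕ) :
    ∑ u ∈ Finset.range T, ((u : ℝ) + 1) * h u ≤ ∑ s ∈ Finset.range T, ∑ t ∈ Finset.range T, h (s + t) := by
  rw [diag_aux]
  refine le_trans ?_ (Finset.sum_le_sum_of_subset_of_nonneg (s := Finset.range T)
    (Finset.range_subset_range.2 (by omega)) (fun u _ _ => mul_nonneg (Nat.cast_nonneg _) (h0 u)))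
  refine Finset.sum_le_sum fun u hu => mul_le_mul_of_nonneg_right ?_ (h0 u)
  have : u + 1 ≤ ((Finset.range T ×ˢ Finset.range T).filter (fun p => p.1 + p.2 = u)).card := by
    rw [← Finset.Nat.card_antidiagonal u]
    refine Finset.card_le_card fun p hp => ?_
    rw [Finset.HasAntidiagonal.mem_antidiagonal] at hp
    rw [Finset.mem_range] at hu
    rw [Finset.mem_filter, Finset.mem_product, Finset.mem_range, Finset.mem_range]
    omega
  exact_mod_cast this

def GT (T : ℕ) (y : Fin 4 → ℤ) : ℝ := ∑ t ∈ Finset.range T, pk ℤ t y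

lemma GT_nonneg (T : ℕ) (y : Fin 4 → ℤ) : 0 ≤ GT T y := Finset.sum_nonneg fun t _ => pk_nonneg t y

lemma GT_summ (T : ℕ) (f : (Fin 4 → ℤ) → ℝ) : Summable fun y => GT T y * f y := by
  have : (fun y => GT T y * f y) = fun y => ∑ t ∈ Finset.range T, pk ℤ t y * f y := by
    funext y; unfold GT; rw [Finset.sum_mul]
  rw [this]
  exact summable_sum fun t _ => summ_of_fin (pk_fin t) f

lemma GT_pair (T : ℕ) (f : (Fin 4 → ℤ) → ℝ) :
    ∑' y, GT T y * f y = ∑ s ∈ Finset.range T, (Pop^[s] f) 0 := by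
  have : (fun y => GT T y * f y) = fun y => ∑ t ∈ Finset.range T, pk ℤ t y * f y := by
    funext y; unfold GT; rw [Finset.sum_mul]
  rw [this, Summable.tsum_finsetSum (fun t _ => summ_of_fin (pk_fin t) f)]
  exact Finset.sum_congr rfl fun s _ => pairing s f

lemma GT_sum (T : ℕ) : ∑' y, GT T y = T := by
  have := GT_pair T (fun _ => 1)
  simp only [mul_one, Pop_iter_const] at this
  simpa using this

lemma GT_summable (T : ℕ) : Summable (GT T) := by simpa using GT_summ T (fun _ => 1)

lemma GT_sq (T : ℕ) : ∑' y, GT T y * GT T y = ∑ s ∈ Finset.range T, ∑ t ∈ Finset.range T, pk ℤ (s + t) 0 := by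
  rw [GT_pair]
  refine Finset.sum_congr rfl fun s _ => ?_
  unfold GT
  rw [Pop_iter_sum]
  simp only [pk_iter]

lemma GT_sqn (T : ℕ) : ∑' y, GT T y * (sqn y * GT T y) ≤
    ∑ s ∈ Finset.range T, ∑ t ∈ Finset.range T, (s : ℝ) * pk ℤ (s + t) 0 := by
  rw [GT_pair]
  refine Finset.sum_le_sum fun s _ => ?_
  have : (fun y => sqn y * GT T y) = fun y => ∑ t ∈ Finset.range T, sqn y * pk ℤ t y := by
    funext y; unfold GT; rw [Finset.mul_sum]
  rw [this, Pop_iter_sum]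
  refine Finset.sum_le_sum fun t _ => ?_
  have := second_moment (pk ℤ t) (pk_nonneg t) (fun r x => by rw [pk_iter]; exact pkZ_le_zero _ x) s
  rwa [pk_iter] at this

lemma uau_le (u : ℕ) : ((u : ℝ) + 1) * ((u : ℝ) * pk ℤ u 0) ≤ CE := by
  have h := pkZ_E2 u
  have hC := CE_pos
  have hu : (0 : ℝ) ≤ u := Nat.cast_nonneg u
  have hp := pk_nonneg (R := ℤ) u 0
  rw [le_div_iff₀ (by positivity)] at h
  nlinarith [mul_nonneg hu hp]

def Bm (m : ℕ) : Finset (Fin 4 → ℤ) :=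
  (Fintype.piFinset fun _ : Fin 4 => Finset.Icc (-(m : ℤ)) m).filter (fun y => (∑ i, (y i) ^ 2) ≤ (m : ℤ) ^ 2)

lemma mem_Bm (m : ℕ) (y : Fin 4 → ℤ) : y ∈ Bm m ↔ (∑ i, (y i) ^ 2) ≤ (m : ℤ) ^ 2 := by
  unfold Bm
  rw [Finset.mem_filter, and_iff_right_iff_imp]
  intro h
  rw [Fintype.mem_piFinset]
  intro i
  have h1 : (y i) ^ 2 ≤ (m : ℤ) ^ 2 :=
    (Finset.single_le_sum (f := fun i => (y i) ^ 2) (fun i _ => sq_nonneg _) (Finset.mem_univ i)).trans h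
  have h2 := abs_le_of_sq_le_sq' h1 (by positivity)
  exact Finset.mem_Icc.2 h2

lemma card_Bm (m : ℕ) (hm : 1 ≤ m) : ((Bm m).card : ℝ) ≤ 81 * (m : ℝ) ^ 4 := by
  have h1 : (Bm m).card ≤ (3 * m) ^ 4 := by
    refine (Finset.card_filter_le _ _).trans ?_
    rw [Fintype.card_piFinset]
    simp only [Int.card_Icc, Finset.prod_const, Finset.card_univ, Fintype.card_fin]
    refine Nat.pow_le_pow_left ?_ 4
    omega
  calc ((Bm m).card : ℝ) ≤ (((3 * m) ^ 4 : ℕ) : ℝ) := by exact_mod_cast h1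
    _ = _ := by push_cast; ring

lemma sqn_cast (y : Fin 4 → ℤ) : sqn y = ((∑ i, (y i) ^ 2 : ℤ) : ℝ) := by
  unfold sqn; push_cast; rfl

lemma ball_tsum (m : ℕ) : (∑' y : Fin 4 → ℤ, if (∑ i, (y i) ^ 2) ≤ (m : ℤ) ^ 2 then (greenZ 4 y) ^ 2 else 0) =
    ∑ y ∈ Bm m, (greenZ 4 y) ^ 2 := by
  rw [tsum_eq_sum (s := Bm m)]
  · refine Finset.sum_congr rfl fun y hy => ?_
    rw [if_pos ((mem_Bm m y).1 hy)]
  · intro y hy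
    rw [if_neg (fun h => hy ((mem_Bm m y).2 h))]

lemma green_split (T : ℕ) (hT : 0 < T) (y : Fin 4 → ℤ) :
    GT T y ≤ greenZ 4 y ∧ greenZ 4 y ≤ GT T y + CE / T := by
  rw [greenZ_eq]
  exact ⟨(pkZ_summable y).sum_le_tsum _ (fun t _ => pk_nonneg t y),
    tsum_le_tail hT (fun t => pk_nonneg t y) (fun t _ => (pkZ_le_zero t y).trans (pkZ_E2 t))⟩

lemma ball_upper (m : ℕ) (hm : 1 ≤ m) :
    ∑ y ∈ Bm m, (greenZ 4 y) ^ 2 ≤ AA (2 * m ^ 2) + (2 * CE + 81 * CE ^ 2) := by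
  have hm0 : (0 : ℝ) < m := by exact_mod_cast hm
  have hT : 0 < m ^ 2 := by positivity
  have hC := CE_pos
  set c : ℝ := CE / ((m ^ 2 : ℕ) : ℝ) with hc
  have hc' : c = CE / (m : ℝ) ^ 2 := by rw [hc]; push_cast; rfl
  have hc0 : 0 ≤ c := by rw [hc']; positivity
  have h1 : ∑ y ∈ Bm m, (greenZ 4 y) ^ 2 ≤
      ∑ y ∈ Bm m, (GT (m ^ 2) y * GT (m ^ 2) y + 2 * c * GT (m ^ 2) y + c ^ 2) := by
    refine Finset.sum_le_sum fun y _ => ?_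
    obtain ⟨ha, hb⟩ := green_split (m ^ 2) hT y
    have h0 := GT_nonneg (m ^ 2) y
    calc (greenZ 4 y) ^ 2 ≤ (GT (m ^ 2) y + c) ^ 2 := pow_le_pow_left₀ (h0.trans ha) hb 2
      _ = _ := by ring
  rw [Finset.sum_add_distrib, Finset.sum_add_distrib, ← Finset.mul_sum, Finset.sum_const, nsmul_eq_mul] at h1
  have h2 : ∑ y ∈ Bm m, GT (m ^ 2) y * GT (m ^ 2) y ≤ AA (2 * m ^ 2) := by
    refine ((GT_summ (m ^ 2) (GT (m ^ 2))).sum_le_tsum _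
      (fun y _ => mul_nonneg (GT_nonneg _ y) (GT_nonneg _ y))).trans ?_
    rw [GT_sq]
    exact diag_upper (fun u => pk ℤ u 0) (fun u => pk_nonneg u 0) (m ^ 2)
  have h3 : ∑ y ∈ Bm m, GT (m ^ 2) y ≤ (m : ℝ) ^ 2 := by
    refine ((GT_summable (m ^ 2)).sum_le_tsum _ (fun y _ => GT_nonneg _ y)).trans ?_
    rw [GT_sum]; push_cast; rfl
  have h4 : 2 * c * ∑ y ∈ Bm m, GT (m ^ 2) y ≤ 2 * CE := by
    calc 2 * c * ∑ y ∈ Bm m, GT (m ^ 2) y ≤ 2 * c * (m : ℝ) ^ 2 := by gcongr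
      _ = 2 * CE := by rw [hc']; field_simp
  have h5 : ((Bm m).card : ℝ) * c ^ 2 ≤ 81 * CE ^ 2 := by
    calc ((Bm m).card : ℝ) * c ^ 2 ≤ 81 * (m : ℝ) ^ 4 * c ^ 2 := by
          have := card_Bm m hm
          gcongr
      _ = 81 * CE ^ 2 := by rw [hc']; field_simp
  linarith

lemma ball_lower (m : ℕ) (hm : 1 ≤ m) :
    AA (m ^ 2) - 2 * CE ≤ ∑ y ∈ Bm m, (greenZ 4 y) ^ 2 := by
  have hm0 : (0 : ℝ) < m := by exact_mod_cast hm
  have hT : 0 < m ^ 2 := by positivity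
  have hC := CE_pos
  set T := m ^ 2 with hTd
  have hTr : (T : ℝ) = (m : ℝ) ^ 2 := by rw [hTd]; push_cast; rfl
  have h1 : ∑ y ∈ Bm m, GT T y * GT T y ≤ ∑ y ∈ Bm m, (greenZ 4 y) ^ 2 := by
    refine Finset.sum_le_sum fun y _ => ?_
    obtain ⟨ha, hb⟩ := green_split T hT y
    rw [← sq]
    exact pow_le_pow_left₀ (GT_nonneg _ y) ha 2
  have hind : ∑' y, (if y ∈ Bm m then GT T y * GT T y else 0) = ∑ y ∈ Bm m, GT T y * GT T y := by
    rw [tsum_eq_sum (s := Bm m) (fun y hy => if_neg hy)]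
    exact Finset.sum_congr rfl fun y hy => if_pos hy
  have hinds : Summable fun y => (if y ∈ Bm m then GT T y * GT T y else 0) :=
    summable_of_ne_finset_zero (s := Bm m) (fun y hy => if_neg hy)
  have h2 : ∑' y, (GT T y * GT T y - ((m : ℝ) ^ 2)⁻¹ * (GT T y * (sqn y * GT T y))) ≤
      ∑ y ∈ Bm m, GT T y * GT T y := by
    rw [← hind]
    refine Summable.tsum_le_tsum (fun y => ?_) ((GT_summ T (GT T)).sub ((GT_summ T (fun y => sqn y * GT T y)).mul_left _)) hinds
    have hg : 0 ≤ GT T y * GT T y := mul_nonneg (GT_nonneg _ y) (GT_nonneg _ y)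
    have hs : 0 ≤ sqn y := Finset.sum_nonneg fun i _ => sq_nonneg _
    have he : GT T y * GT T y - ((m : ℝ) ^ 2)⁻¹ * (GT T y * (sqn y * GT T y)) =
        (1 - sqn y / (m : ℝ) ^ 2) * (GT T y * GT T y) := by rw [div_eq_mul_inv]; ring
    rw [he]
    split_ifs with h
    · refine mul_le_of_le_one_left hg ?_
      have : 0 ≤ sqn y / (m : ℝ) ^ 2 := by positivity
      linarith
    · refine mul_nonpos_of_nonpos_of_nonneg ?_ hg
      rw [mem_Bm] at h
      have h' : (m : ℝ) ^ 2 ≤ sqn y := by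
        rw [sqn_cast]; push Not at h; exact_mod_cast h.le
      have : 1 ≤ sqn y / (m : ℝ) ^ 2 := (one_le_div (by positivity)).2 h'
      linarith
  rw [Summable.tsum_sub (GT_summ T (GT T)) ((GT_summ T (fun y => sqn y * GT T y)).mul_left _), tsum_mul_left, GT_sq] at h2
  have h3 := diag_lower (fun u => pk ℤ u 0) (fun u => pk_nonneg u 0) T
  have h4 : ∑ s ∈ Finset.range T, ∑ t ∈ Finset.range T, (s : ℝ) * pk ℤ (s + t) 0 ≤ 2 * (m : ℝ) ^ 2 * CE := by
    have ha : ∑ s ∈ Finset.range T, ∑ t ∈ Finset.range T, (s : ℝ) * pk ℤ (s + t) 0 ≤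
        ∑ s ∈ Finset.range T, ∑ t ∈ Finset.range T, (fun u : ℕ => (u : ℝ) * pk ℤ u 0) (s + t) := by
      refine Finset.sum_le_sum fun s _ => Finset.sum_le_sum fun t _ => ?_
      have := pk_nonneg (R := ℤ) (s + t) 0
      dsimp only
      push_cast
      have ht : (0 : ℝ) ≤ t := Nat.cast_nonneg t
      gcongr
      linarith
    have hb := diag_upper (fun u : ℕ => (u : ℝ) * pk ℤ u 0) (fun u => mul_nonneg (Nat.cast_nonneg u) (pk_nonneg u 0)) T
    have hc : ∑ u ∈ Finset.range (2 * T), ((u : ℝ) + 1) * ((u : ℝ) * pk ℤ u 0) ≤ ∑ u ∈ Finset.range (2 * T), CE :=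
      Finset.sum_le_sum fun u _ => uau_le u
    rw [Finset.sum_const, Finset.card_range, nsmul_eq_mul] at hc
    push_cast at hc
    rw [hTr] at hc
    linarith
  have h5 : ((m : ℝ) ^ 2)⁻¹ * ∑' y, GT T y * (sqn y * GT T y) ≤ 2 * CE := by
    calc ((m : ℝ) ^ 2)⁻¹ * ∑' y, GT T y * (sqn y * GT T y) ≤ ((m : ℝ) ^ 2)⁻¹ * (2 * (m : ℝ) ^ 2 * CE) := by
          refine mul_le_mul_of_nonneg_left ((GT_sqn T).trans h4) (by positivity)
      _ = 2 * CE := by field_simp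
  unfold AA
  linarith

end LatticeSum

section LocalCLT

def vphi (θ : Fin 4 → ℝ) : ℝ := 1 + (∑ i, (Real.cos (θ i) - 1)) / 8

def mu1 : Measure ℝ := (volume : Measure ℝ).restrict (Set.Ioc (-Real.pi) Real.pi)

instance mu1_fin : IsFiniteMeasure mu1 := by
  unfold mu1
  infer_instance

def mu4 : Measure (Fin 4 → ℝ) := Measure.pi fun _ => mu1

instance mu4_fin : IsFiniteMeasure mu4 := by
  unfold mu4
  infer_instance

def dotp (θ : Fin 4 → ℝ) (x : Fin 4 → ℤ) : ℝ := ∑ i, (x i : ℝ) * θ i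

lemma vphi_nonneg (θ : Fin 4 → ℝ) : 0 ≤ vphi θ := by
  unfold vphi
  have : ∑ i : Fin 4, (-2 : ℝ) ≤ ∑ i, (Real.cos (θ i) - 1) :=
    Finset.sum_le_sum fun i _ => by linarith [Real.neg_one_le_cos (θ i)]
  simp at this
  simp
  linarith

lemma vphi_le_one (θ : Fin 4 → ℝ) : vphi θ ≤ 1 := by
  unfold vphi
  have : ∑ i, (Real.cos (θ i) - 1) ≤ 0 :=
    Finset.sum_nonpos fun i _ => by linarith [Real.cos_le_one (θ i)]
  linarith

lemma vphi_cont : Continuous vphi := by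
  unfold vphi
  fun_prop

lemma dotp_cont (x : Fin 4 → ℤ) : Continuous fun θ => dotp θ x := by
  unfold dotp
  fun_prop

lemma int_integrable (t : ℕ) (x : Fin 4 → ℤ) : Integrable (fun θ => vphi θ ^ t * Real.cos (dotp θ x)) mu4 := by
  refine Integrable.of_bound ?_ 1 (Eventually.of_forall fun θ => ?_)
  · exact ((vphi_cont.pow t).mul (Real.continuous_cos.comp (dotp_cont x))).aestronglyMeasurable
  · rw [Real.norm_eq_abs, abs_mul, abs_pow, abs_of_nonneg (vphi_nonneg θ)]
    have h1 := pow_le_one₀ (n := t) (vphi_nonneg θ) (vphi_le_one θ)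
    have h2 := Real.abs_cos_le_one (dotp θ x)
    exact mul_le_one₀ h1 (abs_nonneg _) h2

lemma one_dim (k : ℤ) : ∫ s, Complex.exp ((k * Complex.I) * (s : ℂ)) ∂mu1 = if k = 0 then 2 * (Real.pi : ℂ) else 0 := by
  unfold mu1
  rw [← intervalIntegral.integral_of_le (by linarith [Real.pi_pos])]
  split_ifs with h
  · subst h
    simp
    ring
  · have hc : (k : ℂ) * Complex.I ≠ 0 := mul_ne_zero (by exact_mod_cast h) Complex.I_ne_zero
    rw [integral_exp_mul_complex hc]
    have : Complex.exp ((k : ℂ) * Complex.I * (Real.pi : ℝ)) = Complex.exp ((k : ℂ) * Complex.I * ((-Real.pi : ℝ) : ℂ)) := by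
      rw [Complex.exp_eq_exp_iff_exists_int]
      refine ⟨k, ?_⟩
      push_cast; ring
    rw [this, sub_self, zero_div]

lemma base_case (x : Fin 4 → ℤ) : ∫ θ, Real.cos (dotp θ x) ∂mu4 = (2 * Real.pi) ^ 4 * dl ℤ x := by
  have h := integral_fintype_prod_eq_prod (𝕜 := ℂ) (μ := fun _ : Fin 4 => mu1)
    (fun i (s : ℝ) => Complex.exp (((x i : ℤ) * Complex.I) * (s : ℂ)))
  simp only [one_dim] at h
  have h2 : ∀ θ : Fin 4 → ℝ, ∏ i, Complex.exp (((x i : ℤ) * Complex.I) * (θ i : ℂ)) =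
      Complex.exp ((dotp θ x : ℝ) * Complex.I) := by
    intro θ
    rw [← Complex.exp_sum]
    congr 1
    unfold dotp
    push_cast
    rw [Finset.sum_mul]
    refine Finset.sum_congr rfl fun i _ => by ring
  simp only [h2] at h
  have hint : Integrable (fun θ => Complex.exp ((dotp θ x : ℝ) * Complex.I)) mu4 := by
    refine Integrable.of_bound ?_ 1 (Eventually.of_forall fun θ => ?_)
    · have := dotp_cont x
      refine Continuous.aestronglyMeasurable ?_
      fun_prop
    · rw [Complex.norm_exp_ofReal_mul_I]
  have h3 := integral_re (𝕜 := ℂ) hint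
  simp only [RCLike.re_to_complex, Complex.exp_ofReal_mul_I_re] at h3
  rw [h3]
  unfold mu4
  rw [h]
  unfold dl
  split_ifs with hx
  · subst hx
    simp only [Pi.zero_apply, if_true, Finset.prod_const, Finset.card_univ, Fintype.card_fin]
    rw [mul_one, show ((2 * (Real.pi : ℂ)) ^ 4) = (((2 * Real.pi) ^ 4 : ℝ) : ℂ) by push_cast; rfl, Complex.ofReal_re]
  · obtain ⟨i, hi⟩ := Function.ne_iff.1 hx
    rw [Finset.prod_eq_zero (Finset.mem_univ i) (if_neg hi)]
    simp

lemma dotp_add (θ : Fin 4 → ℝ) (x : Fin 4 → ℤ) (i : Fin 4) : dotp θ (x + ev ℤ i) = dotp θ x + θ i := by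
  unfold dotp
  have : ∀ j, (((x + ev ℤ i) j : ℤ) : ℝ) * θ j = (x j : ℝ) * θ j + (if j = i then θ i else 0) := by
    intro j
    by_cases h : j = i
    · subst h; simp [ev]; ring
    · simp [ev, h]
  simp only [this]
  rw [Finset.sum_add_distrib, Finset.sum_ite_eq' Finset.univ i]
  simp

lemma dotp_sub (θ : Fin 4 → ℝ) (x : Fin 4 → ℤ) (i : Fin 4) : dotp θ (x - ev ℤ i) = dotp θ x - θ i := by
  have := dotp_add θ (x - ev ℤ i) i
  rw [sub_add_cancel] at this
  linarith

lemma pkZ_fourier (t : ℕ) (x : Fin 4 → ℤ) :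
    ∫ θ, vphi θ ^ t * Real.cos (dotp θ x) ∂mu4 = (2 * Real.pi) ^ 4 * pk ℤ t x := by
  induction t generalizing x with
  | zero =>
    simp only [pow_zero, one_mul]
    rw [base_case]; rfl
  | succ t ih =>
    rw [pk_succ]
    have h1 : ∀ θ, vphi θ ^ (t + 1) * Real.cos (dotp θ x) =
        (1 / 2) * (vphi θ ^ t * Real.cos (dotp θ x)) + ∑ i, (1 / 16) * (vphi θ ^ t * Real.cos (dotp θ (x + ev ℤ i)) +
          vphi θ ^ t * Real.cos (dotp θ (x - ev ℤ i))) := by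
      intro θ
      have : ∀ i, (1 / 16) * (vphi θ ^ t * Real.cos (dotp θ (x + ev ℤ i)) +
          vphi θ ^ t * Real.cos (dotp θ (x - ev ℤ i))) = (vphi θ ^ t * Real.cos (dotp θ x)) * ((Real.cos (θ i) - 1) / 8 + 1 / 8) := by
        intro i
        rw [dotp_add, dotp_sub, Real.cos_add, Real.cos_sub]; ring
      simp only [this]
      rw [← Finset.mul_sum, Finset.sum_add_distrib, ← Finset.sum_div]
      simp only [Finset.sum_const, Finset.card_univ, Fintype.card_fin]
      rw [pow_succ]
      nth_rewrite 2 [vphi]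
      simp
      ring
    have hI : ∀ i, Integrable (fun θ => (1 / 16) * (vphi θ ^ t * Real.cos (dotp θ (x + ev ℤ i)) +
          vphi θ ^ t * Real.cos (dotp θ (x - ev ℤ i)))) mu4 :=
      fun i => ((int_integrable t _).add (int_integrable t _)).const_mul _
    simp only [h1]
    rw [integral_add ((int_integrable t x).const_mul _) (integrable_finset_sum _ fun i _ => hI i),
      integral_finset_sum _ (fun i _ => hI i), integral_const_mul, ih]
    have h2 : ∀ i, ∫ θ, (1 / 16) * (vphi θ ^ t * Real.cos (dotp θ (x + ev ℤ i)) +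
          vphi θ ^ t * Real.cos (dotp θ (x - ev ℤ i))) ∂mu4 =
        (1 / 16) * ((2 * Real.pi) ^ 4 * pk ℤ t (x + ev ℤ i) + (2 * Real.pi) ^ 4 * pk ℤ t (x - ev ℤ i)) := by
      intro i
      rw [integral_const_mul, integral_add (int_integrable t _) (int_integrable t _), ih, ih]
    simp only [h2]
    unfold Pop
    rw [← Finset.mul_sum]
    simp only [← mul_add]
    rw [← Finset.mul_sum]
    ring

def bx : Set (Fin 4 → ℝ) := Set.univ.pi fun _ => Set.Ioc (-Real.pi) Real.pi

lemma bx_meas : MeasurableSet bx := MeasurableSet.univ_pi fun _ => measurableSet_Ioc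

lemma mu4_eq : mu4 = (volume : Measure (Fin 4 → ℝ)).restrict bx := by
  unfold mu4 mu1 bx
  rw [volume_pi, Measure.restrict_pi_pi]

lemma pkZ_zero_int (t : ℕ) :
    (2 * Real.pi) ^ 4 * pk ℤ t 0 = ∫ θ : Fin 4 → ℝ, bx.indicator (fun θ => vphi θ ^ t) θ := by
  rw [← pkZ_fourier, mu4_eq, integral_indicator bx_meas]
  have : ∀ θ, dotp θ 0 = 0 := fun θ => by simp [dotp]
  simp only [this, Real.cos_zero, mul_one]

lemma scaled_int (t : ℕ) : (2 * Real.pi) ^ 4 * ((t : ℝ) ^ 2 * pk ℤ t 0) =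
    ∫ η : Fin 4 → ℝ, bx.indicator (fun θ => vphi θ ^ t) ((√(t : ℝ))⁻¹ • η) := by
  have h := Measure.integral_comp_inv_smul (volume : Measure (Fin 4 → ℝ)) (bx.indicator (fun θ => vphi θ ^ t)) (√(t : ℝ))
  rw [h, ← pkZ_zero_int]
  have h4 : (√(t : ℝ)) ^ 4 = (t : ℝ) ^ 2 := by
    rw [show (4 : ℕ) = 2 * 2 by norm_num, pow_mul, Real.sq_sqrt (Nat.cast_nonneg t)]
  rw [Module.finrank_fintype_fun_eq_card, Fintype.card_fin, h4, abs_of_nonneg (by positivity), smul_eq_mul]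
  ring

lemma cos_lim (x : ℝ) : Tendsto (fun t : ℕ => (t : ℝ) * (Real.cos ((√(t : ℝ))⁻¹ * x) - 1)) atTop (nhds (-(x ^ 2 / 2))) := by
  have hs : Tendsto (fun t : ℕ => (√(t : ℝ))⁻¹ * x) atTop (nhds 0) := by
    have : Tendsto (fun t : ℕ => (√(t : ℝ))⁻¹) atTop (nhds 0) :=
      tendsto_inv_atTop_zero.comp (Real.tendsto_sqrt_atTop.comp tendsto_natCast_atTop_atTop)
    simpa using this.mul_const x
  have hev : ∀ᶠ t : ℕ in atTop, |(√(t : ℝ))⁻¹ * x| ≤ 1 := by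
    have := hs.abs
    rw [abs_zero] at this
    exact this.eventually_le_const (by norm_num)
  rw [tendsto_iff_norm_sub_tendsto_zero]
  have hz : Tendsto (fun t : ℕ => (x ^ 4 * (5 / 96)) / (t : ℝ)) atTop (nhds 0) :=
    tendsto_const_div_atTop_nhds_zero_nat _
  refine squeeze_zero' (Eventually.of_forall fun _ => norm_nonneg _) ?_ hz
  filter_upwards [hev, eventually_gt_atTop 0] with t ht h0
  have h0' : (0 : ℝ) < t := by exact_mod_cast h0
  have hb := Real.cos_bound ht
  set y := (√(t : ℝ))⁻¹ * x with hy
  have hy2 : y ^ 2 = x ^ 2 / t := by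
    rw [hy, mul_pow, inv_pow, Real.sq_sqrt h0'.le]; ring
  have hy4 : |y| ^ 4 = x ^ 4 / (t : ℝ) ^ 2 := by
    rw [show (4 : ℕ) = 2 * 2 by norm_num, pow_mul, sq_abs, hy2]; ring
  rw [hy4, hy2] at hb
  have he : (t : ℝ) * (Real.cos y - 1) - -(x ^ 2 / 2) = t * (Real.cos y - (1 - x ^ 2 / t / 2)) := by
    field_simp; ring
  rw [he, Real.norm_eq_abs, abs_mul, abs_of_pos h0']
  calc (t : ℝ) * |Real.cos y - (1 - x ^ 2 / t / 2)| ≤ t * (x ^ 4 / (t : ℝ) ^ 2 * (5 / 96)) := by gcongr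
    _ = _ := by field_simp

lemma bx_ev (η : Fin 4 → ℝ) : ∀ᶠ t : ℕ in atTop, (√(t : ℝ))⁻¹ • η ∈ bx := by
  have : ∀ i, ∀ᶠ t : ℕ in atTop, |(√(t : ℝ))⁻¹ * η i| < Real.pi := by
    intro i
    have h1 : Tendsto (fun t : ℕ => (√(t : ℝ))⁻¹) atTop (nhds 0) :=
      tendsto_inv_atTop_zero.comp (Real.tendsto_sqrt_atTop.comp tendsto_natCast_atTop_atTop)
    have h2 := (h1.mul_const (η i)).abs
    rw [zero_mul, abs_zero] at h2
    exact h2.eventually_lt_const Real.pi_pos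
  filter_upwards [eventually_all.2 this] with t ht
  intro i _
  have := abs_lt.1 (ht i)
  exact ⟨this.1, this.2.le⟩

lemma gaussian_bound (t : ℕ) (ht : 0 < t) (η : Fin 4 → ℝ) :
    ‖bx.indicator (fun θ => vphi θ ^ t) ((√(t : ℝ))⁻¹ • η)‖ ≤ ∏ i, Real.exp (-(1 / (4 * Real.pi ^ 2)) * η i ^ 2) := by
  have hpi := Real.pi_pos
  have h0' : (0 : ℝ) < t := by exact_mod_cast ht
  by_cases h : (√(t : ℝ))⁻¹ • η ∈ bx
  · rw [Set.indicator_of_mem h, Real.norm_eq_abs, abs_of_nonneg (pow_nonneg (vphi_nonneg _) t), ← Real.exp_sum]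
    have h1 : vphi ((√(t : ℝ))⁻¹ • η) ≤ Real.exp (∑ i, (-(1 / (4 * Real.pi ^ 2)) * (η i ^ 2 / t))) := by
      refine le_trans ?_ (Real.add_one_le_exp _)
      unfold vphi
      rw [Finset.sum_div, add_comm]
      gcongr with i
      have hi := h i trivial
      have hc := Real.cos_le_one_sub_mul_cos_sq (x := ((√(t : ℝ))⁻¹ • η) i) (abs_le.2 ⟨hi.1.le, hi.2⟩)
      have hy2 : (((√(t : ℝ))⁻¹ • η) i) ^ 2 = η i ^ 2 / t := by
        rw [Pi.smul_apply, smul_eq_mul, mul_pow, inv_pow, Real.sq_sqrt h0'.le]; ring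
      rw [hy2] at hc
      have : -(1 / (4 * Real.pi ^ 2)) * (η i ^ 2 / t) = (-(2 / Real.pi ^ 2 * (η i ^ 2 / t))) / 8 := by
        field_simp; ring
      rw [this]
      gcongr
      linarith
    calc vphi ((√(t : ℝ))⁻¹ • η) ^ t ≤ (Real.exp (∑ i, (-(1 / (4 * Real.pi ^ 2)) * (η i ^ 2 / t)))) ^ t :=
          pow_le_pow_left₀ (vphi_nonneg _) h1 t
      _ = _ := by
          rw [← Real.exp_nat_mul, Finset.mul_sum]
          congr 1
          refine Finset.sum_congr rfl fun i _ => ?_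
          field_simp
  · rw [Set.indicator_of_notMem h, norm_zero]
    exact Finset.prod_nonneg fun i _ => (Real.exp_pos _).le

lemma vphi_lim (η : Fin 4 → ℝ) : Tendsto (fun t : ℕ => bx.indicator (fun θ => vphi θ ^ t) ((√(t : ℝ))⁻¹ • η))
    atTop (nhds (∏ i, Real.exp (-(1 / 16) * η i ^ 2))) := by
  have h1 : Tendsto (fun t : ℕ => vphi ((√(t : ℝ))⁻¹ • η) ^ t) atTop (nhds (∏ i, Real.exp (-(1 / 16) * η i ^ 2))) := by
    rw [← Real.exp_sum]
    unfold vphi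
    refine Real.tendsto_one_add_pow_exp_of_tendsto ?_
    have h2 : Tendsto (fun t : ℕ => (∑ i, (t : ℝ) * (Real.cos ((√(t : ℝ))⁻¹ * η i) - 1)) / 8) atTop
        (nhds ((∑ i, -(η i ^ 2 / 2)) / 8)) := (tendsto_finset_sum _ fun i _ => cos_lim (η i)).div_const 8
    have he : (∑ i, -(η i ^ 2 / 2)) / 8 = ∑ i, -(1 / 16) * η i ^ 2 := by
      rw [Finset.sum_div]
      refine Finset.sum_congr rfl fun i _ => by ring
    rw [he] at h2
    refine h2.congr fun t => ?_
    rw [← Finset.mul_sum, mul_div_assoc]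
    rfl
  refine h1.congr' ?_
  filter_upwards [bx_ev η] with t ht
  rw [Set.indicator_of_mem ht]

def C0 : ℝ := (∫ η : Fin 4 → ℝ, ∏ i, Real.exp (-(1 / 16) * η i ^ 2)) / (2 * Real.pi) ^ 4

lemma C0_pos : 0 < C0 := by
  unfold C0
  rw [integral_fintype_prod_volume_eq_prod (𝕜 := ℝ) (fun (_ : Fin 4) (s : ℝ) => Real.exp (-(1 / 16) * s ^ 2))]
  have hpi := Real.pi_pos
  refine div_pos (Finset.prod_pos fun i _ => ?_) (by positivity)
  rw [integral_gaussian]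
  positivity

lemma lclt : Tendsto (fun t : ℕ => (t : ℝ) ^ 2 * pk ℤ t 0) atTop (nhds C0) := by
  have hpi := Real.pi_pos
  have h : Tendsto (fun t : ℕ => ∫ η : Fin 4 → ℝ, bx.indicator (fun θ => vphi θ ^ (t + 1)) ((√((t + 1 : ℕ) : ℝ))⁻¹ • η))
      atTop (nhds (∫ η : Fin 4 → ℝ, ∏ i, Real.exp (-(1 / 16) * η i ^ 2))) := by
    refine tendsto_integral_of_dominated_convergence
      (fun η => ∏ i, Real.exp (-(1 / (4 * Real.pi ^ 2)) * η i ^ 2)) ?_ ?_ ?_ ?_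
    · intro t
      have h1 : Measurable (bx.indicator (fun θ => vphi θ ^ (t + 1))) :=
        ((vphi_cont.pow (t + 1)).measurable).indicator bx_meas
      exact (h1.comp (measurable_const_smul _)).aestronglyMeasurable
    · rw [volume_pi]
      exact Integrable.fintype_prod (f := fun (_ : Fin 4) (s : ℝ) => Real.exp (-(1 / (4 * Real.pi ^ 2)) * s ^ 2))
        (fun i => integrable_exp_neg_mul_sq (by positivity))
    · exact fun t => Eventually.of_forall fun η => gaussian_bound (t + 1) (by omega) η
    · exact Eventually.of_forall fun η => (tendsto_add_atTop_iff_nat 1).2 (vphi_lim η)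
  have h2 := (tendsto_add_atTop_iff_nat (f := fun t : ℕ => ∫ η : Fin 4 → ℝ, bx.indicator (fun θ => vphi θ ^ t) ((√(t : ℝ))⁻¹ • η)) 1).1 h
  have h3 := h2.div_const ((2 * Real.pi) ^ 4)
  refine h3.congr fun t => ?_
  rw [← scaled_int]
  field_simp

end LocalCLT

section Asym

lemma a_lim : Tendsto (fun u : ℕ => ((u : ℝ) + 1) ^ 2 * pk ℤ u 0) atTop (nhds C0) := by
  have hz : Tendsto (fun u : ℕ => (2 * (u : ℝ) + 1) * pk ℤ u 0) atTop (nhds 0) := by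
    have h1 : Tendsto (fun u : ℕ => 2 * CE * (1 / ((u : ℝ) + 1))) atTop (nhds 0) := by
      simpa using (tendsto_one_div_add_atTop_nhds_zero_nat (𝕜 := ℝ)).const_mul (2 * CE)
    refine squeeze_zero (fun u => mul_nonneg (by positivity) (pk_nonneg u 0)) (fun u => ?_) h1
    have hE := pkZ_E2 u
    have hC := CE_pos
    calc (2 * (u : ℝ) + 1) * pk ℤ u 0 ≤ (2 * ((u : ℝ) + 1)) * (CE / ((u : ℝ) + 1) ^ 2) := by
          have := pk_nonneg (R := ℤ) u 0
          gcongr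
          linarith
      _ = _ := by field_simp
  have h := lclt.add hz
  rw [add_zero] at h
  refine h.congr fun u => by ring

lemma harm_lim : Tendsto (fun n : ℕ => (∑ i ∈ Finset.range n, 1 / ((i : ℝ) + 1)) / Real.log n) atTop (nhds 1) := by
  have hl : Tendsto (fun n : ℕ => Real.log n) atTop atTop := Real.tendsto_log_atTop.comp tendsto_natCast_atTop_atTop
  have h1 := (Real.tendsto_harmonic_sub_log.div_atTop hl).const_add 1
  rw [add_zero] at h1
  refine h1.congr' ?_
  filter_upwards [hl.eventually_gt_atTop 0] with n hn
  have : ((harmonic n : ℚ) : ℝ) = ∑ i ∈ Finset.range n, 1 / ((i : ℝ) + 1) := by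
    unfold harmonic
    push_cast
    simp only [one_div]
  rw [this]
  field_simp
  ring

lemma AA_lim : Tendsto (fun T : ℕ => AA T / Real.log T) atTop (nhds C0) := by
  have hl : Tendsto (fun n : ℕ => Real.log n) atTop atTop := Real.tendsto_log_atTop.comp tendsto_natCast_atTop_atTop
  have h1 : (fun u : ℕ => ((u : ℝ) + 1) * pk ℤ u 0 - C0 * (1 / ((u : ℝ) + 1))) =o[atTop] (fun u : ℕ => 1 / ((u : ℝ) + 1)) := by
    rw [Asymptotics.isLittleO_iff_tendsto (fun u hu => by
      have : (1 : ℝ) / ((u : ℝ) + 1) ≠ 0 := by positivity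
      exact absurd hu this)]
    have h := a_lim.sub_const C0
    rw [sub_self] at h
    refine h.congr fun u => ?_
    have : (u : ℝ) + 1 ≠ 0 := by positivity
    field_simp
  have hH : Tendsto (fun n : ℕ => ∑ i ∈ Finset.range n, 1 / ((i : ℝ) + 1)) atTop atTop :=
    Real.tendsto_sum_range_one_div_nat_succ_atTop
  have h2 := h1.sum_range (fun u => by show (0 : ℝ) ≤ 1 / ((u : ℝ) + 1); positivity) hH
  have h3 := h2.tendsto_div_nhds_zero
  have h4 := (h3.add_const C0).mul harm_lim
  rw [zero_add, mul_one] at h4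
  refine h4.congr' ?_
  filter_upwards [hl.eventually_gt_atTop 0, hH.eventually_gt_atTop 0] with n hn hn2
  unfold AA
  rw [Finset.sum_sub_distrib, ← Finset.mul_sum]
  field_simp
  ring

lemma AA_sq : Tendsto (fun m : ℕ => AA (m ^ 2) / Real.log m) atTop (nhds (2 * C0)) := by
  have hp : Tendsto (fun m : ℕ => m ^ 2) atTop atTop := tendsto_pow_atTop (by norm_num)
  have h := (AA_lim.comp hp).const_mul 2
  refine h.congr fun m => ?_
  simp only [Function.comp]
  push_cast
  rw [Real.log_pow]
  push_cast
  by_cases h0 : Real.log (m : ℝ) = 0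
  · simp [h0]
  · field_simp

lemma AA_two_sq : Tendsto (fun m : ℕ => AA (2 * m ^ 2) / Real.log m) atTop (nhds (2 * C0)) := by
  have hl : Tendsto (fun n : ℕ => Real.log n) atTop atTop := Real.tendsto_log_atTop.comp tendsto_natCast_atTop_atTop
  have hp : Tendsto (fun m : ℕ => 2 * m ^ 2) atTop atTop :=
    (tendsto_pow_atTop (by norm_num : (2 : ℕ) ≠ 0)).const_mul_atTop' (by norm_num)
  have h1 : Tendsto (fun m : ℕ => Real.log 2 / Real.log m + 2) atTop (nhds 2) := by
    simpa using (hl.const_div_atTop (Real.log 2)).add_const 2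
  have h := (AA_lim.comp hp).mul h1
  rw [mul_comm C0 2] at h
  refine h.congr' ?_
  filter_upwards [hl.eventually_gt_atTop 0, eventually_gt_atTop 0] with m hm hm0
  have hm0' : (m : ℝ) ≠ 0 := by positivity
  simp only [Function.comp]
  push_cast
  rw [Real.log_mul (by norm_num) (by positivity), Real.log_pow]
  push_cast
  have h2 : 0 < Real.log 2 := Real.log_pos (by norm_num)
  have h3 : Real.log 2 + 2 * Real.log m ≠ 0 := by positivity
  field_simp

lemma ball_lim : Tendsto (fun m : ℕ => (∑ y ∈ Bm m, (greenZ 4 y) ^ 2) / Real.log m) atTop (nhds (2 * C0)) := by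
  have hl : Tendsto (fun n : ℕ => Real.log n) atTop atTop := Real.tendsto_log_atTop.comp tendsto_natCast_atTop_atTop
  have hA := AA_sq.sub (hl.const_div_atTop (2 * CE))
  have hB := AA_two_sq.add (hl.const_div_atTop (2 * CE + 81 * CE ^ 2))
  rw [sub_zero] at hA
  rw [add_zero] at hB
  refine tendsto_of_tendsto_of_tendsto_of_le_of_le' hA hB ?_ ?_
  · filter_upwards [hl.eventually_gt_atTop 0, eventually_ge_atTop 1] with m hm hm1
    rw [← sub_div]
    gcongr
    exact ball_lower m hm1
  · filter_upwards [hl.eventually_gt_atTop 0, eventually_ge_atTop 1] with m hm hm1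
    rw [← add_div]
    gcongr
    exact ball_upper m hm1

lemma logn_lim : Tendsto (fun n : ℕ => Real.log ((n : ℝ) + 1)) atTop atTop :=
  Real.tendsto_log_atTop.comp (tendsto_atTop_add_const_right _ 1 tendsto_natCast_atTop_atTop)

lemma kk_lim : Tendsto (fun n : ℕ => kk (n + 1) 0 / Real.log ((n : ℝ) + 1)) atTop (nhds (2 * C0)) := by
  have hS : Tendsto (fun n : ℕ => AA ((n + 1) ^ 2) / Real.log ((n : ℝ) + 1)) atTop (nhds (2 * C0)) := by
    have := (tendsto_add_atTop_iff_nat 1).2 AA_sq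
    refine this.congr fun n => ?_
    push_cast; rfl
  have hA := hS.sub (logn_lim.const_div_atTop 1)
  have hB := hS.add (logn_lim.const_div_atTop (2 * CE + 1))
  rw [sub_zero] at hA
  rw [add_zero] at hB
  refine tendsto_of_tendsto_of_tendsto_of_le_of_le' hA hB ?_ ?_
  · filter_upwards [logn_lim.eventually_gt_atTop 0] with n hn
    rw [← sub_div]
    gcongr
    exact kk_lower (n + 1)
  · filter_upwards [logn_lim.eventually_gt_atTop 0] with n hn
    rw [← add_div]
    gcongr
    exact kk_upper (n + 1)

lemma err_lim (a b : ℝ) : Tendsto (fun n : ℕ =>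
    ((1 + (√(Real.log ((n : ℝ) + 1)))⁻¹) * (a + 2 * gg (n + 1) 0)) / Real.log ((n : ℝ) + 1) +
    (√(Real.log ((n : ℝ) + 1)))⁻¹ * |kk (n + 1) 0 / Real.log ((n : ℝ) + 1)| +
    ((Real.log ((n : ℝ) + 1))⁻¹ + (√(Real.log ((n : ℝ) + 1)))⁻¹) * b) atTop (nhds 0) := by
  have hi : Tendsto (fun n : ℕ => (√(Real.log ((n : ℝ) + 1)))⁻¹) atTop (nhds 0) :=
    tendsto_inv_atTop_zero.comp (Real.tendsto_sqrt_atTop.comp logn_lim)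
  have hj : Tendsto (fun n : ℕ => (Real.log ((n : ℝ) + 1))⁻¹) atTop (nhds 0) :=
    tendsto_inv_atTop_zero.comp logn_lim
  have h1 := ((hi.const_add 1).mul ((gg_tendsto.const_mul 2).const_add a)).div_atTop logn_lim
  have h2 := hi.mul kk_lim.abs
  have h3 := (hj.add hi).mul_const b
  have h := (h1.add h2).add h3
  simpa using h

lemma main_bound {n : ℕ} (hn : 2 ≤ n) {Ω : Type} [MeasurableSpace Ω] {P : Measure Ω} [IsProbabilityMeasure P]
    {X₁ X₂ : ℕ → Ω → (Fin 4 → ZMod (n + 1))} {ξ : (Fin 4 → ZMod (n + 1)) → Ω → Bool}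
    (hs : IsPaintSetup (torus 4 (n + 1)) P X₁ X₂ ξ) :
    |4 * gg (n + 1) 0 ^ 2 * (variance (fun ω => (paintedCount X₁ X₂ ξ ω : ℝ)) P / ((n + 1 : ℝ) ^ 4 * Real.log (n + 1)))
      - kk (n + 1) 0 / Real.log ((n : ℝ) + 1)| ≤
    ((1 + (√(Real.log ((n : ℝ) + 1)))⁻¹) * ((3 * (2 * CE + 3) ^ 2 + 6 * (2 + CE)) + 2 * gg (n + 1) 0)) / Real.log ((n : ℝ) + 1) +
    (√(Real.log ((n : ℝ) + 1)))⁻¹ * |kk (n + 1) 0 / Real.log ((n : ℝ) + 1)| +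
    ((Real.log ((n : ℝ) + 1))⁻¹ + (√(Real.log ((n : ℝ) + 1)))⁻¹) * (6 * (2 * CE + 3) ^ 2 + 1) := by
  have hn' : (2 : ℝ) ≤ n := by exact_mod_cast hn
  have hL : 0 < Real.log ((n : ℝ) + 1) := Real.log_pos (by linarith)
  set L := Real.log ((n : ℝ) + 1) with hLd
  have hsq : 0 < √L := Real.sqrt_pos.2 hL
  have h := partA (torus_GK (n := n + 1) (by omega)) hs (ε := (√L)⁻¹) (by positivity)
  rw [card_torus] at h
  push_cast at h
  set N : ℝ := ((n : ℝ) + 1) ^ 4 with hN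
  have hN1 : 1 ≤ N := one_le_pow₀ (by linarith)
  have hN0 : 0 < N := by linarith
  have hm2 : ((2 * CE + 3) * ((n : ℝ) + 1) ^ 2) ^ 2 = (2 * CE + 3) ^ 2 * N := by rw [hN]; ring
  rw [hm2, inv_inv] at h
  set V := variance (fun ω => (paintedCount X₁ X₂ ξ ω : ℝ)) P
  set g := gg (n + 1) 0
  set k := kk (n + 1) 0
  have hNL : 0 < N * L := by positivity
  have e1 : 4 * g ^ 2 * (V / (N * L)) - k / L = (4 * g ^ 2 * V - N * k) / (N * L) := by field_simp
  rw [e1, abs_div, abs_of_pos hNL, div_le_iff₀ hNL]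
  refine h.trans ?_
  have e2 : |N * k| = N * |k| := by rw [abs_mul, abs_of_pos hN0]
  have e3 : |k / L| = |k| / L := by rw [abs_div, abs_of_pos hL]
  rw [e2, e3]
  have e4 : (L⁻¹ + (√L)⁻¹) * L = 1 + √L := by
    have : (√L)⁻¹ * L = √L := by
      nth_rewrite 2 [← Real.mul_self_sqrt hL.le]
      field_simp
    rw [add_mul, this, inv_mul_cancel₀ hL.ne']
  have e5 : ((1 + (√L)⁻¹) * ((3 * (2 * CE + 3) ^ 2 + 6 * (2 + CE)) + 2 * g) / L + (√L)⁻¹ * (|k| / L) +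
      (L⁻¹ + (√L)⁻¹) * (6 * (2 * CE + 3) ^ 2 + 1)) * (N * L) =
      (1 + (√L)⁻¹) * (3 * ((2 * CE + 3) ^ 2 * N) + 6 * ((2 + CE) * N) + 2 * (N * g)) + (√L)⁻¹ * (N * |k|) +
      ((L⁻¹ + (√L)⁻¹) * L) * ((6 * (2 * CE + 3) ^ 2 + 1) * N) := by
    field_simp
  rw [e5, e4]
  have e6 : (1 + √L) * (6 * ((2 * CE + 3) ^ 2 * N) + 1) ≤ (1 + √L) * ((6 * (2 * CE + 3) ^ 2 + 1) * N) := by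
    gcongr
    linarith
  linarith

end Asym

end Helpers

/-- For `d = 4`, the limit
`α₄ = lim_m (1/(G(0;ℤ⁴)² log m)) ∑_{|y| ≤ m} G(y;ℤ⁴)²` exists, is positive and
finite, and on the torus `ℤ_n⁴`, `Var(|𝒜_i|)/(n⁴ log n) → α₄/4`. -/
theorem painting_variance_tori_dim_four
    (Ω : ℕ → Type) [∀ n, MeasurableSpace (Ω n)]
    (P : ∀ n, Measure (Ω n)) (hP : ∀ n, IsProbabilityMeasure (P n))
    (X₁ X₂ : ∀ n, ℕ → Ω n → (Fin 4 → ZMod (n + 1)))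
    (ξ : ∀ n, (Fin 4 → ZMod (n + 1)) → Ω n → Bool)
    (hsetup : ∀ n, IsPaintSetup (torus 4 (n + 1)) (P n) (X₁ n) (X₂ n) (ξ n)) :
    ∃ α : ℝ, 0 < α ∧
      Tendsto (fun m : ℕ =>
          (∑' y : Fin 4 → ℤ, if (∑ i, (y i) ^ 2) ≤ (m : ℤ) ^ 2 then (greenZ 4 y) ^ 2 else 0)
            / ((greenZ 4 0) ^ 2 * Real.log m))
        atTop (nhds α) ∧
      Tendsto (fun n =>
          variance (fun ω => (paintedCount (X₁ n) (X₂ n) (ξ n) ω : ℝ)) (P n)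
            / ((n + 1 : ℝ) ^ 4 * Real.log (n + 1)))
        atTop (nhds (α / 4)) := by
  refine ⟨2 * C0 / (greenZ 4 0) ^ 2, div_pos (by linarith [C0_pos]) (pow_pos greenZ_pos 2), ?_, ?_⟩
  · have h := ball_lim.div_const ((greenZ 4 0) ^ 2)
    refine h.congr fun m => ?_
    rw [ball_tsum, div_div, mul_comm (Real.log m)]
  · have hG := greenZ_pos
    have h0 : Tendsto (fun n : ℕ => 4 * gg (n + 1) 0 ^ 2 *
        (variance (fun ω => (paintedCount (X₁ n) (X₂ n) (ξ n) ω : ℝ)) (P n) / ((n + 1 : ℝ) ^ 4 * Real.log (n + 1)))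
        - kk (n + 1) 0 / Real.log ((n : ℝ) + 1)) atTop (nhds 0) := by
      refine squeeze_zero_norm' ?_ (err_lim (3 * (2 * CE + 3) ^ 2 + 6 * (2 + CE)) (6 * (2 * CE + 3) ^ 2 + 1))
      filter_upwards [eventually_ge_atTop 2] with n hn
      have := hP n
      exact main_bound hn (hsetup n)
    have h1 := h0.add kk_lim
    have h2 : Tendsto (fun n : ℕ => 4 * gg (n + 1) 0 ^ 2) atTop (nhds (4 * (greenZ 4 0) ^ 2)) :=
      (gg_tendsto.pow 2).const_mul 4
    have h3 := h1.div h2 (by positivity)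
    have e : (0 + 2 * C0) / (4 * (greenZ 4 0) ^ 2) = 2 * C0 / (greenZ 4 0) ^ 2 / 4 := by
      field_simp; ring
    rw [e] at h3
    refine h3.congr' ?_
    filter_upwards [h2.eventually_const_lt (show (0 : ℝ) < 4 * (greenZ 4 0) ^ 2 by positivity)] with n hn
    simp only [Pi.div_apply, sub_add_cancel]
    rw [mul_div_cancel_left₀ _ hn.ne']

end RWPaint
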